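/- arXiv:2004.04766 — 4 statements merged into one kernel-verified Lean document; each statement's English description precedes it below -/
import Mathlib

section
/- There exists an absolute constant h = ∏_p (1 + 1/(p(p−1))) such that, uniformly for positive integers n and real R ≥ 1, T(R,n) := ∑_{r ≤ R, gcd(r,n)=1} 1/φ(r) = h·g(n)·(log R + λ + ϑ(n)) + O(b_{1/2}(n)/R^{2/7}), where λ := γ − ∑_p (log p)/(1 + p(p−1)), g(n) := ∏_{p|n} 1/(1 + p/(p−1)²), and ϑ(n) := ∑_{p|n} p² log p /((p−1)(p²−p+1)). -/
open Finset Real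

/-- `h := ∏_p (1 + 1/(p(p−1)))`. -/
noncomputable def hConst : ℝ :=
  ∏' p : Nat.Primes, (1 + 1 / ((p : ℝ) * ((p : ℝ) - 1)))

/-- `λ := γ − ∑_p (log p)/(1 + p(p−1))`. -/
noncomputable def lamConst : ℝ :=
  Real.eulerMascheroniConstant -
    ∑' p : Nat.Primes, Real.log (p : ℝ) / (1 + (p : ℝ) * ((p : ℝ) - 1))

/-- `g(n) := ∏_{p ∣ n} 1/(1 + p/(p−1)²)`. -/
noncomputable def gFunc (n : ℕ) : ℝ :=
  ∏ p ∈ n.primeFactors, (1 + (p : ℝ) / ((p : ℝ) - 1) ^ 2)⁻¹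

/-- `ϑ(n) := ∑_{p ∣ n} p² log p / ((p−1)(p²−p+1))`. -/
noncomputable def thetaFunc (n : ℕ) : ℝ :=
  ∑ p ∈ n.primeFactors,
    (p : ℝ) ^ 2 * Real.log (p : ℝ) / (((p : ℝ) - 1) * ((p : ℝ) ^ 2 - (p : ℝ) + 1))

/-- `b α n = ∏_{p ∣ n} (1 + 1/p^α)`. -/
noncomputable def bFactor (α : ℝ) (n : ℕ) : ℝ :=
  ∏ p ∈ n.primeFactors, (1 + (p : ℝ) ^ (-α))

/-- The multiplicative function supported on squarefree integers with prime values `c p`. -/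
noncomputable def sqfreeMul (c : ℕ → ℝ) (d : ℕ) : ℝ :=
  if Squarefree d then ∏ p ∈ d.primeFactors, c p else 0

theorem sqfreeMul_zero (c : ℕ → ℝ) : sqfreeMul c 0 = 0 := by simp [sqfreeMul]

theorem sqfreeMul_one (c : ℕ → ℝ) : sqfreeMul c 1 = 1 := by simp [sqfreeMul]

theorem sqfreeMul_nonneg {c : ℕ → ℝ} (hc : ∀ p, 0 ≤ c p) (d : ℕ) : 0 ≤ sqfreeMul c d := by
  unfold sqfreeMul
  split_ifs
  · exact prod_nonneg fun p _ ↦ hc p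
  · rfl

theorem sqfreeMul_mul_of_coprime (c : ℕ → ℝ) {m n : ℕ} (h : m.Coprime n) :
    sqfreeMul c (m * n) = sqfreeMul c m * sqfreeMul c n := by
  simp only [sqfreeMul, Nat.squarefree_mul h, h.primeFactors_mul,
    prod_union h.disjoint_primeFactors]
  split_ifs <;> simp_all

theorem sqfreeMul_prime (c : ℕ → ℝ) {p : ℕ} (hp : p.Prime) : sqfreeMul c p = c p := by
  simp [sqfreeMul, hp.squarefree, hp.primeFactors]

theorem abs_sqfreeMul (c : ℕ → ℝ) (d : ℕ) : |sqfreeMul c d| = sqfreeMul (fun p ↦ |c p|) d := by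
  unfold sqfreeMul
  split_ifs
  · exact abs_prod _ _
  · simp

theorem sqfreeMul_mul_rpow (c : ℕ → ℝ) (t : ℝ) (d : ℕ) :
    sqfreeMul (fun p ↦ c p * (p : ℝ) ^ t) d = sqfreeMul c d * (d : ℝ) ^ t := by
  unfold sqfreeMul
  split_ifs with h
  · conv_rhs => rw [← Nat.prod_primeFactors_of_squarefree h]
    push_cast
    rw [prod_mul_distrib, ← Real.finsetProd_rpow _ _ fun i _ ↦ Nat.cast_nonneg i,
      Nat.prod_primeFactors_of_squarefree h]
  · simp

theorem sum_divisors_sqfreeMul (c : ℕ → ℝ) {n : ℕ} (hn : n ≠ 0) :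
    ∑ d ∈ n.divisors, sqfreeMul c d = ∏ p ∈ n.primeFactors, (1 + c p) := by
  simp only [sqfreeMul]
  rw [← sum_filter, Nat.sum_divisors_filter_squarefree hn, prod_one_add]
  have hn' : (UniqueFactorizationMonoid.normalizedFactors n).toFinset = n.primeFactors := by
    rw [Nat.factors_eq]; rfl
  rw [hn']
  refine sum_congr rfl fun s hs ↦ ?_
  have hs' : ∀ p ∈ s, p.Prime := fun p hp ↦ Nat.prime_of_mem_primeFactors (mem_powerset.mp hs hp)
  rw [Finset.prod_val]
  exact prod_congr (Nat.primeFactors_prod hs') fun _ _ ↦ rfl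

theorem sum_range_sqfreeMul_le {c : ℕ → ℝ} (hc : ∀ p, 0 ≤ c p) (N : ℕ) :
    ∑ d ∈ range N, sqfreeMul c d ≤ ∏ p ∈ Nat.primesLE N, (1 + c p) := by
  rw [← primeFactors_primorial, ← sum_divisors_sqfreeMul c (primorial_ne_zero N)]
  have : ∑ d ∈ range N, sqfreeMul c d = ∑ d ∈ range N with Squarefree d, sqfreeMul c d := by
    rw [sum_filter]
    exact sum_congr rfl fun d _ ↦ by simp only [sqfreeMul]; split_ifs <;> rfl
  rw [this]
  refine sum_le_sum_of_subset_of_nonneg (fun d hd ↦ ?_) fun d _ _ ↦ sqfreeMul_nonneg hc d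
  obtain ⟨hdN, hd⟩ := mem_filter.mp hd
  rw [Nat.mem_divisors]
  refine ⟨?_, primorial_ne_zero N⟩
  rw [← Nat.prod_primeFactors_of_squarefree hd]
  refine prod_dvd_prod_of_subset _ _ _ fun p hp ↦ ?_
  have := Nat.le_of_mem_primeFactors hp
  have := Nat.prime_of_mem_primeFactors hp
  simp at hdN ⊢
  grind

theorem hasProd_sqfreeMul {c : ℕ → ℝ} (hs : Summable fun d ↦ |sqfreeMul c d|) :
    HasProd (fun p : Nat.Primes ↦ 1 + c p) (∑' d, sqfreeMul c d) := by
  convert! EulerProduct.eulerProduct_hasProd (sqfreeMul_one c)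
    (fun {m n} h ↦ sqfreeMul_mul_of_coprime c h) hs (sqfreeMul_zero c) using 2 with p
  rw [tsum_eq_sum (s := range 2)]
  · simp [sum_range_succ, sqfreeMul_one, sqfreeMul_prime c p.2]
  · intro e he
    have : ¬ Squarefree ((p : ℕ) ^ e) := by
      rw [Nat.squarefree_pow_iff p.2.ne_one (by grind)]
      grind
    simp [sqfreeMul, this]

theorem tsum_sqfreeMul_dvd {c : ℕ → ℝ} (hs : Summable fun d ↦ |sqfreeMul c d|) {p : ℕ}
    (hp : p.Prime) (hc : 1 + c p ≠ 0) :
    ∑' d, (if p ∣ d then sqfreeMul c d else 0) = c p / (1 + c p) * ∑' d, sqfreeMul c d := by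
  have hs' : Summable (sqfreeMul c) := hs.of_abs
  have hmul : ∑' d, (if p ∣ d then sqfreeMul c d else 0) = ∑' m, sqfreeMul c (p * m) := by
    rw [← (mul_right_injective₀ hp.ne_zero).tsum_eq
      (f := fun d ↦ if p ∣ d then sqfreeMul c d else 0)]
    · simp
    · intro d hd
      by_contra h
      apply hd
      simp only
      rw [if_neg]
      rintro ⟨m, rfl⟩
      exact h ⟨m, rfl⟩
  have hval (m : ℕ) : sqfreeMul c (p * m) = c p * (if p ∣ m then 0 else sqfreeMul c m) := by
    split_ifs with h
    · rw [mul_zero, sqfreeMul, if_neg]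
      intro h'
      obtain ⟨k, rfl⟩ := h
      exact hp.ne_one (Nat.isUnit_iff.mp (h' p ⟨k, by ring⟩))
    · rw [sqfreeMul_mul_of_coprime c ((Nat.Prime.coprime_iff_not_dvd hp).mpr h),
        sqfreeMul_prime c hp]
  have h1 : Summable fun d ↦ if p ∣ d then sqfreeMul c d else 0 :=
    hs.of_norm_bounded fun d ↦ by split_ifs <;> simp
  have h2 : Summable fun d ↦ if p ∣ d then 0 else sqfreeMul c d :=
    hs.of_norm_bounded fun d ↦ by split_ifs <;> simp
  have hadd : ∑' d, sqfreeMul c d = ∑' d, (if p ∣ d then sqfreeMul c d else 0)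
      + ∑' d, (if p ∣ d then 0 else sqfreeMul c d) := by
    rw [← h1.tsum_add h2]
    exact tsum_congr fun d ↦ by split_ifs <;> simp
  simp only [hval, tsum_mul_left] at hmul
  rw [hadd, hmul]
  field_simp
  ring

theorem log_eq_sum_primeFactors {d : ℕ} (hd : Squarefree d) :
    Real.log d = ∑ p ∈ d.primeFactors, Real.log p := by
  conv_lhs => rw [← Nat.prod_primeFactors_of_squarefree hd]
  push_cast
  exact Real.log_prod fun p hp ↦ by
    exact_mod_cast (Nat.prime_of_mem_primeFactors hp).ne_zero

@[to_additive]
theorem hasProd_primes_ite_dvd {M : Type*} [CommMonoid M] [TopologicalSpace M] {n : ℕ}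
    (hn : n ≠ 0) (f : ℕ → M) :
    HasProd (fun p : Nat.Primes ↦ if (p : ℕ) ∣ n then f p else 1) (∏ p ∈ n.primeFactors, f p) := by
  have hinj : Function.Injective (fun p : Nat.Primes ↦ (p : ℕ)) := Subtype.val_injective
  have h : HasProd (fun p ↦ if p ∈ n.primeFactors then f p else 1) (∏ p ∈ n.primeFactors, f p) := by
    convert! hasProd_prod_of_ne_finset_one (L := .unconditional ℕ) (s := n.primeFactors)
      (f := fun p ↦ if p ∈ n.primeFactors then f p else 1) (fun p hp ↦ if_neg hp) using 1
    exact prod_congr rfl fun p hp ↦ (if_pos hp).symm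
  have h' := (hinj.hasProd_iff fun p hp ↦ if_neg fun h ↦
    hp ⟨⟨p, Nat.prime_of_mem_primeFactors h⟩, rfl⟩).mpr h
  refine h'.congr_fun fun p ↦ ?_
  have := p.2
  simp [Nat.mem_primeFactors, this, hn]

theorem hasSum_primes_dvd_log {d : ℕ} (hd : Squarefree d) :
    HasSum (fun p : Nat.Primes ↦ if (p : ℕ) ∣ d then Real.log p else 0) (Real.log d) := by
  rw [log_eq_sum_primeFactors hd]
  exact hasSum_primes_ite_dvd hd.ne_zero fun p ↦ Real.log p

theorem hasSum_sqfreeMul_mul_log {c : ℕ → ℝ} (hs : Summable fun d ↦ |sqfreeMul c d|)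
    (hlog : Summable fun d ↦ |sqfreeMul c d| * Real.log d)
    (hc : ∀ p, p.Prime → 1 + c p ≠ 0) :
    HasSum (fun p : Nat.Primes ↦ Real.log p * (c p / (1 + c p)) * ∑' d, sqfreeMul c d)
      (∑' d, sqfreeMul c d * Real.log d) := by
  let f : ℕ × Nat.Primes → ℝ := fun x ↦
    sqfreeMul c x.1 * if (x.2 : ℕ) ∣ x.1 then Real.log x.2 else 0
  have hrow (d : ℕ) : HasSum (fun p ↦ f (d, p)) (sqfreeMul c d * Real.log d) := by
    by_cases hd : Squarefree d
    · exact (hasSum_primes_dvd_log hd).mul_left _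
    · simp [f, sqfreeMul, hd]
  have hrow' (d : ℕ) : HasSum (fun p ↦ |f (d, p)|) (|sqfreeMul c d| * Real.log d) := by
    by_cases hd : Squarefree d
    · convert! (hasSum_primes_dvd_log hd).mul_left (|sqfreeMul c d|) using 2 with p
      simp only [f, abs_mul]
      congr 1
      apply abs_of_nonneg
      split_ifs
      · exact Real.log_natCast_nonneg _
      · rfl
    · simp [f, sqfreeMul, hd]
  have hf : Summable f := by
    apply Summable.of_abs
    rw [summable_prod_of_nonneg fun _ ↦ abs_nonneg _]
    exact ⟨fun d ↦ (hrow' d).summable, by simpa only [(hrow' _).tsum_eq] using hlog⟩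
  have hswap : Summable fun x : Nat.Primes × ℕ ↦ f (x.2, x.1) := hf.prod_symm
  have hcol (p : Nat.Primes) :
      ∑' d, f (d, p) = Real.log p * (c p / (1 + c p)) * ∑' d, sqfreeMul c d := by
    rw [mul_assoc, ← tsum_sqfreeMul_dvd hs p.2 (hc p p.2), ← tsum_mul_left]
    exact tsum_congr fun d ↦ by simp only [f]; split_ifs <;> ring
  have := hswap.prod.hasSum
  simp only [hcol] at this
  convert! this using 1
  simp only [← hcol]
  rw [← Summable.tsum_comm (f := fun (p : Nat.Primes) (d : ℕ) ↦ f (d, p)) hswap]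
  exact tsum_congr fun d ↦ (hrow d).tsum_eq.symm

theorem abs_harmonic_floor_sub_log_le {x : ℝ} (hx : 0 < x) :
    |(∑ m ∈ Icc 1 ⌊x⌋₊, (1 : ℝ) / m) - (Real.log x + Real.eulerMascheroniConstant)|
      ≤ 3 * x ^ (-(1 / 2) : ℝ) := by
  rcases lt_or_ge x 1 with h | h
  · rw [Nat.floor_eq_zero.mpr h]
    simp only [Order.lt_one_iff, Icc_eq_empty_of_lt, sum_empty, zero_sub, abs_neg]
    have h1 := Real.abs_log_mul_self_rpow_lt x (1 / 2) hx h.le (by norm_num)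
    have h2 : (0 : ℝ) < x ^ (1 / 2 : ℝ) := by positivity
    have h3 : x ^ (1 / 2 : ℝ) ≤ 1 := Real.rpow_le_one hx.le h.le (by norm_num)
    rw [Real.rpow_neg hx.le, ← div_eq_mul_inv, le_div_iff₀ h2]
    rw [abs_mul, abs_of_pos h2] at h1
    have h4 := abs_add_le (Real.log x) Real.eulerMascheroniConstant
    rw [abs_of_pos (by linarith [Real.one_half_lt_eulerMascheroniConstant] :
      0 < Real.eulerMascheroniConstant)] at h4
    have h5 := Real.eulerMascheroniConstant_lt_two_thirds
    nlinarith
  · set N := ⌊x⌋₊ with hN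
    have hN1 : 1 ≤ N := Nat.one_le_floor_iff x |>.mpr h
    have hN1' : (1 : ℝ) ≤ N := by exact_mod_cast hN1
    have hNx : (N : ℝ) ≤ x := Nat.floor_le hx.le
    have hxN : x < N + 1 := Nat.lt_floor_add_one x
    have hH : (∑ m ∈ Icc 1 N, (1 : ℝ) / m) = harmonic N := by
      rw [harmonic_eq_sum_Icc]; push_cast; simp
    have h1 := Real.eulerMascheroniSeq_lt_eulerMascheroniConstant N
    have h2 := Real.eulerMascheroniConstant_lt_eulerMascheroniSeq' N
    rw [Real.eulerMascheroniSeq] at h1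
    rw [Real.eulerMascheroniSeq', if_neg (by omega)] at h2
    have h3 : Real.log N ≤ Real.log x := Real.log_le_log (by linarith) hNx
    have h4 : Real.log x ≤ Real.log (N + 1) := Real.log_le_log hx hxN.le
    have h5 : Real.log (N + 1) - Real.log N ≤ 1 / N := by
      rw [← Real.log_div (by positivity) (by positivity)]
      refine (Real.log_le_sub_one_of_pos (by positivity)).trans (le_of_eq ?_)
      field_simp
      ring
    have h6 : 1 / (N : ℝ) ≤ 3 * x ^ (-(1 / 2) : ℝ) := by
      have : x ^ (-1 : ℝ) ≤ x ^ (-(1 / 2) : ℝ) :=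
        Real.rpow_le_rpow_of_exponent_le h (by norm_num)
      rw [Real.rpow_neg_one] at this
      refine le_trans ?_ (mul_le_mul_of_nonneg_left this (by norm_num))
      rw [← div_eq_mul_inv, div_le_div_iff₀ (by linarith) hx]
      linarith
    rw [hH, abs_le]
    constructor <;> linarith

/-- The weight at the prime `p` for which `1_{(r, n) = 1} r / φ(r) = ∑_{d ∣ r} d * F(d)`, where
`F = sqfreeMul (coprimeWeight n)`. -/
noncomputable def coprimeWeight (n p : ℕ) : ℝ :=
  if p ∣ n then -(1 / (p : ℝ)) else 1 / ((p : ℝ) * ((p : ℝ) - 1))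

theorem coprimeWeight_one {p : ℕ} (hp : p.Prime) :
    coprimeWeight 1 p = 1 / ((p : ℝ) * ((p : ℝ) - 1)) :=
  if_neg (by simpa using hp.ne_one)

theorem inv_totient_eq (r : ℕ) :
    (1 : ℝ) / r.totient = 1 / r * ∏ p ∈ r.primeFactors, ((p : ℝ) / ((p : ℝ) - 1)) := by
  rcases eq_or_ne r 0 with rfl | hr
  · simp
  have h : (r.totient : ℝ) * ∏ p ∈ r.primeFactors, (p : ℝ)
      = r * ∏ p ∈ r.primeFactors, ((p : ℝ) - 1) := by
    have := congrArg (Nat.cast : ℕ → ℝ) (Nat.totient_mul_prod_primeFactors r)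
    push_cast at this
    rw [this]
    congr 1
    exact prod_congr rfl fun p hp ↦ by
      rw [Nat.cast_sub (Nat.prime_of_mem_primeFactors hp).one_le, Nat.cast_one]
  have h1 : (r.totient : ℝ) ≠ 0 := by
    exact_mod_cast (Nat.totient_pos.mpr (Nat.pos_of_ne_zero hr)).ne'
  have h2 : ∏ p ∈ r.primeFactors, ((p : ℝ) - 1) ≠ 0 := prod_ne_zero_iff.mpr fun p hp ↦ by
    have : (1 : ℝ) < p := by exact_mod_cast (Nat.prime_of_mem_primeFactors hp).one_lt
    linarith
  rw [prod_div_distrib, div_mul_div_comm, div_eq_div_iff h1 (by positivity)]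
  linarith

theorem coprime_inv_totient_eq {n r : ℕ} (hr : r ≠ 0) :
    (if r.Coprime n then (1 : ℝ) / r.totient else 0)
      = ∑ x ∈ r.divisorsAntidiagonal, sqfreeMul (coprimeWeight n) x.1 * (1 / (x.2 : ℝ)) := by
  have h1 : ∑ x ∈ r.divisorsAntidiagonal, sqfreeMul (coprimeWeight n) x.1 * (1 / (x.2 : ℝ))
      = 1 / r * ∑ d ∈ r.divisors, sqfreeMul (fun p ↦ coprimeWeight n p * (p : ℝ) ^ (1 : ℝ)) d := by
    rw [Nat.sum_divisorsAntidiagonal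
      (f := fun d m ↦ sqfreeMul (coprimeWeight n) d * (1 / (m : ℝ))), mul_sum]
    refine sum_congr rfl fun d hd ↦ ?_
    obtain ⟨k, rfl⟩ := Nat.dvd_of_mem_divisors hd
    have hd0 : d ≠ 0 := by rintro rfl; simp at hr
    have hk0 : k ≠ 0 := by rintro rfl; simp at hr
    rw [sqfreeMul_mul_rpow, Real.rpow_one, Nat.mul_div_cancel_left k (Nat.pos_of_ne_zero hd0)]
    push_cast
    have : (d : ℝ) ≠ 0 := by exact_mod_cast hd0
    have : (k : ℝ) ≠ 0 := by exact_mod_cast hk0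
    field_simp
  rw [h1, sum_divisors_sqfreeMul _ hr]
  split_ifs with h
  · rw [inv_totient_eq]
    congr 1
    refine prod_congr rfl fun p hp ↦ ?_
    have hpp := Nat.prime_of_mem_primeFactors hp
    have hpn : ¬ p ∣ n := fun hpn ↦ hpp.one_lt.ne'
      (Nat.eq_one_of_dvd_coprimes h (Nat.dvd_of_mem_primeFactors hp) hpn)
    have : (1 : ℝ) < p := by exact_mod_cast hpp.one_lt
    have : (p : ℝ) - 1 ≠ 0 := by linarith
    rw [coprimeWeight, if_neg hpn, Real.rpow_one]
    field_simp
    ring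
  · obtain ⟨p, hp, hpr, hpn⟩ := Nat.Prime.not_coprime_iff_dvd.mp h
    have : (p : ℝ) ≠ 0 := by exact_mod_cast hp.ne_zero
    rw [prod_eq_zero (Nat.mem_primeFactors.mpr ⟨hp, hpr, hr⟩), mul_zero]
    rw [coprimeWeight, if_pos hpn, Real.rpow_one]
    field_simp
    ring

theorem sum_coprime_inv_totient_eq (n : ℕ) (R : ℝ) :
    ∑ r ∈ (Icc 1 ⌊R⌋₊).filter (fun r ↦ r.Coprime n), (1 : ℝ) / r.totient
      = ∑ d ∈ Icc 1 ⌊R⌋₊, sqfreeMul (coprimeWeight n) d * ∑ m ∈ Icc 1 ⌊R / d⌋₊, (1 : ℝ) / m := by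
  let F : ArithmeticFunction ℝ := ⟨sqfreeMul (coprimeWeight n), sqfreeMul_zero _⟩
  let G : ArithmeticFunction ℝ := ⟨fun m ↦ 1 / (m : ℝ), by simp⟩
  have h := ArithmeticFunction.sum_Ioc_mul_eq_sum_sum F G ⌊R⌋₊
  have hIcc (N : ℕ) : Ioc 0 N = Icc 1 N := by ext; simp; omega
  simp only [hIcc] at h
  simp only [Nat.floor_div_natCast]
  refine Eq.trans ?_ h
  rw [sum_filter]
  refine sum_congr rfl fun r hr ↦ ?_
  rw [coprime_inv_totient_eq (by simp at hr; omega), ArithmeticFunction.mul_apply]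
  rfl

/-- A bound for `∏_{p ∤ n} (1 + |coprimeWeight n p| * p ^ (1 / 2))` that is uniform in `n`. -/
noncomputable def weightBound : ℝ := Real.exp (∑' m : ℕ, 2 * (m : ℝ) ^ (-(3 / 2) : ℝ))

theorem summable_two_mul_rpow : Summable fun m : ℕ ↦ 2 * (m : ℝ) ^ (-(3 / 2) : ℝ) :=
  (Real.summable_nat_rpow.mpr (by norm_num)).mul_left 2

theorem one_add_abs_coprimeWeight_le {n p : ℕ} (hn : n ≠ 0) (hp : p.Prime) :
    1 + |coprimeWeight n p| * (p : ℝ) ^ (1 / 2 : ℝ)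
      ≤ (if p ∈ n.primeFactors then 1 + (p : ℝ) ^ (-(1 / 2) : ℝ) else 1)
        * (1 + 2 * (p : ℝ) ^ (-(3 / 2) : ℝ)) := by
  have hp2 : (2 : ℝ) ≤ p := by exact_mod_cast hp.two_le
  have hp0 : (0 : ℝ) < p := by linarith
  have h3 : 0 < (p : ℝ) ^ (-(3 / 2) : ℝ) := by positivity
  have h1 : 0 < (p : ℝ) ^ (-(1 / 2) : ℝ) := by positivity
  rw [coprimeWeight]
  by_cases h : p ∣ n
  · have : |-(1 / (p : ℝ))| * (p : ℝ) ^ (1 / 2 : ℝ) = (p : ℝ) ^ (-(1 / 2) : ℝ) := by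
      rw [abs_neg, abs_of_pos (by positivity), one_div, ← Real.rpow_neg_one,
        ← Real.rpow_add hp0]
      norm_num
    rw [if_pos h, if_pos (Nat.mem_primeFactors.mpr ⟨hp, h, hn⟩), this]
    nlinarith
  · rw [if_neg h, if_neg fun h' ↦ h (Nat.dvd_of_mem_primeFactors h'), one_mul,
      abs_of_nonneg (by apply one_div_nonneg.mpr; nlinarith)]
    have h4 : 1 / ((p : ℝ) * (p - 1)) ≤ 2 * (p : ℝ) ^ (-2 : ℝ) := by
      rw [Real.rpow_neg hp0.le, Real.rpow_two, ← div_eq_mul_inv, div_le_div_iff₀ (by nlinarith)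
        (by positivity)]
      nlinarith
    have h5 : (p : ℝ) ^ (-(3 / 2) : ℝ) = (p : ℝ) ^ (-2 : ℝ) * (p : ℝ) ^ (1 / 2 : ℝ) := by
      rw [← Real.rpow_add hp0]; norm_num
    rw [h5, ← mul_assoc]
    gcongr

theorem prod_one_add_abs_coprimeWeight_le {n : ℕ} (hn : n ≠ 0) (N : ℕ) :
    ∏ p ∈ Nat.primesLE N, (1 + |coprimeWeight n p| * (p : ℝ) ^ (1 / 2 : ℝ))
      ≤ weightBound * bFactor (1 / 2) n := by
  have hnn (m : ℕ) : (0 : ℝ) ≤ 2 * (m : ℝ) ^ (-(3 / 2) : ℝ) := by positivity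
  calc _ ≤ ∏ p ∈ Nat.primesLE N,
        ((if p ∈ n.primeFactors then 1 + (p : ℝ) ^ (-(1 / 2) : ℝ) else 1)
          * (1 + 2 * (p : ℝ) ^ (-(3 / 2) : ℝ))) :=
        prod_le_prod (fun p _ ↦ by positivity) fun p hp ↦
          one_add_abs_coprimeWeight_le hn (Nat.mem_primesLE.mp hp).2
    _ = (∏ p ∈ Nat.primesLE N ∩ n.primeFactors, (1 + (p : ℝ) ^ (-(1 / 2) : ℝ)))
        * ∏ p ∈ Nat.primesLE N, (1 + 2 * (p : ℝ) ^ (-(3 / 2) : ℝ)) := by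
      rw [prod_mul_distrib, prod_ite_mem]
    _ ≤ bFactor (1 / 2) n * weightBound := by
      refine mul_le_mul ?_ ?_ (prod_nonneg fun p _ ↦ by positivity)
        (prod_nonneg fun p _ ↦ by positivity)
      · exact prod_le_prod_of_subset_of_one_le inter_subset_right (fun p _ ↦ by positivity)
          fun p _ _ ↦ le_add_of_nonneg_right (by positivity)
      · refine (Real.prod_one_add_le_exp_sum _ hnn).trans (Real.exp_le_exp.mpr ?_)
        exact summable_two_mul_rpow.sum_le_tsum _ fun m _ ↦ hnn m
    _ = _ := mul_comm _ _

theorem abs_sqfreeMul_mul_sqrt_eq (n d : ℕ) :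
    |sqfreeMul (coprimeWeight n) d| * (d : ℝ) ^ (1 / 2 : ℝ)
      = sqfreeMul (fun p ↦ |coprimeWeight n p| * (p : ℝ) ^ (1 / 2 : ℝ)) d := by
  rw [sqfreeMul_mul_rpow, abs_sqfreeMul]

theorem sum_range_abs_sqfreeMul_le {n : ℕ} (hn : n ≠ 0) (N : ℕ) :
    ∑ d ∈ range N, |sqfreeMul (coprimeWeight n) d| * (d : ℝ) ^ (1 / 2 : ℝ)
      ≤ weightBound * bFactor (1 / 2) n := by
  simp only [abs_sqfreeMul_mul_sqrt_eq]
  exact (sum_range_sqfreeMul_le (fun p ↦ by positivity) N).trans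
    (prod_one_add_abs_coprimeWeight_le hn N)

theorem summable_abs_sqfreeMul_mul_sqrt {n : ℕ} (hn : n ≠ 0) :
    Summable fun d : ℕ ↦ |sqfreeMul (coprimeWeight n) d| * (d : ℝ) ^ (1 / 2 : ℝ) :=
  summable_of_sum_range_le (fun d ↦ by positivity) (sum_range_abs_sqfreeMul_le hn)

theorem tsum_abs_sqfreeMul_mul_sqrt_le {n : ℕ} (hn : n ≠ 0) :
    ∑' d : ℕ, |sqfreeMul (coprimeWeight n) d| * (d : ℝ) ^ (1 / 2 : ℝ)
      ≤ weightBound * bFactor (1 / 2) n :=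
  Real.tsum_le_of_sum_range_le (fun d ↦ by positivity) (sum_range_abs_sqfreeMul_le hn)

theorem summable_abs_sqfreeMul {n : ℕ} (hn : n ≠ 0) :
    Summable fun d ↦ |sqfreeMul (coprimeWeight n) d| := by
  refine (summable_abs_sqfreeMul_mul_sqrt hn).of_nonneg_of_le (fun d ↦ abs_nonneg _) fun d ↦ ?_
  rcases Nat.eq_zero_or_pos d with rfl | hd
  · simp [sqfreeMul_zero]
  · exact le_mul_of_one_le_right (abs_nonneg _)
      (Real.one_le_rpow (by exact_mod_cast hd) (by norm_num))

theorem summable_abs_sqfreeMul_mul_log {n : ℕ} (hn : n ≠ 0) :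
    Summable fun d : ℕ ↦ |sqfreeMul (coprimeWeight n) d| * Real.log d := by
  refine ((summable_abs_sqfreeMul_mul_sqrt hn).mul_left 2).of_nonneg_of_le
    (fun d ↦ mul_nonneg (abs_nonneg _) (Real.log_natCast_nonneg d)) fun d ↦ ?_
  have := Real.log_le_rpow_div (Nat.cast_nonneg d) (one_half_pos (α := ℝ))
  calc _ ≤ |sqfreeMul (coprimeWeight n) d| * ((d : ℝ) ^ (1 / 2 : ℝ) / (1 / 2)) := by gcongr
    _ = _ := by ring

theorem tsum_sqfreeMul_coprimeWeight {n : ℕ} (hn : n ≠ 0) :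
    ∑' d, sqfreeMul (coprimeWeight n) d = hConst * gFunc n := by
  have h1 := hasProd_sqfreeMul (summable_abs_sqfreeMul one_ne_zero)
  have hh : hConst = ∑' d, sqfreeMul (coprimeWeight 1) d := by
    rw [← h1.tprod_eq, hConst]
    refine tprod_congr fun p ↦ ?_
    rw [coprimeWeight_one p.2]
  have h2 := h1.mul (hasProd_primes_ite_dvd hn fun p ↦ (1 + (p : ℝ) / ((p : ℝ) - 1) ^ 2)⁻¹)
  rw [← hh] at h2
  refine (hasProd_sqfreeMul (summable_abs_sqfreeMul hn)).unique ?_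
  refine h2.congr_fun fun p ↦ ?_
  have hp : (1 : ℝ) < (p : ℕ) := by exact_mod_cast p.2.one_lt
  have hp1 : ((p : ℕ) : ℝ) - 1 ≠ 0 := by linarith
  rw [coprimeWeight_one p.2, coprimeWeight]
  split_ifs
  · have : (((p : ℕ) : ℝ) - 1) ^ 2 + (p : ℕ) ≠ 0 := by nlinarith
    field_simp
    ring
  · simp

theorem hConst_ne_zero : hConst ≠ 0 := by
  have h := tsum_sqfreeMul_coprimeWeight one_ne_zero
  have hg : gFunc 1 = 1 := by simp [gFunc]
  rw [hg, mul_one] at h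
  rw [← h]
  have hnn (d : ℕ) : 0 ≤ sqfreeMul (coprimeWeight 1) d := by
    unfold sqfreeMul
    split_ifs
    · refine prod_nonneg fun p hp ↦ ?_
      have hp' := Nat.prime_of_mem_primeFactors hp
      have : (1 : ℝ) < p := by exact_mod_cast hp'.one_lt
      rw [coprimeWeight_one hp']
      apply one_div_nonneg.mpr
      nlinarith
    · rfl
  have := (summable_abs_sqfreeMul one_ne_zero).of_abs.le_tsum 1 fun d _ ↦ hnn d
  rw [sqfreeMul_one] at this
  linarith

theorem one_add_coprimeWeight_ne_zero (n : ℕ) {p : ℕ} (hp : p.Prime) :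
    1 + coprimeWeight n p ≠ 0 := by
  have : (1 : ℝ) < p := by exact_mod_cast hp.one_lt
  rw [coprimeWeight]
  split_ifs
  · have : 1 / (p : ℝ) < 1 := by rw [div_lt_one] <;> linarith
    linarith
  · have : 0 ≤ 1 / ((p : ℝ) * (p - 1)) := by apply one_div_nonneg.mpr; nlinarith
    linarith

theorem log_mul_coprimeWeight_div (n : ℕ) {p : ℕ} (hp : p.Prime) :
    Real.log p * (coprimeWeight n p / (1 + coprimeWeight n p))
      = Real.log p / (1 + p * ((p : ℝ) - 1)) - if p ∣ n then
        (p : ℝ) ^ 2 * Real.log p / (((p : ℝ) - 1) * ((p : ℝ) ^ 2 - p + 1)) else 0 := by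
  have h1 : (1 : ℝ) < p := by exact_mod_cast hp.one_lt
  have h2 : (p : ℝ) - 1 ≠ 0 := by linarith
  have h3 : (p : ℝ) ^ 2 - p + 1 = 1 + p * ((p : ℝ) - 1) := by ring
  have h4 : 1 + (p : ℝ) * ((p : ℝ) - 1) ≠ 0 := by nlinarith
  rw [h3]
  have h5 := one_add_coprimeWeight_ne_zero n hp
  rw [coprimeWeight] at h5 ⊢
  split_ifs at h5 ⊢
  · have h6 : (1 : ℝ) + -(1 / p) = (p - 1) / p := by field_simp; ring
    rw [h6]
    field_simp
    ring
  · have h6 : 1 + 1 / ((p : ℝ) * (p - 1)) = (1 + p * (p - 1)) / (p * (p - 1)) := by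
      field_simp; ring
    rw [h6]
    field_simp
    ring

theorem summable_log_div :
    Summable fun p : Nat.Primes ↦ Real.log (p : ℝ) / (1 + (p : ℝ) * ((p : ℝ) - 1)) := by
  have h := (hasSum_sqfreeMul_mul_log (summable_abs_sqfreeMul one_ne_zero)
    (summable_abs_sqfreeMul_mul_log one_ne_zero)
    fun p hp ↦ one_add_coprimeWeight_ne_zero 1 hp).summable
  have hg : gFunc 1 = 1 := by simp [gFunc]
  rw [tsum_sqfreeMul_coprimeWeight one_ne_zero, hg, mul_one,
    summable_mul_right_iff hConst_ne_zero] at h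
  refine h.congr fun p ↦ ?_
  rw [log_mul_coprimeWeight_div 1 p.2, if_neg (by simpa using p.2.ne_one), sub_zero]

theorem tsum_sqfreeMul_coprimeWeight_mul_log {n : ℕ} (hn : n ≠ 0) :
    ∑' d : ℕ, sqfreeMul (coprimeWeight n) d * Real.log d
      = hConst * gFunc n * (Real.eulerMascheroniConstant - lamConst - thetaFunc n) := by
  have h := hasSum_sqfreeMul_mul_log (summable_abs_sqfreeMul hn)
    (summable_abs_sqfreeMul_mul_log hn) fun p hp ↦ one_add_coprimeWeight_ne_zero n hp
  rw [tsum_sqfreeMul_coprimeWeight hn] at h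
  refine h.unique ?_
  have h' := (summable_log_div.hasSum.sub (hasSum_primes_ite_dvd hn fun p ↦
    (p : ℝ) ^ 2 * Real.log p / (((p : ℝ) - 1) * ((p : ℝ) ^ 2 - p + 1)))).mul_right
      (hConst * gFunc n)
  convert! h' using 1
  · ext p
    rw [log_mul_coprimeWeight_div n p.2]
  · rw [lamConst, thetaFunc]
    ring

theorem abs_sum_coprime_inv_totient_sub_le {n : ℕ} (hn : n ≠ 0) {R : ℝ} (hR : 0 < R) :
    |(∑ r ∈ (Icc 1 ⌊R⌋₊).filter (fun r ↦ r.Coprime n), (1 : ℝ) / r.totient)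
        - hConst * gFunc n * (Real.log R + lamConst + thetaFunc n)|
      ≤ 3 * weightBound * bFactor (1 / 2) n * R ^ (-(1 / 2) : ℝ) := by
  set F := sqfreeMul (coprimeWeight n) with hF
  have hT : HasSum (fun d : ℕ ↦ F d * ∑ m ∈ Icc 1 ⌊R / d⌋₊, (1 : ℝ) / m)
      (∑ r ∈ (Icc 1 ⌊R⌋₊).filter (fun r ↦ r.Coprime n), (1 : ℝ) / r.totient) := by
    rw [sum_coprime_inv_totient_eq]
    refine hasSum_sum_of_ne_finset_zero fun d hd ↦ ?_
    rcases Nat.eq_zero_or_pos d with rfl | hd0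
    · simp
    · have : ⌊R / d⌋₊ = 0 := by
        rw [Nat.floor_div_natCast]
        exact Nat.div_eq_of_lt (by simp at hd; omega)
      simp [this]
  have hA := (summable_abs_sqfreeMul hn).of_abs.hasSum
  have hL : HasSum (fun d : ℕ ↦ F d * Real.log d) (∑' d : ℕ, F d * Real.log d) :=
    Summable.hasSum <| .of_abs <| by
      simpa only [abs_mul, abs_of_nonneg (Real.log_natCast_nonneg _)] using
        summable_abs_sqfreeMul_mul_log hn
  rw [tsum_sqfreeMul_coprimeWeight hn] at hA
  rw [tsum_sqfreeMul_coprimeWeight_mul_log hn] at hL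
  have hM := hT.sub ((hA.mul_right (Real.log R + Real.eulerMascheroniConstant)).sub hL)
  have hbound (d : ℕ) : ‖F d * (∑ m ∈ Icc 1 ⌊R / d⌋₊, (1 : ℝ) / m)
      - (F d * (Real.log R + Real.eulerMascheroniConstant) - F d * Real.log d)‖
      ≤ 3 * R ^ (-(1 / 2) : ℝ) * (|F d| * (d : ℝ) ^ (1 / 2 : ℝ)) := by
    rcases Nat.eq_zero_or_pos d with rfl | hd0
    · simp [hF, sqfreeMul_zero]
    have hd : (0 : ℝ) < d := by exact_mod_cast hd0
    have h := abs_harmonic_floor_sub_log_le (div_pos hR hd)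
    rw [Real.div_rpow hR.le hd.le, Real.rpow_neg hd.le, div_inv_eq_mul,
      Real.log_div hR.ne' hd.ne'] at h
    calc _ = |F d| * |(∑ m ∈ Icc 1 ⌊R / d⌋₊, (1 : ℝ) / m)
          - (Real.log R - Real.log d + Real.eulerMascheroniConstant)| := by
          rw [← abs_mul, Real.norm_eq_abs]; ring_nf
      _ ≤ |F d| * (3 * (R ^ (-(1 / 2) : ℝ) * (d : ℝ) ^ (1 / 2 : ℝ))) := by gcongr
      _ = _ := by ring
  have hfin := tsum_of_norm_bounded
    ((summable_abs_sqfreeMul_mul_sqrt hn).hasSum.mul_left (3 * R ^ (-(1 / 2) : ℝ))) hbound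
  rw [hM.tsum_eq, Real.norm_eq_abs] at hfin
  calc _ = _ := by congr 1; ring
    _ ≤ _ := hfin
    _ ≤ 3 * R ^ (-(1 / 2) : ℝ) * (weightBound * bFactor (1 / 2) n) := by
      gcongr
      exact tsum_abs_sqfreeMul_mul_sqrt_le hn
    _ = _ := by ring

/-- Uniformly for `n ≥ 1`, `R ≥ 1`:
`∑_{r ≤ R, (r,n)=1} 1/φ(r) = h g(n) (log R + λ + ϑ(n)) + O(b_{1/2}(n)/R^{2/7})`. -/
theorem stmt_2 :
    ∃ C : ℝ, 0 < C ∧ ∀ (n : ℕ) (R : ℝ), 1 ≤ n → 1 ≤ R →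
      |(∑ r ∈ (Finset.Icc 1 ⌊R⌋₊).filter (fun r => Nat.Coprime r n),
          (1 : ℝ) / (Nat.totient r))
        - hConst * gFunc n * (Real.log R + lamConst + thetaFunc n)|
      ≤ C * bFactor (1/2) n / R ^ ((2 : ℝ)/7) := by
  have hD : 0 < weightBound := Real.exp_pos _
  refine ⟨3 * weightBound, by positivity, fun n R hn hR ↦ ?_⟩
  refine (abs_sum_coprime_inv_totient_sub_le (by omega) (by linarith)).trans ?_
  rw [div_eq_mul_inv _ (R ^ _), ← Real.rpow_neg (by linarith)]
  have hb : 0 ≤ bFactor (1 / 2) n := prod_nonneg fun p _ ↦ by positivity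
  exact mul_le_mul_of_nonneg_left (Real.rpow_le_rpow_of_exponent_le hR (by norm_num))
    (by positivity)
end

section
/- For every j ∈ {0,1} and uniformly for R ≥ R₀ ≥ 1 and positive integers m, n, one has T(R,m,n) := ∑_{r ≤ R, gcd(r,n)=1} 1/φ(mr) = (h·g(mn)/φ(m))·( (log R + λ + ϑ(mn))·Θ₀(m,n;R₀) − Θ₁(m,n;R₀) ) + O( τ(mn)² (log 2R) / (φ(m) R₀^{1/4}) ), where Θ_j(m,n;u) := ∑_{δ ≤ u, δ | m^∞, gcd(δ,n)=1} (log δ)^j / δ. -/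
open Finset Real

/-- `Θ_j(m,n;u) := ∑_{δ ≤ u, δ ∣ m^∞, (δ,n)=1} (log δ)^j / δ`. -/
noncomputable def ThetaFn (j : ℕ) (m n : ℕ) (u : ℝ) : ℝ :=
  ∑ δ ∈ (Finset.Icc 1 ⌊u⌋₊).filter
      (fun δ => δ.primeFactors ⊆ m.primeFactors ∧ Nat.Coprime δ n),
    (Real.log δ) ^ j / δ

/-- Explicit form of `∑_{t ≤ y} 1/t = log y + γ + O(y^{-1/4})`, valid for all `y > 0`. -/
lemma abs_sum_floor_inv_sub_le {y : ℝ} (hy : 0 < y) :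
    |∑ t ∈ Icc 1 ⌊y⌋₊, (1 : ℝ) / t - (log y + eulerMascheroniConstant)|
      ≤ 5 * y ^ (-(1 / 4) : ℝ) := by
  have hγ := eulerMascheroniConstant_lt_two_thirds
  have hγ' := one_half_lt_eulerMascheroniConstant
  rcases lt_or_ge y 1 with h | h
  · rw [Nat.floor_eq_zero.mpr h]
    have hu : 1 ≤ y ^ (-(1 / 4) : ℝ) := one_le_rpow_of_pos_of_le_one_of_nonpos hy h.le (by norm_num)
    have hl := log_le_sub_one_of_pos (zero_lt_one.trans_le hu)
    rw [log_rpow hy] at hl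
    have hneg := log_neg hy h
    rw [abs_le]
    constructor <;> simp <;> linarith
  · set N := ⌊y⌋₊ with hN
    have hN1 : 1 ≤ N := Nat.le_floor (by exact_mod_cast h)
    have hNr : (1 : ℝ) ≤ N := by exact_mod_cast hN1
    have hH : ∑ t ∈ Icc 1 N, (1 : ℝ) / t = harmonic N := by
      simp [harmonic_eq_sum_Icc]
    have h1 := eulerMascheroniSeq_lt_eulerMascheroniConstant N
    have h2 := eulerMascheroniConstant_lt_eulerMascheroniSeq' N
    rw [eulerMascheroniSeq] at h1
    rw [eulerMascheroniSeq', if_neg (by lia)] at h2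
    have hle : (N : ℝ) ≤ y := Nat.floor_le hy.le
    have hlt : y < N + 1 := Nat.lt_floor_add_one y
    have l1 := log_le_log (by linarith) hle
    have l2 := log_le_log hy hlt.le
    have l3 : log (N + 1) - log N ≤ 2 / y := by
      rw [← log_div (by linarith) (by linarith)]
      refine (log_le_sub_one_of_pos (by positivity)).trans ?_
      rw [div_sub_one (by linarith), div_le_div_iff₀ (by linarith) hy]
      linarith
    have l4 : y⁻¹ ≤ y ^ (-(1 / 4) : ℝ) := by
      rw [← rpow_neg_one]
      exact rpow_le_rpow_of_exponent_le h (by norm_num)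
    have : 0 < y⁻¹ := by positivity
    rw [hH, abs_le]
    rw [div_eq_mul_inv] at l3
    constructor <;> linarith

/-- Logarithmic derivative of an infinite product, written as a sum over finite sets. -/
lemma tsum_prod_mul_sum {ι : Type*} {b L : ι → ℝ} (hb : Summable fun i ↦ ‖b i‖)
    (hne : ∀ i, 1 + b i ≠ 0)
    (hs : Summable fun s : Finset ι ↦ |∏ i ∈ s, b i| * ∑ i ∈ s, |L i|) :
    ∑' s : Finset ι, (∏ i ∈ s, b i) * ∑ i ∈ s, L i
      = (∏' i, (1 + b i)) * ∑' i, L i * b i / (1 + b i) := by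
  classical
  have hbs : Summable fun s : Finset ι ↦ ∏ i ∈ s, b i := summable_finsetProd_of_summable_norm hb
  let F : Finset ι × ι → ℝ := fun q ↦ if q.2 ∈ q.1 then L q.2 * ∏ i ∈ q.1, b i else 0
  have hF0 : ∀ s : Finset ι, ∀ i ∉ s, F (s, i) = 0 := fun s i hi ↦ by simp [F, hi]
  have hF : Summable F := by
    rw [← summable_norm_iff, summable_prod_of_nonneg (fun _ ↦ norm_nonneg _)]
    refine ⟨fun s ↦ summable_of_ne_finset_zero (s := s) fun i hi ↦ by simp [hF0 s i hi],
      hs.congr fun s ↦ ?_⟩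
    rw [tsum_eq_sum (s := s) (fun i hi ↦ by simp [hF0 s i hi]), mul_comm, sum_mul]
    refine sum_congr rfl fun i hi ↦ ?_
    rw [norm_eq_abs, show F (s, i) = L i * ∏ i ∈ s, b i from if_pos hi, abs_mul]
  have hcol : ∀ i, ∑' s, F (s, i) = (∏' j, (1 + b j)) * (L i * b i / (1 + b i)) := by
    intro i
    let c : ι → ℝ := Function.update b i 0
    have hc : Summable fun j ↦ ‖c j‖ := by
      refine hb.of_nonneg_of_le (fun _ ↦ norm_nonneg _) fun j ↦ ?_
      by_cases h : j = i <;> simp [c, h]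
    have hcs : Summable fun s : Finset ι ↦ ∏ j ∈ s, c j := summable_finsetProd_of_summable_norm hc
    have hprod : ∏' j, (1 + b j) = (1 + b i) * ∏' j, (1 + c j) := by
      have h1 : HasProd (fun j ↦ (if j = i then 1 + b i else 1) * (1 + c j))
          ((1 + b i) * ∏' j, (1 + c j)) :=
        (hasProd_ite_eq i (1 + b i)).mul (multipliable_one_add_of_summable_prod hcs).hasProd
      rw [← h1.tprod_eq]
      refine tprod_congr fun j ↦ ?_
      by_cases h : j = i
      · subst h; simp [c]
      · simp [c, h]
    have hFc : ∀ s, F (s, i) = L i * (∏ j ∈ s, b j - ∏ j ∈ s, c j) := by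
      intro s
      by_cases h : i ∈ s
      · have : ∏ j ∈ s, c j = 0 := prod_eq_zero h (by simp [c])
        simp [F, h, this]
      · have : ∏ j ∈ s, c j = ∏ j ∈ s, b j :=
          prod_congr rfl fun j hj ↦ by
            have : j ≠ i := fun e ↦ h (e ▸ hj)
            simp [c, this]
        simp [F, h, this]
    simp_rw [hFc]
    rw [tsum_mul_left, hbs.tsum_sub hcs, ← tprod_one_add hbs, ← tprod_one_add hcs, hprod]
    have := hne i
    generalize (∏' j, (1 + c j)) = P
    field_simp
    ring
  calc ∑' s : Finset ι, (∏ i ∈ s, b i) * ∑ i ∈ s, L i = ∑' s, ∑' i, F (s, i) := by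
        refine tsum_congr fun s ↦ ?_
        rw [tsum_eq_sum (s := s) (hF0 s), mul_comm, sum_mul]
        exact sum_congr rfl fun i hi ↦ by simp [F, hi]
    _ = ∑' i, ∑' s, F (s, i) := (Summable.tsum_comm (f := fun s i ↦ F (s, i)) (by exact hF)).symm
    _ = _ := by simp_rw [hcol]; rw [tsum_mul_left]

/-- The local coefficient at `p` of the Dirichlet series whose summatory function, weighted by
`1/r`, is `∑_{(r,k)=1} 1/φ(r)`. -/
noncomputable def coprimeCoeff (k p : ℕ) : ℝ :=
  if p.Prime then if p ∣ k then -(p : ℝ)⁻¹ else ((p : ℝ) * ((p : ℝ) - 1))⁻¹ else 0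

lemma coprimeCoeff_of_not_prime {k p : ℕ} (hp : ¬ p.Prime) : coprimeCoeff k p = 0 := by
  simp [coprimeCoeff, hp]

lemma prod_coprimeCoeff_eq_zero {k : ℕ} {s : Finset ℕ} (hs : ¬ ∀ p ∈ s, p.Prime) :
    ∏ p ∈ s, coprimeCoeff k p = 0 := by
  push Not at hs
  obtain ⟨p, hp, hp'⟩ := hs
  exact prod_eq_zero hp (coprimeCoeff_of_not_prime hp')

lemma sum_powerset_primeFactors_coprimeCoeff (k : ℕ) {r : ℕ} (hr : r ≠ 0) :
    ∑ s ∈ r.primeFactors.powerset, (∏ p ∈ s, (p : ℝ)) * ∏ p ∈ s, coprimeCoeff k p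
      = if r.Coprime k then (r : ℝ) / r.totient else 0 := by
  simp_rw [← prod_mul_distrib]
  rw [← prod_one_add]
  split_ifs with h
  · have htot : (r.totient : ℝ) = r * ∏ p ∈ r.primeFactors, (1 - (p : ℝ)⁻¹) := by
      have := congrArg (Rat.cast : ℚ → ℝ) (Nat.totient_eq_mul_prod_factors r)
      push_cast at this
      exact this
    have hr' : (r : ℝ) ≠ 0 := by exact_mod_cast hr
    rw [htot, ← div_div, div_self hr', one_div, ← prod_inv_distrib]
    refine prod_congr rfl fun p hp ↦ ?_
    have hpp := Nat.prime_of_mem_primeFactors hp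
    have hpk : ¬ p ∣ k := fun hk ↦
      hpp.one_lt.ne' (Nat.eq_one_of_dvd_coprimes h (Nat.dvd_of_mem_primeFactors hp) hk)
    have h1 : (1 : ℝ) < p := by exact_mod_cast hpp.one_lt
    have h2 : (p : ℝ) - 1 ≠ 0 := by linarith
    have h3 : (p : ℝ) ≠ 0 := by linarith
    simp only [coprimeCoeff, hpp, hpk, if_true, if_false]
    field_simp
    ring
  · obtain ⟨p, hp, hpr, hpk⟩ := Nat.Prime.not_coprime_iff_dvd.mp h
    refine prod_eq_zero (Nat.mem_primeFactors.mpr ⟨hp, hpr, hr⟩) ?_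
    have h3 : (p : ℝ) ≠ 0 := by exact_mod_cast hp.ne_zero
    simp [coprimeCoeff, hp, hpk, h3]

lemma sum_filter_dvd_div {D : ℕ} (hD : D ≠ 0) (N : ℕ) :
    ∑ r ∈ (Icc 1 N).filter (D ∣ ·), (D : ℝ) / r = ∑ t ∈ Icc 1 (N / D), (1 : ℝ) / t := by
  have hD0 : 0 < D := Nat.pos_of_ne_zero hD
  have hD' : (D : ℝ) ≠ 0 := by exact_mod_cast hD
  refine (sum_nbij' (fun t ↦ D * t) (fun r ↦ r / D) ?_ ?_ ?_ ?_ ?_).symm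
  · intro t ht
    rw [mem_Icc] at ht
    have := (Nat.le_div_iff_mul_le hD0).mp ht.2
    rw [mem_filter, mem_Icc]
    exact ⟨⟨Nat.mul_pos hD0 ht.1, by linarith⟩, dvd_mul_right _ _⟩
  · intro r hr
    rw [mem_filter, mem_Icc] at hr
    rw [mem_Icc]
    exact ⟨Nat.div_pos (Nat.le_of_dvd hr.1.1 hr.2) hD0, Nat.div_le_div_right hr.1.2⟩
  · intro t _
    exact Nat.mul_div_cancel_left t hD0
  · intro r hr
    exact Nat.mul_div_cancel' (mem_filter.mp hr).2
  · intro t ht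
    rw [Nat.cast_mul, div_mul_eq_div_div, div_self hD']

lemma subset_primeFactors_iff_prod_dvd {s : Finset ℕ} (hs : ∀ p ∈ s, p.Prime) {r : ℕ}
    (hr : r ≠ 0) : s ⊆ r.primeFactors ↔ ∏ p ∈ s, p ∣ r := by
  constructor
  · intro h
    exact (prod_dvd_prod_of_subset _ _ _ h).trans (Nat.prod_primeFactors_dvd r)
  · intro h
    rw [← Nat.primeFactors_prod hs]
    exact Nat.primeFactors_mono h hr

/-- The sum of `1/φ(r)` over `r ≤ x` coprime to `k`. -/
noncomputable def coprimeTotientSum (k : ℕ) (x : ℝ) : ℝ :=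
  ∑ r ∈ (Icc 1 ⌊x⌋₊).filter (fun r ↦ r.Coprime k), (1 : ℝ) / r.totient

lemma hasSum_coprimeTotientSum (k : ℕ) (x : ℝ) :
    HasSum (fun s : Finset ℕ ↦ (∏ p ∈ s, coprimeCoeff k p) *
      ∑ t ∈ Icc 1 ⌊x / ∏ p ∈ s, (p : ℝ)⌋₊, (1 : ℝ) / t) (coprimeTotientSum k x) := by
  have key : HasSum (fun s : Finset ℕ ↦ ∑ r ∈ Icc 1 ⌊x⌋₊, if s ⊆ r.primeFactors then
      (1 : ℝ) / r * ((∏ p ∈ s, (p : ℝ)) * ∏ p ∈ s, coprimeCoeff k p) else 0)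
      (∑ r ∈ Icc 1 ⌊x⌋₊, if r.Coprime k then (1 : ℝ) / r.totient else 0) := by
    refine hasSum_sum fun r hr ↦ ?_
    have hr0 : r ≠ 0 := by have := (mem_Icc.mp hr).1; lia
    have hr' : (r : ℝ) ≠ 0 := by exact_mod_cast hr0
    have h := sum_powerset_primeFactors_coprimeCoeff k hr0
    have h2 : (if r.Coprime k then (1 : ℝ) / r.totient else 0) =
        ∑ s ∈ r.primeFactors.powerset, if s ⊆ r.primeFactors then
          (1 : ℝ) / r * ((∏ p ∈ s, (p : ℝ)) * ∏ p ∈ s, coprimeCoeff k p) else 0 := by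
      rw [sum_congr rfl fun s hs ↦ if_pos (mem_powerset.mp hs), ← mul_sum, h]
      split_ifs
      · field_simp
      · simp
    rw [h2]
    exact hasSum_sum_of_ne_finset_zero fun s hs ↦ if_neg (by simpa using hs)
  rw [coprimeTotientSum, sum_filter]
  convert key using 2 with s
  by_cases hs : ∀ p ∈ s, p.Prime
  · have hD : ∏ p ∈ s, p ≠ 0 := prod_ne_zero_iff.mpr fun p hp ↦ (hs p hp).ne_zero
    have hfl : ⌊x / ∏ p ∈ s, (p : ℝ)⌋₊ = ⌊x⌋₊ / ∏ p ∈ s, p := by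
      rw [← Nat.floor_div_natCast]; push_cast; rfl
    rw [hfl, ← sum_filter_dvd_div hD, mul_sum, sum_filter]
    refine sum_congr rfl fun r hr ↦ ?_
    have hr0 : r ≠ 0 := by have := (mem_Icc.mp hr).1; lia
    simp only [subset_primeFactors_iff_prod_dvd hs hr0]
    split_ifs
    · push_cast; ring
    · rfl
  · rw [prod_coprimeCoeff_eq_zero hs]
    simp

lemma abs_coprimeCoeff_one_le (p : ℕ) :
    |coprimeCoeff 1 p| * (p : ℝ) ^ (1 / 4 : ℝ) ≤ 2 * (p : ℝ) ^ (-(7 / 4) : ℝ) := by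
  by_cases hp : p.Prime
  · have h2 : (2 : ℝ) ≤ p := by exact_mod_cast hp.two_le
    have h0 : (0 : ℝ) < p := by linarith
    have hc : coprimeCoeff 1 p = ((p : ℝ) * ((p : ℝ) - 1))⁻¹ := by
      simp [coprimeCoeff, hp, hp.one_lt.ne']
    have hle : |coprimeCoeff 1 p| ≤ 2 * (p : ℝ) ^ (-2 : ℝ) := by
      rw [hc, abs_of_pos (inv_pos.mpr (mul_pos h0 (by linarith))), rpow_neg h0.le, ← div_eq_mul_inv,
        inv_eq_one_div, div_le_div_iff₀ (mul_pos h0 (by linarith)) (by positivity)]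
      norm_num
      nlinarith
    calc _ ≤ 2 * (p : ℝ) ^ (-2 : ℝ) * (p : ℝ) ^ (1 / 4 : ℝ) := by gcongr
      _ = _ := by rw [mul_assoc, ← rpow_add h0]; norm_num
  · rw [coprimeCoeff_of_not_prime hp]
    simp
    positivity

lemma summable_coprimeCoeff_one :
    Summable fun p : ℕ ↦ |coprimeCoeff 1 p| * (p : ℝ) ^ (1 / 4 : ℝ) :=
  Summable.of_nonneg_of_le (fun _ ↦ by positivity) abs_coprimeCoeff_one_le
    ((summable_nat_rpow.mpr (by norm_num)).mul_left 2)

lemma abs_coprimeCoeff_mul_le {k : ℕ} (hk : k ≠ 0) (p : ℕ) :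
    |coprimeCoeff k p| * (p : ℝ) ^ (1 / 4 : ℝ) ≤ if p ∈ k.primeFactors then 1 else
      |coprimeCoeff 1 p| * (p : ℝ) ^ (1 / 4 : ℝ) := by
  split_ifs with h
  · have hp := Nat.prime_of_mem_primeFactors h
    have hpk := Nat.dvd_of_mem_primeFactors h
    have h1 : (1 : ℝ) ≤ p := by exact_mod_cast hp.one_lt.le
    simp only [coprimeCoeff, hp, hpk, if_true, abs_neg, abs_inv, Nat.abs_cast]
    rw [inv_mul_le_iff₀ (by linarith), mul_one]
    exact rpow_le_self_of_one_le h1 (by norm_num)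
  · by_cases hp : p.Prime
    · have hpk : ¬ p ∣ k := fun hd ↦ h (Nat.mem_primeFactors.mpr ⟨hp, hd, hk⟩)
      simp [coprimeCoeff, hp, hpk, hp.one_lt.ne']
    · simp [coprimeCoeff, hp]

lemma summable_coprimeCoeff {k : ℕ} (hk : k ≠ 0) :
    Summable fun p : ℕ ↦ |coprimeCoeff k p| * (p : ℝ) ^ (1 / 4 : ℝ) := by
  have h1 : Summable fun p : ℕ ↦ if p ∈ k.primeFactors then (1 : ℝ) else 0 :=
    summable_of_ne_finset_zero (s := k.primeFactors) fun p hp ↦ if_neg hp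
  refine Summable.of_nonneg_of_le (fun _ ↦ by positivity) (fun p ↦ ?_)
    (h1.add summable_coprimeCoeff_one)
  refine (abs_coprimeCoeff_mul_le hk p).trans ?_
  split_ifs
  · have : 0 ≤ |coprimeCoeff 1 p| * (p : ℝ) ^ (1 / 4 : ℝ) := by positivity
    linarith
  · simp

lemma summable_norm_coprimeCoeff {k : ℕ} (hk : k ≠ 0) :
    Summable fun p ↦ ‖coprimeCoeff k p‖ := by
  refine (summable_coprimeCoeff hk).of_nonneg_of_le (fun _ ↦ norm_nonneg _) fun p ↦ ?_
  by_cases hp : p.Prime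
  · exact le_mul_of_one_le_right (abs_nonneg _)
      (one_le_rpow (by exact_mod_cast hp.one_lt.le) (by norm_num))
  · simp [coprimeCoeff_of_not_prime hp]

lemma prod_abs_coprimeCoeff_eq (k : ℕ) (s : Finset ℕ) :
    ∏ p ∈ s, |coprimeCoeff k p| * (p : ℝ) ^ (1 / 4 : ℝ)
      = |∏ p ∈ s, coprimeCoeff k p| * (∏ p ∈ s, (p : ℝ)) ^ (1 / 4 : ℝ) := by
  rw [prod_mul_distrib, abs_prod, finsetProd_rpow _ _ fun _ _ ↦ Nat.cast_nonneg _]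

lemma summable_prod_coprimeCoeff {k : ℕ} (hk : k ≠ 0) :
    Summable fun s : Finset ℕ ↦ ∏ p ∈ s, |coprimeCoeff k p| * (p : ℝ) ^ (1 / 4 : ℝ) :=
  summable_finsetProd_of_summable_norm <| (summable_coprimeCoeff hk).congr fun p ↦ by
    rw [norm_of_nonneg (by positivity)]

/-- The absolute constant bounding the Dirichlet series of `coprimeCoeff`. -/
noncomputable def coprimeConst : ℝ :=
  exp (∑' p : ℕ, |coprimeCoeff 1 p| * (p : ℝ) ^ (1 / 4 : ℝ))

lemma tsum_prod_coprimeCoeff_le {k : ℕ} (hk : k ≠ 0) :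
    ∑' s : Finset ℕ, ∏ p ∈ s, |coprimeCoeff k p| * (p : ℝ) ^ (1 / 4 : ℝ)
      ≤ 2 ^ #k.primeFactors * coprimeConst := by
  rw [← tprod_one_add (summable_prod_coprimeCoeff hk)]
  refine Multipliable.tprod_le_of_prod_le
    (multipliable_one_add_of_summable_prod (summable_prod_coprimeCoeff hk)) fun S ↦ ?_
  have hw : ∀ p : ℕ, 0 ≤ |coprimeCoeff 1 p| * (p : ℝ) ^ (1 / 4 : ℝ) := fun p ↦ by positivity
  calc ∏ p ∈ S, (1 + |coprimeCoeff k p| * (p : ℝ) ^ (1 / 4 : ℝ))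
      ≤ ∏ p ∈ S, (if p ∈ k.primeFactors then (2 : ℝ) else 1) *
          (1 + |coprimeCoeff 1 p| * (p : ℝ) ^ (1 / 4 : ℝ)) := by
        refine prod_le_prod (fun p _ ↦ by positivity) fun p _ ↦ ?_
        have h := abs_coprimeCoeff_mul_le hk p
        have h' := hw p
        split_ifs at h ⊢ <;> linarith
    _ = 2 ^ #(S.filter (· ∈ k.primeFactors)) *
          ∏ p ∈ S, (1 + |coprimeCoeff 1 p| * (p : ℝ) ^ (1 / 4 : ℝ)) := by
        rw [prod_mul_distrib, ← prod_filter, prod_const]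
    _ ≤ _ := by
        have h1 : #(S.filter (· ∈ k.primeFactors)) ≤ #k.primeFactors :=
          card_le_card fun p hp ↦ (mem_filter.mp hp).2
        refine mul_le_mul (pow_le_pow_right₀ one_le_two h1) ?_
          (prod_nonneg fun p _ ↦ by have := hw p; linarith) (by positivity)
        refine (prod_one_add_le_exp_sum S hw).trans (exp_le_exp.mpr ?_)
        exact summable_coprimeCoeff_one.sum_le_tsum S fun p _ ↦ hw p

lemma one_add_coprimeCoeff_ne_zero (k p : ℕ) : 1 + coprimeCoeff k p ≠ 0 := by
  unfold coprimeCoeff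
  split_ifs with hp hk
  · have h2 : (2 : ℝ) ≤ p := by exact_mod_cast hp.two_le
    have : (p : ℝ)⁻¹ ≤ 2⁻¹ := inv_anti₀ (by norm_num) h2
    norm_num at this ⊢
    linarith
  · have h2 : (2 : ℝ) ≤ p := by exact_mod_cast hp.two_le
    have : 0 < ((p : ℝ) * ((p : ℝ) - 1))⁻¹ := inv_pos.mpr (mul_pos (by linarith) (by linarith))
    linarith
  · norm_num

lemma sum_log_eq_log_prod {s : Finset ℕ} (hs : ∀ p ∈ s, p.Prime) :
    ∑ p ∈ s, log p = log (∏ p ∈ s, (p : ℝ)) :=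
  (log_prod fun p hp ↦ by exact_mod_cast (hs p hp).ne_zero).symm

lemma one_le_prod_primes {s : Finset ℕ} (hs : ∀ p ∈ s, p.Prime) :
    (1 : ℝ) ≤ ∏ p ∈ s, (p : ℝ) := by
  have : 1 ≤ ∏ p ∈ s, p :=
    Nat.one_le_iff_ne_zero.mpr (prod_ne_zero_iff.mpr fun p hp ↦ (hs p hp).ne_zero)
  rw [← Nat.cast_prod]
  exact_mod_cast this

/-- The asymptotic formula for `coprimeTotientSum` with the constants in unevaluated form. -/
lemma abs_coprimeTotientSum_sub_tprod_le {k : ℕ} (hk : k ≠ 0) {x : ℝ} (hx : 0 < x) :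
    |coprimeTotientSum k x - (∏' p, (1 + coprimeCoeff k p)) *
        (log x + eulerMascheroniConstant -
          ∑' p : ℕ, log p * coprimeCoeff k p / (1 + coprimeCoeff k p))|
      ≤ 5 * coprimeConst * 2 ^ #k.primeFactors * x ^ (-(1 / 4) : ℝ) := by
  set b : Finset ℕ → ℝ := fun s ↦ ∏ p ∈ s, coprimeCoeff k p with hb
  set D : Finset ℕ → ℝ := fun s ↦ ∏ p ∈ s, (p : ℝ) with hD
  have hw := summable_prod_coprimeCoeff hk
  simp_rw [prod_abs_coprimeCoeff_eq] at hw
  have hnorm := summable_norm_coprimeCoeff hk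
  have hbs : Summable b := summable_finsetProd_of_summable_norm hnorm
  have hlog : Summable fun s : Finset ℕ ↦ |b s| * ∑ p ∈ s, |log p| := by
    refine (hw.mul_left 4).of_nonneg_of_le (fun _ ↦ by positivity) fun s ↦ ?_
    by_cases hs : ∀ p ∈ s, p.Prime
    · have h1 := one_le_prod_primes hs
      have : ∑ p ∈ s, |log (p : ℝ)| = log (D s) := by
        rw [← sum_log_eq_log_prod hs]
        exact sum_congr rfl fun p _ ↦ abs_of_nonneg (log_natCast_nonneg p)
      rw [this, mul_left_comm]
      refine mul_le_mul_of_nonneg_left ?_ (abs_nonneg _)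
      refine (log_le_rpow_div (by positivity) (by norm_num : (0 : ℝ) < 1 / 4)).trans ?_
      apply le_of_eq; ring
    · simp [hb, prod_coprimeCoeff_eq_zero hs]
  have hlog' : Summable fun s : Finset ℕ ↦ b s * ∑ p ∈ s, log (p : ℝ) := by
    refine Summable.of_norm (hlog.of_nonneg_of_le (fun _ ↦ norm_nonneg _) fun s ↦ ?_)
    rw [norm_mul]
    exact mul_le_mul_of_nonneg_left (abs_sum_le_sum_abs _ _) (abs_nonneg _)
  have hmain : HasSum (fun s ↦ b s * (log x + eulerMascheroniConstant) -
      b s * ∑ p ∈ s, log (p : ℝ)) ((∏' p, (1 + coprimeCoeff k p)) *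
        (log x + eulerMascheroniConstant -
          ∑' p : ℕ, log p * coprimeCoeff k p / (1 + coprimeCoeff k p))) := by
    have h1 := hbs.hasSum.mul_right (log x + eulerMascheroniConstant)
    have h2 := hlog'.hasSum
    rw [tsum_prod_mul_sum hnorm (one_add_coprimeCoeff_ne_zero k) hlog] at h2
    rw [← tprod_one_add hbs] at h1
    rw [mul_sub]
    exact h1.sub h2
  have hdiff := (hasSum_coprimeTotientSum k x).sub hmain
  have hbound := (hw.mul_left (5 * x ^ (-(1 / 4) : ℝ))).hasSum
  rw [← norm_eq_abs, ← hdiff.tsum_eq]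
  refine (tsum_of_norm_bounded hbound fun s ↦ ?_).trans ?_
  · by_cases hs : ∀ p ∈ s, p.Prime
    · have h1 : 1 ≤ D s := one_le_prod_primes hs
      have h0 : 0 < D s := by linarith
      have h := abs_sum_floor_inv_sub_le (div_pos hx h0)
      rw [sum_log_eq_log_prod hs, ← mul_sub, ← mul_sub, norm_mul, norm_eq_abs, norm_eq_abs]
      rw [log_div hx.ne' h0.ne', div_rpow hx.le h0.le, rpow_neg h0.le, div_inv_eq_mul] at h
      calc _ ≤ |b s| * (5 * (x ^ (-(1 / 4) : ℝ) * D s ^ (1 / 4 : ℝ))) := by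
            refine mul_le_mul_of_nonneg_left ?_ (abs_nonneg _)
            have e : log x + eulerMascheroniConstant - log (∏ p ∈ s, (p : ℝ))
                = log x - log (D s) + eulerMascheroniConstant := by simp only [hD]; ring
            rw [e]
            exact h
        _ = _ := by ring
    · simp [hb, prod_coprimeCoeff_eq_zero hs]
  · rw [tsum_mul_left]
    have h := tsum_prod_coprimeCoeff_le hk
    simp_rw [prod_abs_coprimeCoeff_eq] at h
    calc _ ≤ 5 * x ^ (-(1 / 4) : ℝ) * (2 ^ #k.primeFactors * coprimeConst) := by gcongr
      _ = _ := by ring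

lemma coprimeCoeff_one {p : ℕ} (hp : p.Prime) :
    coprimeCoeff 1 p = 1 / ((p : ℝ) * ((p : ℝ) - 1)) := by
  simp [coprimeCoeff, hp, hp.one_lt.ne']

lemma coprimeCoeff_of_notMem_primeFactors {k p : ℕ} (hk : k ≠ 0) (h : p ∉ k.primeFactors) :
    coprimeCoeff k p = coprimeCoeff 1 p := by
  by_cases hp : p.Prime
  · have hpk : ¬ p ∣ k := fun hd ↦ h (Nat.mem_primeFactors.mpr ⟨hp, hd, hk⟩)
    simp [coprimeCoeff, hp, hpk, hp.one_lt.ne']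
  · simp [coprimeCoeff, hp]

lemma coprimeCoeff_of_mem_primeFactors {k p : ℕ} (h : p ∈ k.primeFactors) :
    coprimeCoeff k p = -(p : ℝ)⁻¹ := by
  simp [coprimeCoeff, Nat.prime_of_mem_primeFactors h, Nat.dvd_of_mem_primeFactors h]

lemma hConst_eq_tprod : hConst = ∏' p : ℕ, (1 + coprimeCoeff 1 p) := by
  have h := tprod_subtype {p : ℕ | p.Prime} fun p ↦ 1 + coprimeCoeff 1 p
  have h2 : ∀ p : ℕ, ({p : ℕ | p.Prime}.mulIndicator fun p ↦ 1 + coprimeCoeff 1 p) p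
      = 1 + coprimeCoeff 1 p := by
    intro p
    by_cases hp : p.Prime
    · exact Set.mulIndicator_of_mem hp _
    · rw [Set.mulIndicator_of_notMem (s := {p : ℕ | p.Prime}) hp,
        coprimeCoeff_of_not_prime hp, add_zero]
  simp_rw [h2] at h
  rw [← h, hConst]
  exact tprod_congr fun p : Nat.Primes ↦ by rw [coprimeCoeff_one p.2]

lemma tprod_one_add_coprimeCoeff {k : ℕ} (hk : k ≠ 0) :
    ∏' p : ℕ, (1 + coprimeCoeff k p) = hConst * gFunc k := by
  have h1 : HasProd (fun p : ℕ ↦ 1 + coprimeCoeff 1 p) hConst := by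
    rw [hConst_eq_tprod]
    exact (multipliable_one_add_of_summable_prod
      (summable_finsetProd_of_summable_norm (summable_norm_coprimeCoeff one_ne_zero))).hasProd
  have h2 : HasProd (fun p : ℕ ↦ if p ∈ k.primeFactors then
      (1 + (p : ℝ) / ((p : ℝ) - 1) ^ 2)⁻¹ else 1) (gFunc k) := by
    have : gFunc k = ∏ p ∈ k.primeFactors, if p ∈ k.primeFactors then
        (1 + (p : ℝ) / ((p : ℝ) - 1) ^ 2)⁻¹ else 1 :=
      prod_congr rfl fun p hp ↦ (if_pos hp).symm
    rw [this]
    exact hasProd_prod_of_ne_finset_one fun p hp ↦ if_neg hp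
  rw [← (h1.mul h2).tprod_eq]
  refine tprod_congr fun p ↦ ?_
  split_ifs with h
  · have hp := Nat.prime_of_mem_primeFactors h
    have hp1 : (1 : ℝ) < p := by exact_mod_cast hp.one_lt
    have e1 : (p : ℝ) - 1 ≠ 0 := by linarith
    have e2 : (p : ℝ) ≠ 0 := by linarith
    have e3 : ((p : ℝ) - 1) ^ 2 + p ≠ 0 := by positivity
    rw [coprimeCoeff_of_mem_primeFactors h, coprimeCoeff_one hp]
    field_simp
    ring
  · rw [coprimeCoeff_of_notMem_primeFactors hk h, mul_one]

lemma log_mul_coprimeCoeff_one {p : ℕ} (hp : p.Prime) :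
    log p * coprimeCoeff 1 p / (1 + coprimeCoeff 1 p)
      = log p / (1 + (p : ℝ) * ((p : ℝ) - 1)) := by
  have hp1 : (1 : ℝ) < p := by exact_mod_cast hp.one_lt
  have e0 : 0 < (p : ℝ) - 1 := by linarith
  have e1 : (p : ℝ) - 1 ≠ 0 := e0.ne'
  have e2 : (p : ℝ) ≠ 0 := by linarith
  have e3 : 1 + (p : ℝ) * ((p : ℝ) - 1) ≠ 0 := by positivity
  have e4 : (p : ℝ) * ((p : ℝ) - 1) + 1 ≠ 0 := by positivity
  rw [coprimeCoeff_one hp]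
  field_simp
  ring

lemma tsum_log_mul_coprimeCoeff_one :
    ∑' p : ℕ, log p * coprimeCoeff 1 p / (1 + coprimeCoeff 1 p)
      = eulerMascheroniConstant - lamConst := by
  have h := tsum_subtype {p : ℕ | p.Prime} fun p ↦
    log p * coprimeCoeff 1 p / (1 + coprimeCoeff 1 p)
  have h2 : ∀ p : ℕ, ({p : ℕ | p.Prime}.indicator fun p : ℕ ↦
      log p * coprimeCoeff 1 p / (1 + coprimeCoeff 1 p)) p
      = log p * coprimeCoeff 1 p / (1 + coprimeCoeff 1 p) := by
    intro p
    by_cases hp : p.Prime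
    · exact Set.indicator_of_mem hp _
    · rw [Set.indicator_of_notMem (s := {p : ℕ | p.Prime}) hp, coprimeCoeff_of_not_prime hp]
      simp
  simp_rw [h2] at h
  rw [← h, lamConst, sub_sub_cancel]
  exact tsum_congr fun p : Nat.Primes ↦ log_mul_coprimeCoeff_one p.2

lemma summable_log_mul_coprimeCoeff_one :
    Summable fun p : ℕ ↦ log p * coprimeCoeff 1 p / (1 + coprimeCoeff 1 p) := by
  refine Summable.of_norm ((summable_coprimeCoeff_one.mul_left 4).of_nonneg_of_le
    (fun _ ↦ norm_nonneg _) fun p ↦ ?_)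
  by_cases hp : p.Prime
  · have hp1 : (1 : ℝ) < p := by exact_mod_cast hp.one_lt
    have e0 : 0 < coprimeCoeff 1 p := by
      rw [coprimeCoeff_one hp]
      exact one_div_pos.mpr (mul_pos (by linarith) (by linarith))
    have hl : log p ≤ 4 * (p : ℝ) ^ (1 / 4 : ℝ) := by
      refine (log_le_rpow_div (by positivity) (by norm_num : (0 : ℝ) < 1 / 4)).trans ?_
      apply le_of_eq; ring
    have hl0 := log_natCast_nonneg p
    rw [norm_of_nonneg (by positivity), abs_of_pos e0]
    calc _ ≤ log p * coprimeCoeff 1 p := div_le_self (by positivity) (by linarith)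
      _ ≤ 4 * (p : ℝ) ^ (1 / 4 : ℝ) * coprimeCoeff 1 p := by gcongr
      _ = _ := by ring
  · simp [coprimeCoeff_of_not_prime hp]

lemma tsum_log_mul_coprimeCoeff {k : ℕ} (hk : k ≠ 0) :
    ∑' p : ℕ, log p * coprimeCoeff k p / (1 + coprimeCoeff k p)
      = eulerMascheroniConstant - lamConst - thetaFunc k := by
  have h1 := summable_log_mul_coprimeCoeff_one.hasSum
  rw [tsum_log_mul_coprimeCoeff_one] at h1
  have h2 : HasSum (fun p : ℕ ↦ if p ∈ k.primeFactors then (p : ℝ) ^ 2 * log (p : ℝ) /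
      (((p : ℝ) - 1) * ((p : ℝ) ^ 2 - (p : ℝ) + 1)) else 0) (thetaFunc k) := by
    have : thetaFunc k = ∑ p ∈ k.primeFactors, if p ∈ k.primeFactors then (p : ℝ) ^ 2 *
        log (p : ℝ) / (((p : ℝ) - 1) * ((p : ℝ) ^ 2 - (p : ℝ) + 1)) else 0 :=
      sum_congr rfl fun p hp ↦ (if_pos hp).symm
    rw [this]
    exact hasSum_sum_of_ne_finset_zero fun p hp ↦ if_neg hp
  rw [← (h1.sub h2).tsum_eq]
  refine tsum_congr fun p ↦ ?_
  split_ifs with h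
  · have hp := Nat.prime_of_mem_primeFactors h
    have hp1 : (1 : ℝ) < p := by exact_mod_cast hp.one_lt
    have e0 : 0 < (p : ℝ) - 1 := by linarith
    have e1 : (p : ℝ) - 1 ≠ 0 := e0.ne'
    have e2 : (p : ℝ) ≠ 0 := by linarith
    have e3 : 1 + (p : ℝ) * ((p : ℝ) - 1) ≠ 0 := by positivity
    have e4 : (p : ℝ) ^ 2 - p + 1 ≠ 0 := by
      convert e3 using 1; ring
    have e5 : log p * -(p : ℝ)⁻¹ / (1 + -(p : ℝ)⁻¹) = - (log p / ((p : ℝ) - 1)) := by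
      have : 1 + -(p : ℝ)⁻¹ = ((p : ℝ) - 1) / p := by field_simp; ring
      rw [this]
      field_simp
    rw [log_mul_coprimeCoeff_one hp, coprimeCoeff_of_mem_primeFactors h, e5,
      show 1 + (p : ℝ) * ((p : ℝ) - 1) = (p : ℝ) ^ 2 - p + 1 by ring]
    field_simp
    ring
  · rw [coprimeCoeff_of_notMem_primeFactors hk h, sub_zero]

/-- `∑_{r ≤ x, (r,k)=1} 1/φ(r) = h g(k) (log x + λ + ϑ(k)) + O(2^{ω(k)} x^{-1/4})` for `x > 0`. -/
lemma abs_coprimeTotientSum_sub_le {k : ℕ} (hk : k ≠ 0) {x : ℝ} (hx : 0 < x) :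
    |coprimeTotientSum k x - hConst * gFunc k * (log x + lamConst + thetaFunc k)|
      ≤ 5 * coprimeConst * 2 ^ #k.primeFactors * x ^ (-(1 / 4) : ℝ) := by
  have h := abs_coprimeTotientSum_sub_tprod_le hk hx
  rw [tprod_one_add_coprimeCoeff hk, tsum_log_mul_coprimeCoeff hk] at h
  convert h using 4
  ring

/-- `∑_{r ≤ x, (r,k)=1} 1/φ(r) = O(log 2x)` uniformly in `k`. -/
lemma exists_coprimeTotientSum_le : ∃ C : ℝ, 0 < C ∧ ∀ (k : ℕ) (x : ℝ), 1 ≤ x →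
    coprimeTotientSum k x ≤ C * log (2 * x) := by
  refine ⟨|hConst| + (|hConst| * |lamConst| + 5 * coprimeConst) / log 2, ?_, fun k x hx ↦ ?_⟩
  · have : 0 < coprimeConst := exp_pos _
    have := log_pos one_lt_two
    positivity
  have hE : 0 < coprimeConst := exp_pos _
  have hl2 := log_pos one_lt_two
  have hx0 : 0 < x := by linarith
  have hmono : coprimeTotientSum k x ≤ coprimeTotientSum 1 x := by
    refine sum_le_sum_of_subset_of_nonneg (fun r hr ↦ ?_) fun _ _ _ ↦ by positivity
    simp only [mem_filter, Nat.coprime_one_right_eq_true, and_true] at hr ⊢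
    exact hr.1
  have h := (abs_le.mp (abs_coprimeTotientSum_sub_le one_ne_zero hx0)).2
  have hg : gFunc 1 = 1 := by simp [gFunc]
  have ht : thetaFunc 1 = 0 := by simp [thetaFunc]
  rw [hg, ht, Nat.primeFactors_one, card_empty, pow_zero] at h
  have hx1 : x ^ (-(1 / 4) : ℝ) ≤ 1 := rpow_le_one_of_one_le_of_nonpos hx (by norm_num)
  have hlx := log_nonneg hx
  have hlog : log (2 * x) = log 2 + log x := log_mul two_ne_zero hx0.ne'
  have h1 : hConst * (log x + lamConst) ≤ |hConst| * (log x + |lamConst|) := by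
    have a := mul_le_mul_of_nonneg_right (le_abs_self hConst) hlx
    have b : hConst * lamConst ≤ |hConst| * |lamConst| := by
      rw [← abs_mul]; exact le_abs_self _
    linarith
  have h2 : 5 * coprimeConst * x ^ (-(1 / 4) : ℝ) ≤ 5 * coprimeConst :=
    mul_le_of_le_one_right (by positivity) hx1
  have h3 : |hConst| * |lamConst| + 5 * coprimeConst ≤
      (|hConst| * |lamConst| + 5 * coprimeConst) / log 2 * log (2 * x) := by
    rw [div_mul_eq_mul_div, le_div_iff₀ hl2]
    refine mul_le_mul_of_nonneg_left (by linarith) (by positivity)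
  have h4 : |hConst| * log x ≤ |hConst| * log (2 * x) :=
    mul_le_mul_of_nonneg_left (by linarith) (abs_nonneg _)
  linarith

lemma dvd_pow_of_primeFactors_subset {m d N : ℕ} (hm : m ≠ 0) (hd : d ≠ 0)
    (h : d.primeFactors ⊆ m.primeFactors) (hN : d ≤ N) : d ∣ m ^ N := by
  rw [← Nat.factorization_prime_le_iff_dvd hd (pow_ne_zero _ hm)]
  intro p hp
  by_cases hpd : p ∣ d
  · have hpm := Nat.dvd_of_mem_primeFactors (h (Nat.mem_primeFactors.mpr ⟨hp, hpd, hd⟩))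
    have h1 := hp.factorization_pos_of_dvd hm hpm
    have h2 := Nat.factorization_lt p hd
    simp only [Nat.factorization_pow, Finsupp.smul_apply, smul_eq_mul]
    nlinarith
  · simp [Nat.factorization_eq_zero_of_not_dvd hpd]

lemma primeFactors_gcd_pow_subset {m : ℕ} (hm : m ≠ 0) (r : ℕ) :
    (r.gcd (m ^ r)).primeFactors ⊆ m.primeFactors := by
  intro p hp
  have hpp := Nat.prime_of_mem_primeFactors hp
  exact Nat.mem_primeFactors.mpr ⟨hpp, hpp.dvd_of_dvd_pow
    ((Nat.dvd_of_mem_primeFactors hp).trans (Nat.gcd_dvd_right _ _)), hm⟩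

lemma coprime_div_gcd_pow {m r : ℕ} (hm : m ≠ 0) (hr : r ≠ 0) :
    (r / r.gcd (m ^ r)).Coprime m := by
  by_contra hc
  obtain ⟨p, hp, hpr, hpm⟩ := Nat.Prime.not_coprime_iff_dvd.mp hc
  have hdvd := Nat.gcd_dvd_left r (m ^ r)
  have hq : r / r.gcd (m ^ r) ≠ 0 :=
    (Nat.div_pos (Nat.le_of_dvd (Nat.pos_of_ne_zero hr) hdvd)
      (Nat.gcd_pos_of_pos_left _ (Nat.pos_of_ne_zero hr))).ne'
  have h1 := hp.factorization_pos_of_dvd hq hpr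
  have h2 := hp.factorization_pos_of_dvd hm hpm
  have h3 := Nat.factorization_lt p hr
  rw [Nat.factorization_div hdvd, Nat.factorization_gcd hr (pow_ne_zero _ hm)] at h1
  simp only [Nat.factorization_pow, Finsupp.coe_tsub, Pi.sub_apply, Finsupp.inf_apply,
    Finsupp.smul_apply, smul_eq_mul] at h1
  have : r.factorization p ≤ r * m.factorization p := by nlinarith
  rw [min_eq_left this] at h1
  lia

lemma gcd_mul_pow_eq {m d s : ℕ} (hm : m ≠ 0) (hd : d ≠ 0) (hs : s ≠ 0)
    (h : d.primeFactors ⊆ m.primeFactors) (hsm : s.Coprime m) :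
    (d * s).gcd (m ^ (d * s)) = d := by
  rw [Nat.Coprime.gcd_mul_right_cancel _ (hsm.pow_right _)]
  exact Nat.gcd_eq_left (dvd_pow_of_primeFactors_subset hm hd h
    (Nat.le_mul_of_pos_right _ (Nat.pos_of_ne_zero hs)))

lemma coprime_of_primeFactors_subset {m d s : ℕ} (hm : m ≠ 0) (hd : d ≠ 0)
    (h : d.primeFactors ⊆ m.primeFactors) (hsm : s.Coprime m) : s.Coprime d :=
  (hsm.pow_right d).coprime_dvd_right (dvd_pow_of_primeFactors_subset hm hd h le_rfl)

lemma totient_mul_of_primeFactors_subset {m d : ℕ} (hm : m ≠ 0) (hd : d ≠ 0)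
    (h : d.primeFactors ⊆ m.primeFactors) : (m * d).totient = d * m.totient := by
  have h1 := Nat.totient_eq_mul_prod_factors (m * d)
  rw [Nat.primeFactors_mul hm hd, union_eq_left.mpr h] at h1
  have h2 := Nat.totient_eq_mul_prod_factors m
  have : ((m * d).totient : ℚ) = d * m.totient := by
    rw [h1, h2]; push_cast; ring
  exact_mod_cast this

/-- Splitting off the part of `r` supported on the primes dividing `m`. -/
lemma sum_totient_mul_eq {m n : ℕ} (hm : m ≠ 0) (R : ℝ) :
    ∑ r ∈ (Icc 1 ⌊R⌋₊).filter (fun r ↦ r.Coprime n), (1 : ℝ) / (m * r).totient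
      = (1 / m.totient) * ∑ δ ∈ (Icc 1 ⌊R⌋₊).filter
          (fun δ ↦ δ.primeFactors ⊆ m.primeFactors ∧ δ.Coprime n),
          1 / δ * coprimeTotientSum (m * n) (R / δ) := by
  have hmaps : ∀ r ∈ (Icc 1 ⌊R⌋₊).filter (fun r ↦ r.Coprime n), r.gcd (m ^ r) ∈
      (Icc 1 ⌊R⌋₊).filter (fun δ ↦ δ.primeFactors ⊆ m.primeFactors ∧ δ.Coprime n) := by
    intro r hr
    rw [mem_filter, mem_Icc] at hr
    have hdvd := Nat.gcd_dvd_left r (m ^ r)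
    rw [mem_filter, mem_Icc]
    exact ⟨⟨Nat.gcd_pos_of_pos_left _ hr.1.1, (Nat.le_of_dvd hr.1.1 hdvd).trans hr.1.2⟩,
      primeFactors_gcd_pow_subset hm r, hr.2.coprime_dvd_left hdvd⟩
  rw [← sum_fiberwise_of_maps_to hmaps, mul_sum]
  refine sum_congr rfl fun δ hδ ↦ ?_
  rw [mem_filter, mem_Icc] at hδ
  obtain ⟨⟨hδ1, hδR⟩, hsub, hδn⟩ := hδ
  have hδ0 : δ ≠ 0 := by lia
  rw [coprimeTotientSum, mul_sum, mul_sum, Nat.floor_div_natCast]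
  refine (sum_nbij' (fun s ↦ δ * s) (fun r ↦ r / δ) ?_ ?_ ?_ ?_ ?_).symm
  · intro s hs
    rw [mem_filter, mem_Icc] at hs
    have hle := (Nat.le_div_iff_mul_le hδ1).mp hs.1.2
    simp only [mem_filter, mem_Icc]
    exact ⟨⟨⟨Nat.mul_pos hδ1 hs.1.1, by linarith⟩,
      hδn.mul_left (Nat.Coprime.coprime_mul_left_right hs.2)⟩,
      gcd_mul_pow_eq hm hδ0 (by lia) hsub (Nat.Coprime.coprime_mul_right_right hs.2)⟩
  · intro r hr
    simp only [mem_filter, mem_Icc] at hr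
    obtain ⟨⟨⟨hr1, hrR⟩, hrn⟩, hg⟩ := hr
    have hdvd : δ ∣ r := hg ▸ Nat.gcd_dvd_left r (m ^ r)
    rw [mem_filter, mem_Icc]
    refine ⟨⟨Nat.div_pos (Nat.le_of_dvd hr1 hdvd) hδ1, Nat.div_le_div_right hrR⟩,
      Nat.Coprime.mul_right ?_ (hrn.coprime_dvd_left (Nat.div_dvd_of_dvd hdvd))⟩
    have := coprime_div_gcd_pow hm (r := r) (by lia)
    rwa [hg] at this
  · intro s _
    exact Nat.mul_div_cancel_left s hδ1
  · intro r hr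
    simp only [mem_filter, mem_Icc] at hr
    exact Nat.mul_div_cancel' (hr.2 ▸ Nat.gcd_dvd_left r (m ^ r))
  · intro s hs
    rw [mem_filter, mem_Icc] at hs
    have hsm := Nat.Coprime.coprime_mul_right_right hs.2
    have hcop : (m * δ).Coprime s :=
      Nat.Coprime.mul_left hsm.symm (coprime_of_primeFactors_subset hm hδ0 hsub hsm).symm
    rw [← mul_assoc m, Nat.totient_mul hcop, totient_mul_of_primeFactors_subset hm hδ0 hsub]
    push_cast
    rw [one_div_mul_one_div, one_div_mul_one_div]
    ring_nf

lemma inv_one_sub_rpow_le {p : ℕ} (hp : p.Prime) :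
    (1 - (p : ℝ) ^ (-(3 / 4) : ℝ))⁻¹ ≤ 2 * if p = 2 then 2 else 1 := by
  have h0 : (0 : ℝ) < p := by exact_mod_cast hp.pos
  have aux : ∀ c : ℝ, 0 < c → c ^ 4 ≤ (p : ℝ) ^ 3 → (p : ℝ) ^ (-(3 / 4) : ℝ) ≤ c⁻¹ := by
    intro c hc h
    rw [rpow_neg h0.le]
    refine inv_anti₀ hc ?_
    refine le_of_pow_le_pow_left₀ four_ne_zero (by positivity) (h.trans_eq ?_)
    rw [← rpow_natCast, ← rpow_natCast, ← rpow_mul h0.le]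
    norm_num
  split_ifs with h
  · have := aux (4 / 3) (by norm_num) (by rw [h]; norm_num)
    rw [inv_le_comm₀ (by norm_num at this ⊢; linarith) (by norm_num)]
    norm_num at this ⊢
    linarith
  · have h3 : (3 : ℝ) ≤ p := by
      exact_mod_cast (Nat.lt_of_le_of_ne hp.two_le (Ne.symm h))
    have h27 : (3 : ℝ) ^ 3 ≤ (p : ℝ) ^ 3 := by gcongr
    have := aux 2 (by norm_num) (by linarith)
    rw [inv_le_comm₀ (by norm_num at this ⊢; linarith) (by norm_num)]
    norm_num at this ⊢
    linarith

/-- Rankin-type bound for the sum of `δ^{-3/4}` over `δ ∣ m^∞`. -/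
lemma sum_rpow_primeFactors_subset_le (m : ℕ) {F : Finset ℕ}
    (hF : ∀ δ ∈ F, δ ≠ 0 ∧ δ.primeFactors ⊆ m.primeFactors) :
    ∑ δ ∈ F, (δ : ℝ) ^ (-(3 / 4) : ℝ) ≤ 2 * 2 ^ #m.primeFactors := by
  let f : ℕ →* ℝ :=
    { toFun := fun n ↦ (n : ℝ) ^ (-(3 / 4) : ℝ)
      map_one' := by simp
      map_mul' := fun a b ↦ by
        rw [Nat.cast_mul, mul_rpow (Nat.cast_nonneg _) (Nat.cast_nonneg _)] }
  have hf : ∀ {p : ℕ}, p.Prime → ‖f p‖ < 1 := by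
    intro p hp
    have h1 : (1 : ℝ) < p := by exact_mod_cast hp.one_lt
    change ‖(p : ℝ) ^ (-(3 / 4) : ℝ)‖ < 1
    rw [norm_of_nonneg (by positivity)]
    exact rpow_lt_one_of_one_lt_of_neg h1 (by norm_num)
  have hsum := (EulerProduct.summable_and_hasSum_factoredNumbers_prod_filter_prime_geometric
    hf m.primeFactors).2
  rw [filter_true_of_mem fun p hp ↦ Nat.prime_of_mem_primeFactors hp] at hsum
  have hsum' : HasSum ((Nat.factoredNumbers m.primeFactors).indicator f)
      (∏ p ∈ m.primeFactors, (1 - f p)⁻¹) := hasSum_subtype_iff_indicator.mp hsum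
  calc ∑ δ ∈ F, (δ : ℝ) ^ (-(3 / 4) : ℝ)
      = ∑ δ ∈ F, (Nat.factoredNumbers m.primeFactors).indicator f δ := by
        refine sum_congr rfl fun δ hδ ↦ ?_
        rw [Set.indicator_of_mem (Nat.mem_factoredNumbers_iff_primeFactors_subset.mpr (hF δ hδ))]
        rfl
    _ ≤ ∏ p ∈ m.primeFactors, (1 - f p)⁻¹ := by
        refine sum_le_hasSum F (fun δ _ ↦ Set.indicator_nonneg (fun d _ ↦ ?_) δ) hsum'
        exact rpow_nonneg (Nat.cast_nonneg d) _
    _ ≤ ∏ p ∈ m.primeFactors, (2 * if p = 2 then (2 : ℝ) else 1) := by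
        refine prod_le_prod (fun p hp ↦ ?_) fun p hp ↦
          inv_one_sub_rpow_le (Nat.prime_of_mem_primeFactors hp)
        have := hf (Nat.prime_of_mem_primeFactors hp)
        rw [norm_eq_abs] at this
        exact inv_nonneg.mpr (sub_nonneg.mpr ((le_abs_self _).trans this.le))
    _ ≤ _ := by
        rw [prod_mul_distrib, prod_const, prod_ite_eq', mul_comm]
        split_ifs
        · exact le_rfl
        · exact mul_le_mul_of_nonneg_right one_le_two (by positivity)

lemma two_pow_card_primeFactors_le {k : ℕ} (hk : k ≠ 0) :
    2 ^ #k.primeFactors ≤ #k.divisors := by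
  rw [Nat.card_divisors hk, ← prod_const]
  refine prod_le_prod' fun p hp ↦ ?_
  have := (Nat.prime_of_mem_primeFactors hp).factorization_pos_of_dvd hk
    (Nat.dvd_of_mem_primeFactors hp)
  lia

/-- Termwise comparison of the two sides after splitting off `δ ∣ m^∞`. -/
lemma exists_abs_term_le : ∃ C : ℝ, 0 < C ∧ ∀ (k d : ℕ) (R R₀ : ℝ), k ≠ 0 → 1 ≤ d → 1 ≤ R₀ →
    R₀ ≤ R → d ≤ R →
    |1 / d * coprimeTotientSum k (R / d) - (if d ≤ ⌊R₀⌋₊ then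
        hConst * gFunc k * (1 / d * (log R + lamConst + thetaFunc k - log d)) else 0)|
      ≤ C * 2 ^ #k.primeFactors * log (2 * R) * R₀ ^ (-(1 / 4) : ℝ) * (d : ℝ) ^ (-(3 / 4) : ℝ) := by
  obtain ⟨C₁, hC₁, hS⟩ := exists_coprimeTotientSum_le
  have hE : 0 < coprimeConst := exp_pos _
  have hl2 := log_pos one_lt_two
  refine ⟨5 * coprimeConst / log 2 + C₁, by positivity, fun k d R R₀ hk hd hR₀ hR hdR ↦ ?_⟩
  have hd1 : (1 : ℝ) ≤ d := by exact_mod_cast hd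
  have hd0 : (0 : ℝ) < d := by linarith
  have hR0 : 0 < R := by linarith
  have hR₀0 : 0 < R₀ := by linarith
  have hlog2R : log 2 ≤ log (2 * R) := log_le_log two_pos (by linarith)
  have hpow1 : (1 : ℝ) ≤ 2 ^ #k.primeFactors := one_le_pow₀ one_le_two
  have hsplit : (1 : ℝ) / d = (d : ℝ) ^ (-(3 / 4) : ℝ) * (d : ℝ) ^ (-(1 / 4) : ℝ) := by
    rw [← rpow_add hd0, one_div, ← rpow_neg_one]; norm_num
  have hq1 : 0 < (d : ℝ) ^ (-(3 / 4) : ℝ) := by positivity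
  have hq2 : 0 < R₀ ^ (-(1 / 4) : ℝ) := by positivity
  have hL : 0 < log (2 * R) := by linarith
  split_ifs with h
  · have hb := abs_coprimeTotientSum_sub_le hk (div_pos hR0 hd0)
    have hRR : R ^ (-(1 / 4) : ℝ) ≤ R₀ ^ (-(1 / 4) : ℝ) :=
      rpow_le_rpow_of_nonpos hR₀0 hR (by norm_num)
    have hcancel : (1 : ℝ) / d * (R / d) ^ (-(1 / 4) : ℝ)
        = R ^ (-(1 / 4) : ℝ) * (d : ℝ) ^ (-(3 / 4) : ℝ) := by
      rw [hsplit, div_rpow hR0.le hd0.le]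
      have : (d : ℝ) ^ (-(1 / 4) : ℝ) ≠ 0 := by positivity
      field_simp
    rw [log_div hR0.ne' hd0.ne'] at hb
    calc _ = 1 / d * |coprimeTotientSum k (R / d) -
            hConst * gFunc k * (log R - log d + lamConst + thetaFunc k)| := by
          rw [← abs_of_pos (one_div_pos.mpr hd0), ← abs_mul, abs_of_pos (one_div_pos.mpr hd0)]
          congr 1
          ring
      _ ≤ 1 / d * (5 * coprimeConst * 2 ^ #k.primeFactors * (R / d) ^ (-(1 / 4) : ℝ)) := by
          gcongr
      _ = 5 * coprimeConst * 2 ^ #k.primeFactors *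
            (R ^ (-(1 / 4) : ℝ) * (d : ℝ) ^ (-(3 / 4) : ℝ)) := by
          rw [← hcancel]; ring
      _ ≤ (5 * coprimeConst / log 2 * log (2 * R)) * 2 ^ #k.primeFactors *
            (R₀ ^ (-(1 / 4) : ℝ) * (d : ℝ) ^ (-(3 / 4) : ℝ)) := by
          have hc : 5 * coprimeConst ≤ 5 * coprimeConst / log 2 * log (2 * R) := by
            rw [div_mul_eq_mul_div, le_div_iff₀ hl2]
            gcongr
          gcongr ?_ * _ * (?_ * _)
      _ ≤ ((5 * coprimeConst / log 2 + C₁) * log (2 * R)) * 2 ^ #k.primeFactors *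
            (R₀ ^ (-(1 / 4) : ℝ) * (d : ℝ) ^ (-(3 / 4) : ℝ)) := by
          gcongr
          linarith
      _ = _ := by ring
  · have hlt : R₀ ≤ d := ((Nat.floor_lt hR₀0.le).mp (not_le.mp h)).le
    have hdd : (d : ℝ) ^ (-(1 / 4) : ℝ) ≤ R₀ ^ (-(1 / 4) : ℝ) :=
      rpow_le_rpow_of_nonpos hR₀0 hlt (by norm_num)
    have hS0 : 0 ≤ coprimeTotientSum k (R / d) := sum_nonneg fun _ _ ↦ by positivity
    have hSle : coprimeTotientSum k (R / d) ≤ C₁ * log (2 * R) := by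
      refine (hS k _ ((one_le_div hd0).mpr hdR)).trans ?_
      have : R / d ≤ R := div_le_self hR0.le hd1
      have : 0 < R / d := by positivity
      gcongr
    rw [sub_zero, abs_of_nonneg (by positivity), hsplit]
    calc _ ≤ (d : ℝ) ^ (-(3 / 4) : ℝ) * R₀ ^ (-(1 / 4) : ℝ) * (C₁ * log (2 * R)) := by
          gcongr
      _ ≤ (d : ℝ) ^ (-(3 / 4) : ℝ) * R₀ ^ (-(1 / 4) : ℝ) *
            (((5 * coprimeConst / log 2 + C₁) * 2 ^ #k.primeFactors) * log (2 * R)) := by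
          gcongr
          have : 0 ≤ 5 * coprimeConst / log 2 := by positivity
          nlinarith
      _ = _ := by ring

lemma mul_thetaFn_zero_sub_thetaFn_one {m n : ℕ} {R R₀ : ℝ} (hR : R₀ ≤ R) (A : ℝ) :
    A * ThetaFn 0 m n R₀ - ThetaFn 1 m n R₀ = ∑ δ ∈ (Icc 1 ⌊R⌋₊).filter
      (fun δ ↦ δ.primeFactors ⊆ m.primeFactors ∧ δ.Coprime n),
      if δ ≤ ⌊R₀⌋₊ then 1 / (δ : ℝ) * (A - log δ) else 0 := by
  rw [ThetaFn, ThetaFn, mul_sum, ← sum_sub_distrib, ← sum_filter, filter_filter]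
  have hfl := Nat.floor_le_floor hR
  refine sum_congr ?_ fun δ _ ↦ by ring
  ext δ
  simp only [mem_filter, mem_Icc]
  constructor
  · rintro ⟨⟨h1, h2⟩, h3⟩
    exact ⟨⟨h1, h2.trans hfl⟩, h3, h2⟩
  · rintro ⟨⟨h1, _⟩, h3, h2⟩
    exact ⟨⟨h1, h2⟩, h3⟩

/-- Uniformly for `R ≥ R₀ ≥ 1` and `m, n ≥ 1`:
`∑_{r ≤ R, (r,n)=1} 1/φ(mr) = (h g(mn)/φ(m)) ((log R + λ + ϑ(mn)) Θ₀(m,n;R₀) − Θ₁(m,n;R₀))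
  + O(τ(mn)² log 2R / (φ(m) R₀^{1/4}))`. -/
theorem stmt_3 :
    ∃ C : ℝ, 0 < C ∧ ∀ (m n : ℕ) (R R₀ : ℝ), 1 ≤ m → 1 ≤ n → 1 ≤ R₀ → R₀ ≤ R →
      |(∑ r ∈ (Finset.Icc 1 ⌊R⌋₊).filter (fun r => Nat.Coprime r n),
          (1 : ℝ) / (Nat.totient (m * r)))
        - hConst * gFunc (m * n) / (Nat.totient m) *
            ((Real.log R + lamConst + thetaFunc (m * n)) * ThetaFn 0 m n R₀
              - ThetaFn 1 m n R₀)|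
      ≤ C * ((m * n).divisors.card : ℝ) ^ 2 * Real.log (2 * R)
          / ((Nat.totient m) * R₀ ^ ((1 : ℝ)/4)) := by
  obtain ⟨C, hC, hterm⟩ := exists_abs_term_le
  refine ⟨2 * C, by positivity, fun m n R R₀ hm hn hR₀ hR ↦ ?_⟩
  have hm0 : m ≠ 0 := by lia
  have hk : m * n ≠ 0 := Nat.mul_ne_zero hm0 (by lia)
  have hR0 : 0 ≤ R := by linarith
  have hφ : (0 : ℝ) < m.totient := by exact_mod_cast Nat.totient_pos.mpr hm
  have hL : 0 ≤ log (2 * R) := log_nonneg (by linarith)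
  have hq : 0 < R₀ ^ (-(1 / 4) : ℝ) := rpow_pos_of_pos (by linarith) _
  set F := (Icc 1 ⌊R⌋₊).filter (fun δ ↦ δ.primeFactors ⊆ m.primeFactors ∧ δ.Coprime n) with hF
  have hFmem : ∀ δ ∈ F, 1 ≤ δ ∧ (δ : ℝ) ≤ R ∧ δ.primeFactors ⊆ m.primeFactors := by
    intro δ hδ
    rw [hF, mem_filter, mem_Icc] at hδ
    exact ⟨hδ.1.1, (Nat.le_floor_iff hR0).mp hδ.1.2, hδ.2.1⟩
  have hW := sum_rpow_primeFactors_subset_le m (F := F) fun δ hδ ↦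
    ⟨by have := (hFmem δ hδ).1; lia, (hFmem δ hδ).2.2⟩
  have hω : (2 : ℝ) ^ #(m * n).primeFactors ≤ #(m * n).divisors := by
    exact_mod_cast two_pow_card_primeFactors_le hk
  have hωm : (2 : ℝ) ^ #m.primeFactors ≤ #(m * n).divisors :=
    (pow_le_pow_right₀ one_le_two
      (card_le_card (Nat.primeFactors_mono (Nat.dvd_mul_right m n) hk))).trans hω
  rw [sum_totient_mul_eq hm0, mul_thetaFn_zero_sub_thetaFn_one hR, ← hF]
  calc _ = 1 / m.totient * |∑ δ ∈ F, (1 / δ * coprimeTotientSum (m * n) (R / δ) -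
            (if δ ≤ ⌊R₀⌋₊ then hConst * gFunc (m * n) *
              (1 / δ * (log R + lamConst + thetaFunc (m * n) - log δ)) else 0))| := by
        rw [← abs_of_pos (one_div_pos.mpr hφ), ← abs_mul, abs_of_pos (one_div_pos.mpr hφ),
          sum_sub_distrib, mul_sub]
        simp_rw [← mul_ite_zero]
        rw [← mul_sum]
        congr 1
        ring
    _ ≤ 1 / m.totient * ∑ δ ∈ F, C * 2 ^ #(m * n).primeFactors * log (2 * R) *
            R₀ ^ (-(1 / 4) : ℝ) * (δ : ℝ) ^ (-(3 / 4) : ℝ) := by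
        refine mul_le_mul_of_nonneg_left ((abs_sum_le_sum_abs _ _).trans ?_) (by positivity)
        exact sum_le_sum fun δ hδ ↦
          hterm _ _ _ _ hk (hFmem δ hδ).1 hR₀ hR (hFmem δ hδ).2.1
    _ ≤ 1 / m.totient * (C * #(m * n).divisors * log (2 * R) * R₀ ^ (-(1 / 4) : ℝ) *
            (2 * #(m * n).divisors)) := by
        rw [← mul_sum]
        gcongr
        exact hW.trans (by gcongr)
    _ = _ := by
        rw [rpow_neg (by linarith)]
        field_simp
end

section
/- Let π_k(x) denote the number of integers n ≤ x with exactly k distinct prime factors. There exists an absolute constant a such that π_k(x) ≪ x (log₂ x + a)^{k−1} / ((k−1)! log x) uniformly for x ≥ 3 and k ≥ 1. -/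
open Finset Real

/-- `π_k(x) := #{n ≤ x : ω(n) = k}`, the number of `n ≤ x` with exactly `k`
distinct prime factors. -/
noncomputable def pik (k : ℕ) (x : ℝ) : ℕ :=
  ((Finset.Icc 1 ⌊x⌋₊).filter (fun n => n.primeFactors.card = k)).card

/-- Mertens' first theorem, upper bound. -/
theorem sum_log_div_prime_le (N : ℕ) (hN : 1 ≤ N) :
    ∑ p ∈ Nat.primesLE N, log p / p ≤ log N + log 4 := by
  have hN0 : (0 : ℝ) < N := by exact_mod_cast hN
  have hfac : ∑ p ∈ Nat.primesLE N, ((N / p : ℕ) : ℝ) * log p ≤ N * log N := by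
    calc ∑ p ∈ Nat.primesLE N, ((N / p : ℕ) : ℝ) * log p
        ≤ ∑ p ∈ Nat.primesLE N, (N.factorial.factorization p : ℝ) * log p := by
          refine sum_le_sum fun p hp => ?_
          have hpp := Nat.prime_of_mem_primesLE hp
          have : N / p ≤ N.factorial.factorization p := by
            rw [Nat.factorization_factorial hpp (b := Nat.log p N + 2) (by omega)]
            have := single_le_sum (f := fun i => N / p ^ i) (s := Finset.Ico 1 (Nat.log p N + 2))
              (fun _ _ => Nat.zero_le _) (a := 1) (by simp)
            simpa using this
          gcongr
      _ = log N.factorial := by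
          rw [Real.log_nat_eq_sum_factorization, Finsupp.sum]
          symm
          refine sum_subset (fun p hp => ?_) (fun p _ hp => ?_)
          · rw [Nat.support_factorization] at hp
            have hp' := Nat.prime_of_mem_primeFactors hp
            rw [Nat.mem_primesLE]
            exact ⟨(hp'.dvd_factorial).1 (Nat.dvd_of_mem_primeFactors hp), hp'⟩
          · rw [Finsupp.notMem_support_iff] at hp
            simp [hp]
      _ ≤ log ((N : ℝ) ^ N) := by
          refine Real.log_le_log (by positivity) ?_
          exact_mod_cast Nat.factorial_le_pow N
      _ = N * log N := by rw [Real.log_pow]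
  have hθ := Chebyshev.theta_le_log4_mul_x hN0.le
  rw [Chebyshev.theta_eq_sum_primesLE_log] at hθ
  have hterm : N * ∑ p ∈ Nat.primesLE N, log p / p
      ≤ ∑ p ∈ Nat.primesLE N, (((N / p : ℕ) : ℝ) * log p + log p) := by
    rw [mul_sum]
    refine sum_le_sum fun p hp => ?_
    have hpp := Nat.prime_of_mem_primesLE hp
    have h1 : (N : ℝ) / p ≤ (N / p : ℕ) + 1 := by
      rw [← Nat.floor_div_eq_div (K := ℝ)]
      exact (Nat.lt_floor_add_one _).le
    calc (N : ℝ) * (log p / p) = N / p * log p := by ring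
      _ ≤ ((N / p : ℕ) + 1) * log p := by
        gcongr
      _ = _ := by ring
  rw [sum_add_distrib] at hterm
  refine le_of_mul_le_mul_left (a := (N : ℝ)) ?_ hN0
  linarith

/-- Mertens' second theorem, upper bound. -/
theorem sum_inv_prime_le : ∃ c : ℝ, ∀ N : ℕ, 2 ≤ N →
    ∑ p ∈ Nat.primesLE N, (1 : ℝ) / p ≤ log (log N) + c := by
  have key : ∃ K : ℝ, ∀ N : ℕ, 2 ≤ N → ∑ p ∈ Nat.primesLE N, (1 : ℝ) / p
      - (∑ p ∈ Nat.primesLE N, log p / p) / log N + log 4 / log N ≤ log (log N) + K := by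
    refine ⟨∑ p ∈ Nat.primesLE 2, (1 : ℝ) / p
      - (∑ p ∈ Nat.primesLE 2, log p / p) / log 2 + log 4 / log 2 - log (log 2), fun N hN => ?_⟩
    induction N, hN using Nat.le_induction with
    | base => push_cast; linarith
    | succ N hN ih =>
      have hN' : (2 : ℝ) ≤ N := by exact_mod_cast hN
      have hl : 0 < log N := Real.log_pos (by linarith)
      have hl1 : log N ≤ log (N + 1 : ℕ) := Real.log_le_log (by linarith) (by push_cast; linarith)
      have hl' : 0 < log (N + 1 : ℕ) := hl.trans_le hl1
      have hA := sum_log_div_prime_le N (by omega)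
      have hstep : ∑ p ∈ Nat.primesLE (N + 1), (1 : ℝ) / p
            - (∑ p ∈ Nat.primesLE (N + 1), log p / p) / log (N + 1 : ℕ)
          = ∑ p ∈ Nat.primesLE N, (1 : ℝ) / p
            - (∑ p ∈ Nat.primesLE N, log p / p) / log (N + 1 : ℕ) := by
        rw [Nat.primesLE_eq_filter_range, Nat.primesLE_eq_filter_range, range_add_one (n := N + 1),
          filter_insert]
        split_ifs with h
        · rw [sum_insert (by simp), sum_insert (by simp)]
          field_simp
          ring
        · rfl
      have hlog : 1 - log N / log (N + 1 : ℕ) ≤ log (log (N + 1 : ℕ)) - log (log N) := by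
        rw [← Real.log_div hl'.ne' hl.ne']
        have := Real.one_sub_inv_le_log_of_pos (div_pos hl' hl)
        rwa [inv_div] at this
      have hinv : 0 ≤ 1 / log N - 1 / log (N + 1 : ℕ) := by
        rw [sub_nonneg]; gcongr
      have hmul := mul_le_mul_of_nonneg_right hA hinv
      have h1 : (log N + log 4) * (1 / log N - 1 / log (N + 1 : ℕ))
        = 1 - log N / log (N + 1 : ℕ) + log 4 / log N - log 4 / log (N + 1 : ℕ) := by
        field_simp
        ring
      have h2 : (∑ p ∈ Nat.primesLE N, log p / p) * (1 / log N - 1 / log (N + 1 : ℕ))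
        = (∑ p ∈ Nat.primesLE N, log p / p) / log N
          - (∑ p ∈ Nat.primesLE N, log p / p) / log (N + 1 : ℕ) := by ring
      linarith
  obtain ⟨K, hK⟩ := key
  refine ⟨K + 1, fun N hN => ?_⟩
  have hl : 0 < log (N : ℝ) := Real.log_pos (by exact_mod_cast hN)
  have hA := div_le_div_of_nonneg_right (sum_log_div_prime_le N (by omega)) hl.le
  rw [add_div, div_self hl.ne'] at hA
  linarith [hK N hN]

theorem sq_log_le_sqrt {x : ℝ} (hx : 1 ≤ x) : log x ^ 2 ≤ 16 * √x := by
  have h0 : 0 ≤ log x := Real.log_nonneg hx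
  have h1 : log (√(√x)) = log x / 4 := by
    rw [Real.log_sqrt (by positivity), Real.log_sqrt (by positivity)]; ring
  have h2 : log (√(√x)) ≤ √(√x) := Real.log_le_self (by positivity)
  have h3 : √(√x) ^ 2 = √x := Real.sq_sqrt (by positivity)
  nlinarith

theorem card_filter_card_primeFactors_eq_one_le (N : ℕ) :
    ((Finset.Icc 1 N).filter (fun n => n.primeFactors.card = 1)).card
      ≤ N.primeCounting + (N.sqrt + 1) * (Nat.log 2 N + 1) := by
  have hsub : (Finset.Icc 1 N).filter (fun n => n.primeFactors.card = 1) ⊆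
      N.primesLE ∪ (range (N.sqrt + 1) ×ˢ range (Nat.log 2 N + 1)).image (fun q => q.1 ^ q.2) := by
    intro n hn
    rw [Finset.mem_filter, Finset.mem_Icc, ← isPrimePow_iff_card_primeFactors_eq_one,
      isPrimePow_nat_iff] at hn
    obtain ⟨⟨-, hnN⟩, p, a, hp, ha, rfl⟩ := hn
    rw [mem_union, Nat.mem_primesLE, mem_image]
    rcases Nat.lt_or_ge 1 a with h | h
    · refine Or.inr ⟨(p, a), ?_, rfl⟩
      rw [mem_product, mem_range, mem_range, Nat.lt_succ_iff, Nat.lt_succ_iff]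
      refine ⟨Nat.le_sqrt'.2 ((Nat.pow_le_pow_right hp.pos h).trans hnN), ?_⟩
      exact Nat.le_log_of_pow_le (by norm_num) ((Nat.pow_le_pow_left hp.two_le a).trans hnN)
    · obtain rfl : a = 1 := by omega
      exact Or.inl ⟨hnN, by simpa using hp⟩
  refine (card_le_card hsub).trans ((card_union_le _ _).trans ?_)
  rw [Nat.primesLE_card_eq_primeCounting]
  gcongr
  exact card_image_le.trans (by simp)

/-- Chebyshev's bound for the number of prime powers up to `x`. -/
theorem pik_one_le {x : ℝ} (hx : 2 ≤ x) :
    (pik 1 x : ℝ) ≤ (2 * log 4 + 160) * x / log x := by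
  have hlog2 : 1 / 2 ≤ log 2 := by linarith [Real.log_two_gt_d9]
  have hlog : log 2 ≤ log x := Real.log_le_log (by norm_num) hx
  have hl : 0 < log x := by linarith
  have hx0 : ⌊x⌋₊ ≠ 0 := (Nat.floor_pos.2 (by linarith)).ne'
  have hfl : (⌊x⌋₊ : ℝ) ≤ x := Nat.floor_le (by linarith)
  have hcard : (pik 1 x : ℝ) ≤
      (⌊x⌋₊).primeCounting + (((⌊x⌋₊).sqrt : ℝ) + 1) * ((Nat.log 2 ⌊x⌋₊ : ℝ) + 1) := by
    exact_mod_cast card_filter_card_primeFactors_eq_one_le ⌊x⌋₊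
  have hπ := Chebyshev.pi_le_log4_mul_div (x := x) (by linarith)
  rw [Real.log_sqrt (by linarith)] at hπ
  have hs1 : 1 ≤ √x := Real.one_le_sqrt.2 (by linarith)
  have hss : √x * √x = x := Real.mul_self_sqrt (by linarith)
  have hs : ((⌊x⌋₊).sqrt : ℝ) + 1 ≤ 2 * √x := by
    have : ((⌊x⌋₊).sqrt : ℝ) ≤ √x := Real.nat_sqrt_le_real_sqrt.trans (Real.sqrt_le_sqrt hfl)
    linarith
  have hb : (Nat.log 2 ⌊x⌋₊ : ℝ) + 1 ≤ 4 * log x := by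
    have h1 : ((2 : ℝ) ^ (Nat.log 2 ⌊x⌋₊)) ≤ x :=
      le_trans (by exact_mod_cast Nat.pow_log_le_self 2 hx0) hfl
    have h2 := Real.log_le_log (by positivity) h1
    rw [Real.log_pow] at h2
    have h3 : (0 : ℝ) ≤ Nat.log 2 ⌊x⌋₊ := by positivity
    nlinarith
  have hprod : (((⌊x⌋₊).sqrt : ℝ) + 1) * ((Nat.log 2 ⌊x⌋₊ : ℝ) + 1) ≤ 2 * √x * (4 * log x) := by
    gcongr
  have hsq := sq_log_le_sqrt (x := x) (by linarith)
  have hmain : √x * log x * log x ≤ 16 * x := by nlinarith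
  rw [le_div_iff₀ hl]
  have h4 : (log 4 * x / (log x / 2)) * log x = 2 * log 4 * x := by field_simp
  have h5 : (pik 1 x : ℝ) ≤ log 4 * x / (log x / 2) + √x + 2 * √x * (4 * log x) := by linarith
  have h6 := mul_le_mul_of_nonneg_right h5 hl.le
  have h7 : √x * log x ≤ 2 * (√x * log x * log x) := by
    have : 0 ≤ √x * log x := by positivity
    nlinarith
  nlinarith

/-- The pairs `(p, a)` with `p` prime, `a ≥ 1` and `p ^ (a + 1) ≤ x`. -/
noncomputable def primePowerPairs (x : ℝ) : Finset (ℕ × ℕ) :=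
  ((⌊x⌋₊).primesLE ×ˢ Finset.Icc 1 ⌊x⌋₊).filter (fun q => (q.1 : ℝ) ^ (q.2 + 1) ≤ x)

theorem mem_primePowerPairs {x : ℝ} {q : ℕ × ℕ} :
    q ∈ primePowerPairs x ↔ q.1.Prime ∧ 1 ≤ q.2 ∧ (q.1 : ℝ) ^ (q.2 + 1) ≤ x := by
  rw [primePowerPairs, Finset.mem_filter, mem_product, Nat.mem_primesLE, Finset.mem_Icc]
  refine ⟨fun h => ⟨h.1.1.2, h.1.2.1, h.2⟩, fun ⟨hp, ha, h⟩ => ?_⟩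
  have h' : q.1 ^ (q.2 + 1) ≤ ⌊x⌋₊ := Nat.le_floor (by exact_mod_cast h)
  have h1 : q.1 ≤ q.1 ^ (q.2 + 1) := Nat.le_self_pow (by omega) _
  have h2 : q.2 + 1 < q.1 ^ (q.2 + 1) := Nat.lt_pow_self hp.one_lt
  exact ⟨⟨⟨by omega, hp⟩, ha, by omega⟩, h⟩

theorem card_primeFactors_le_card_filter_add_one {n : ℕ} (hn : n ≠ 0) :
    n.primeFactors.card ≤
      (n.primeFactors.filter (fun p => p ^ (n.factorization p + 1) ≤ n)).card + 1 := by
  rcases n.primeFactors.eq_empty_or_nonempty with h | h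
  · simp [h]
  set P := n.primeFactors.max' h with hP
  have hPm : P ∈ n.primeFactors := max'_mem _ _
  rw [← card_erase_add_one hPm, add_le_add_iff_right]
  refine card_le_card fun p hp => ?_
  rw [mem_erase] at hp
  rw [Finset.mem_filter]
  refine ⟨hp.2, ?_⟩
  have hpp := Nat.prime_of_mem_primeFactors hp.2
  have hPp := Nat.prime_of_mem_primeFactors hPm
  have hle : p ≤ P := le_max' _ _ hp.2
  have hcop : Nat.Coprime (p ^ n.factorization p) P :=
    Nat.Coprime.pow_left _ ((Nat.coprime_primes hpp hPp).2 hp.1)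
  have hdvd : p ^ n.factorization p * P ∣ n :=
    hcop.mul_dvd_of_dvd_of_dvd (Nat.ordProj_dvd n p) (Nat.dvd_of_mem_primeFactors hPm)
  calc p ^ (n.factorization p + 1) = p ^ n.factorization p * p := pow_succ _ _
    _ ≤ p ^ n.factorization p * P := by gcongr
    _ ≤ n := Nat.le_of_dvd (Nat.pos_of_ne_zero hn) hdvd

/-- The Hardy–Ramanujan recursive inequality: all but the largest prime factor `p` of `n ≤ x`
satisfy `p ^ (a + 1) ≤ x`, where `p ^ a` exactly divides `n`. -/
theorem mul_pik_succ_le (k : ℕ) (x : ℝ) :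
    k * pik (k + 1) x ≤ ∑ q ∈ primePowerPairs x, pik k (x / (q.1 : ℝ) ^ q.2) := by
  classical
  set S := (Finset.Icc 1 ⌊x⌋₊).filter (fun n => n.primeFactors.card = k + 1) with hS
  have hlow : k * pik (k + 1) x ≤ (S.sigma fun n =>
      n.primeFactors.filter (fun p => p ^ (n.factorization p + 1) ≤ n)).card := by
    rw [card_sigma, mul_comm, pik, ← hS, ← smul_eq_mul, ← sum_const]
    refine sum_le_sum fun n hn => ?_
    rw [hS, Finset.mem_filter, Finset.mem_Icc] at hn
    have := card_primeFactors_le_card_filter_add_one (n := n) (by omega)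
    omega
  refine hlow.trans ?_
  simp only [pik]
  rw [← card_sigma]
  refine card_le_card_of_injOn
    (fun t => ⟨(t.2, t.1.factorization t.2), t.1 / t.2 ^ t.1.factorization t.2⟩) ?_ ?_
  · rintro ⟨n, p⟩ ht
    simp only [hS, coe_sigma, Set.mem_sigma_iff, Finset.mem_coe, Finset.mem_filter,
      Finset.mem_Icc] at ht ⊢
    obtain ⟨⟨⟨hn1, hnx⟩, hk⟩, hpn, hpow⟩ := ht
    have hpp := Nat.prime_of_mem_primeFactors hpn
    have hnx' : (n : ℝ) ≤ x := (Nat.le_floor_iff' (by omega)).1 hnx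
    have hfac : 1 ≤ n.factorization p := hpp.factorization_pos_of_dvd (by omega)
      (Nat.dvd_of_mem_primeFactors hpn)
    have hord : n / p ^ n.factorization p ≠ 0 := (Nat.ordCompl_pos p (by omega)).ne'
    refine ⟨mem_primePowerPairs.2 ⟨hpp, hfac, ?_⟩, ⟨Nat.one_le_iff_ne_zero.2 hord, ?_⟩, ?_⟩
    · exact le_trans (by exact_mod_cast hpow) hnx'
    · rw [Nat.le_floor_iff' hord]
      have hp0 : (0 : ℝ) < (p : ℝ) ^ n.factorization p := by
        have := hpp.pos
        positivity
      rw [le_div_iff₀ hp0]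
      refine le_trans ?_ hnx'
      exact_mod_cast Nat.div_mul_le_self n _
    · rw [← Nat.support_factorization, Nat.factorization_ordCompl, Finsupp.support_erase,
        Nat.support_factorization, card_erase_of_mem hpn, hk, Nat.add_sub_cancel]
  · rintro ⟨n, p⟩ - ⟨m, q⟩ - h
    simp only [Sigma.mk.injEq, Prod.mk.injEq, heq_eq_eq] at h
    obtain ⟨⟨rfl, h1⟩, h2⟩ := h
    have : n = m := by
      rw [← Nat.ordProj_mul_ordCompl_eq_self n p, h2, h1, Nat.ordProj_mul_ordCompl_eq_self]
    subst this
    rfl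

theorem sum_range_add_one_div_two_pow (n : ℕ) :
    ∑ a ∈ range n, ((a : ℝ) + 1) / 2 ^ a = 4 - (2 * n + 4) / 2 ^ n := by
  induction n with
  | zero => norm_num
  | succ n ih =>
    rw [sum_range_succ, ih]
    push_cast
    field_simp
    ring

theorem le_of_mem_primePowerPairs {x : ℝ} {q : ℕ × ℕ} (hq : q ∈ primePowerPairs x) :
    (q.1 : ℝ) ≤ x / (q.1 : ℝ) ^ q.2 := by
  obtain ⟨hp, -, hx⟩ := mem_primePowerPairs.1 hq
  have : (0 : ℝ) < q.1 := by exact_mod_cast hp.pos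
  rwa [le_div_iff₀ (by positivity), ← pow_succ']

theorem inv_primePow_mul_log_le {x : ℝ} (hx : 2 ≤ x) {q : ℕ × ℕ} (hq : q ∈ primePowerPairs x) :
    log x / ((q.1 : ℝ) ^ q.2 * log (x / (q.1 : ℝ) ^ q.2)) ≤
      (if q.2 = 1 then 1 / (q.1 : ℝ) + 2 / log x * (log q.1 / q.1) else 0)
        + 4 * (((q.2 : ℝ) + 1) / 2 ^ q.2) * ((q.1 : ℝ) ^ 2)⁻¹ := by
  have hle := le_of_mem_primePowerPairs hq
  obtain ⟨hp, ha, hpow⟩ := mem_primePowerPairs.1 hq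
  obtain ⟨p, a⟩ := q
  simp only at hp ha hpow hle ⊢
  have hp2 : (2 : ℝ) ≤ p := by exact_mod_cast hp.two_le
  have hp0 : (0 : ℝ) < p := by linarith
  have hlp : 0 < log p := Real.log_pos (by linarith)
  have hL : 0 < log x := Real.log_pos (by linarith)
  have hlog : log (x / (p : ℝ) ^ a) = log x - a * log p := by
    rw [Real.log_div (by linarith) (by positivity), Real.log_pow]
  have hlog' : ((a : ℝ) + 1) * log p ≤ log x := by
    have := Real.log_le_log (by positivity) hpow
    rw [Real.log_pow] at this
    exact_mod_cast this
  have hpos : 0 < log x - a * log p := by nlinarith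
  rw [hlog]
  split_ifs with h
  · subst h
    norm_num at hpos hlog' ⊢
    have h1 : log x / ((p : ℝ) * (log x - log p)) ≤ (p : ℝ)⁻¹ + 2 / log x * (log p / p) := by
      rw [div_le_iff₀ (by positivity)]
      have : ((p : ℝ)⁻¹ + 2 / log x * (log p / p)) * (p * (log x - log p))
          = log x + log p * (log x - 2 * log p) / log x := by
        field_simp
        ring
      rw [this]
      have : 0 ≤ log p * (log x - 2 * log p) / log x :=
        div_nonneg (mul_nonneg hlp.le (by linarith)) hL.le
      linarith
    refine h1.trans ?_
    have : (0 : ℝ) ≤ 4 * ((p : ℝ) ^ 2)⁻¹ := by positivity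
    linarith
  · obtain ⟨b, rfl⟩ : ∃ b, a = b + 2 := ⟨a - 2, by omega⟩
    push_cast at hpos hlog' ⊢
    have h1 : log x ≤ ((b : ℝ) + 2 + 1) * (log x - (b + 2) * log p) := by nlinarith
    have h2 : (2 : ℝ) ^ b ≤ (p : ℝ) ^ b := by gcongr
    rw [zero_add, div_le_iff₀ (by positivity)]
    calc log x ≤ ((b : ℝ) + 2 + 1) * (log x - (b + 2) * log p) := h1
      _ ≤ ((b : ℝ) + 2 + 1) * (log x - (b + 2) * log p) * ((p : ℝ) ^ b / 2 ^ b) :=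
        le_mul_of_one_le_right (by positivity) ((one_le_div (by positivity)).2 h2)
      _ = _ := by
        rw [pow_add, pow_add]
        field_simp
        ring

theorem sum_primePowerPairs_le : ∃ c : ℝ, ∀ x : ℝ, 2 ≤ x →
    ∑ q ∈ primePowerPairs x, log x / ((q.1 : ℝ) ^ q.2 * log (x / (q.1 : ℝ) ^ q.2))
      ≤ log (log x) + c := by
  obtain ⟨c, hc⟩ := sum_inv_prime_le
  refine ⟨c + 38, fun x hx => ?_⟩
  have hN : 2 ≤ ⌊x⌋₊ := Nat.le_floor (by exact_mod_cast hx)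
  set N := ⌊x⌋₊ with hNdef
  have hNx : (N : ℝ) ≤ x := Nat.floor_le (by linarith)
  have hN2 : (2 : ℝ) ≤ N := by exact_mod_cast hN
  have hlog2 : 1 / 2 ≤ log 2 := by linarith [Real.log_two_gt_d9]
  have hL2 : log 2 ≤ log x := Real.log_le_log (by norm_num) hx
  have hL : 0 < log x := by linarith
  have hLN : log N ≤ log x := Real.log_le_log (by linarith) hNx
  have hLN0 : 0 < log (N : ℝ) := Real.log_pos (by linarith)
  have hnn : ∀ q : ℕ × ℕ,
      0 ≤ (if q.2 = 1 then 1 / (q.1 : ℝ) + 2 / log x * (log q.1 / q.1) else 0)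
        + 4 * (((q.2 : ℝ) + 1) / 2 ^ q.2) * ((q.1 : ℝ) ^ 2)⁻¹ := by
    intro q
    have := log_natCast_nonneg q.1
    split_ifs <;> positivity
  have hgeom : ∑ a ∈ Finset.Icc 1 N, ((a : ℝ) + 1) / 2 ^ a ≤ 4 := by
    calc ∑ a ∈ Finset.Icc 1 N, ((a : ℝ) + 1) / 2 ^ a
        ≤ ∑ a ∈ range (N + 1), ((a : ℝ) + 1) / 2 ^ a := by
          refine sum_le_sum_of_subset_of_nonneg (fun a ha => ?_) (fun a _ _ => by positivity)
          rw [Finset.mem_Icc] at ha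
          exact mem_range.2 (by omega)
      _ ≤ 4 := by
        rw [sum_range_add_one_div_two_pow, sub_le_self_iff]
        positivity
  have hsq : ∑ p ∈ N.primesLE, ((p : ℝ) ^ 2)⁻¹ ≤ 2 := by
    calc ∑ p ∈ N.primesLE, ((p : ℝ) ^ 2)⁻¹ ≤ ∑ p ∈ Finset.Ioo 0 (N + 1), ((p : ℝ) ^ 2)⁻¹ := by
          refine sum_le_sum_of_subset_of_nonneg (fun p hp => ?_) (fun a _ _ => by positivity)
          rw [Nat.mem_primesLE] at hp
          exact Finset.mem_Ioo.2 ⟨hp.2.pos, by omega⟩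
      _ ≤ 2 := by
        have := sum_Ioo_inv_sq_le (α := ℝ) 0 (N + 1)
        norm_num at this ⊢
        exact this
  calc _ ≤ ∑ q ∈ primePowerPairs x,
        ((if q.2 = 1 then 1 / (q.1 : ℝ) + 2 / log x * (log q.1 / q.1) else 0)
          + 4 * (((q.2 : ℝ) + 1) / 2 ^ q.2) * ((q.1 : ℝ) ^ 2)⁻¹) :=
        sum_le_sum fun q hq => inv_primePow_mul_log_le hx hq
    _ ≤ ∑ q ∈ N.primesLE ×ˢ Finset.Icc 1 N,
        ((if q.2 = 1 then 1 / (q.1 : ℝ) + 2 / log x * (log q.1 / q.1) else 0)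
          + 4 * (((q.2 : ℝ) + 1) / 2 ^ q.2) * ((q.1 : ℝ) ^ 2)⁻¹) :=
        sum_le_sum_of_subset_of_nonneg (filter_subset _ _) fun q _ _ => hnn q
    _ = ∑ p ∈ N.primesLE, ((1 / (p : ℝ) + 2 / log x * (log p / p))
          + 4 * (∑ a ∈ Finset.Icc 1 N, ((a : ℝ) + 1) / 2 ^ a) * ((p : ℝ) ^ 2)⁻¹) := by
        rw [sum_product]
        refine sum_congr rfl fun p _ => ?_
        rw [sum_add_distrib, sum_ite_eq' (Finset.Icc 1 N) 1, if_pos (by simp; omega), mul_sum,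
          sum_mul]
    _ ≤ ∑ p ∈ N.primesLE, ((1 / (p : ℝ) + 2 / log x * (log p / p))
          + 16 * ((p : ℝ) ^ 2)⁻¹) := by
        gcongr
        linarith
    _ = ∑ p ∈ N.primesLE, 1 / (p : ℝ) + 2 / log x * ∑ p ∈ N.primesLE, log p / (p : ℝ)
          + 16 * ∑ p ∈ N.primesLE, ((p : ℝ) ^ 2)⁻¹ := by
        rw [sum_add_distrib, sum_add_distrib, mul_sum, mul_sum]
    _ ≤ (log (log N) + c) + 2 / log x * (3 * log x) + 16 * 2 := by
        have h4 : log 4 = 2 * log 2 := by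
          rw [show (4 : ℝ) = 2 ^ 2 by norm_num, Real.log_pow]; norm_num
        have hA : ∑ p ∈ N.primesLE, log p / (p : ℝ) ≤ 3 * log x := by
          linarith [sum_log_div_prime_le N (by omega)]
        gcongr
        exact hc N hN
    _ ≤ log (log x) + (c + 38) := by
        have h1 : 2 / log x * (3 * log x) = 6 := by field_simp; norm_num
        have h2 : log (log N) ≤ log (log x) := Real.log_le_log hLN0 hLN
        linarith

theorem pik_succ_le : ∃ a C : ℝ, 0 < a ∧ 0 < C ∧ ∀ (j : ℕ) (x : ℝ), 2 ≤ x →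
    (pik (j + 1) x : ℝ) ≤ C * x * (log (log x) + a) ^ j / (j.factorial * log x) := by
  obtain ⟨c, hc⟩ := sum_primePowerPairs_le
  have h4 : 0 < log 4 := Real.log_pos (by norm_num)
  have hlog2 : 1 / 2 ≤ log 2 := by linarith [Real.log_two_gt_d9]
  have hlog2_le : ∀ x : ℝ, 2 ≤ x → log 2 ≤ log x := fun x hx => Real.log_le_log (by norm_num) hx
  set a := max c (1 - log (log 2)) with ha
  have hapos : 0 < a := by
    refine lt_of_lt_of_le ?_ (le_max_right _ _)
    have : log (log 2) ≤ 0 := Real.log_nonpos (by linarith) (by linarith [Real.log_two_lt_d9])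
    linarith
  refine ⟨a, 2 * log 4 + 160, hapos, by positivity, fun j => ?_⟩
  set C := 2 * log 4 + 160 with hC
  have hCpos : 0 < C := by positivity
  have hnonneg : ∀ x : ℝ, 2 ≤ x → 0 ≤ log (log x) + a := by
    intro x hx
    have h1 : log (log 2) ≤ log (log x) := Real.log_le_log (by linarith) (hlog2_le x hx)
    linarith [le_max_right c (1 - log (log 2))]
  induction j with
  | zero =>
    intro x hx
    simpa using pik_one_le hx
  | succ j ih =>
    intro x hx
    have hL : 0 < log x := by linarith [hlog2_le x hx]
    have hA := hnonneg x hx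
    have hrec : ((j + 1 : ℕ) : ℝ) * pik (j + 1 + 1) x
        ≤ ∑ q ∈ primePowerPairs x, (pik (j + 1) (x / (q.1 : ℝ) ^ q.2) : ℝ) := by
      exact_mod_cast mul_pik_succ_le (j + 1) x
    have hterm : ∀ q ∈ primePowerPairs x, (pik (j + 1) (x / (q.1 : ℝ) ^ q.2) : ℝ) ≤
        C * x * (log (log x) + a) ^ j / (j.factorial * log x) *
          (log x / ((q.1 : ℝ) ^ q.2 * log (x / (q.1 : ℝ) ^ q.2))) := by
      intro q hq
      have hp := (mem_primePowerPairs.1 hq).1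
      have hp2 : (2 : ℝ) ≤ q.1 := by exact_mod_cast hp.two_le
      have hy := hp2.trans (le_of_mem_primePowerPairs hq)
      have hly : 0 < log (x / (q.1 : ℝ) ^ q.2) := by linarith [hlog2_le _ hy]
      have hpow1 : (1 : ℝ) ≤ (q.1 : ℝ) ^ q.2 := one_le_pow₀ (by linarith)
      have hyx : x / (q.1 : ℝ) ^ q.2 ≤ x := div_le_self (by linarith) hpow1
      have hll : log (log (x / (q.1 : ℝ) ^ q.2)) ≤ log (log x) :=
        Real.log_le_log hly (Real.log_le_log (by linarith) hyx)
      have hA' := hnonneg _ hy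
      calc (pik (j + 1) (x / (q.1 : ℝ) ^ q.2) : ℝ)
          ≤ C * (x / (q.1 : ℝ) ^ q.2) * (log (log (x / (q.1 : ℝ) ^ q.2)) + a) ^ j
            / (j.factorial * log (x / (q.1 : ℝ) ^ q.2)) := ih _ hy
        _ ≤ C * (x / (q.1 : ℝ) ^ q.2) * (log (log x) + a) ^ j
            / (j.factorial * log (x / (q.1 : ℝ) ^ q.2)) := by gcongr
        _ = _ := by field_simp
    have hsum := sum_le_sum hterm
    rw [← mul_sum] at hsum
    have hS : ∑ q ∈ primePowerPairs x, log x / ((q.1 : ℝ) ^ q.2 * log (x / (q.1 : ℝ) ^ q.2))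
        ≤ log (log x) + a := (hc x hx).trans (by gcongr; exact le_max_left _ _)
    have hfin : ((j + 1 : ℕ) : ℝ) * pik (j + 1 + 1) x ≤
        C * x * (log (log x) + a) ^ j / (j.factorial * log x) * (log (log x) + a) :=
      (hrec.trans hsum).trans (by gcongr)
    have hj : (0 : ℝ) < (j + 1 : ℕ) := by positivity
    rw [← le_div_iff₀' hj] at hfin
    refine hfin.trans (le_of_eq ?_)
    rw [Nat.factorial_succ, pow_succ]
    push_cast
    field_simp

/-- Hardy–Ramanujan upper bound: there are absolute constants `a`, `C` with
`π_k(x) ≤ C x (log log x + a)^{k−1} / ((k−1)! log x)` for `x ≥ 3`, `k ≥ 1`. -/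
theorem stmt_5 :
    ∃ a C : ℝ, 0 < a ∧ 0 < C ∧ ∀ (x : ℝ) (k : ℕ), 3 ≤ x → 1 ≤ k →
      (pik k x : ℝ) ≤
        C * x * (Real.log (Real.log x) + a) ^ (k - 1)
          / ((Nat.factorial (k - 1)) * Real.log x) := by
  obtain ⟨a, C, ha, hC, h⟩ := pik_succ_le
  refine ⟨a, C, ha, hC, fun x k hx hk => ?_⟩
  have := h (k - 1) x (by linarith)
  rwa [Nat.sub_add_cancel hk] at this
end

section
/- Uniformly for x ≥ 3, 1 ≤ k ≪ log₂ x, 2 ≤ y ≤ x, and u := (log x)/(log y), the count π_k(x,y) of integers n ≤ x with exactly k distinct prime factors and largest prime factor at most y satisfies π_k(x,y) ≪ π_k(x)·e^{−u/2}. -/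
open Finset Real

/-- `π_k(x,y) := #{n ≤ x : ω(n) = k, P⁺(n) ≤ y}`. -/
noncomputable def piky (k : ℕ) (x y : ℝ) : ℕ :=
  ((Finset.Icc 1 ⌊x⌋₊).filter
    (fun n => n.primeFactors.card = k ∧ ∀ p ∈ n.primeFactors, ((p : ℕ) : ℝ) ≤ y)).card

/-- The `j`-th elementary symmetric function of the values of `g` on `s`. -/
noncomputable def elemSymm (s : Finset ℕ) (g : ℕ → ℝ) (j : ℕ) : ℝ :=
  ∑ T ∈ s.powersetCard j, ∏ p ∈ T, g p

lemma elemSymm_zero (s : Finset ℕ) (g : ℕ → ℝ) : elemSymm s g 0 = 1 := by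
  simp [elemSymm]

lemma elemSymm_empty_succ (g : ℕ → ℝ) (j : ℕ) : elemSymm ∅ g (j + 1) = 0 := by
  rw [elemSymm, Finset.powersetCard_eq_empty.2 (by simp), Finset.sum_empty]

lemma elemSymm_nonneg {s : Finset ℕ} {g : ℕ → ℝ} (hg : ∀ p, 0 ≤ g p) (j : ℕ) :
    0 ≤ elemSymm s g j :=
  Finset.sum_nonneg fun _ _ => Finset.prod_nonneg fun p _ => hg p

lemma elemSymm_insert {s : Finset ℕ} {a : ℕ} (ha : a ∉ s) (g : ℕ → ℝ) (j : ℕ) :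
    elemSymm (insert a s) g (j + 1) = elemSymm s g (j + 1) + g a * elemSymm s g j := by
  have hmem : ∀ T ∈ s.powersetCard j, a ∉ T := fun T hT h =>
    ha ((Finset.mem_powersetCard.1 hT).1 h)
  unfold elemSymm
  rw [Finset.powersetCard_succ_insert ha, Finset.sum_union, Finset.sum_image, Finset.mul_sum]
  · congr 1
    exact Finset.sum_congr rfl fun T hT => Finset.prod_insert (hmem T hT)
  · intro T hT U hU h
    rw [← Finset.erase_insert (hmem T hT), ← Finset.erase_insert (hmem U hU), h]
  · rw [Finset.disjoint_left]
    intro T hT hT'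
    obtain ⟨U, -, rfl⟩ := Finset.mem_image.1 hT'
    exact ha ((Finset.mem_powersetCard.1 hT).1 (Finset.mem_insert_self a U))

lemma elemSymm_one (s : Finset ℕ) (g : ℕ → ℝ) : elemSymm s g 1 = ∑ p ∈ s, g p := by
  simp [elemSymm, Finset.powersetCard_one]

lemma succ_mul_elemSymm_succ_le {g : ℕ → ℝ} (hg : ∀ p, 0 ≤ g p) (s : Finset ℕ) (j : ℕ) :
    (j + 1) * elemSymm s g (j + 1) ≤ (∑ p ∈ s, g p) * elemSymm s g j := by
  induction s using Finset.induction_on generalizing j with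
  | empty => simp [elemSymm_empty_succ]
  | insert a s ha ih =>
    rw [Finset.sum_insert ha, elemSymm_insert ha]
    cases j with
    | zero =>
      have := ih 0
      simp only [elemSymm_zero] at this ⊢
      push_cast at this ⊢
      linarith
    | succ j =>
      rw [elemSymm_insert ha]
      have h1 := ih (j + 1)
      have h2 := mul_le_mul_of_nonneg_left (ih j) (hg a)
      have h3 := mul_nonneg (mul_nonneg (hg a) (hg a)) (elemSymm_nonneg (s := s) hg j)
      push_cast at h1 h2 ⊢
      nlinarith

lemma newton_le_elemSymm {g : ℕ → ℝ} (hg : ∀ p, 0 ≤ g p) (s : Finset ℕ) (j : ℕ) :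
    (∑ p ∈ s, g p) * elemSymm s g (j + 1) - (∑ p ∈ s, g p ^ 2) * elemSymm s g j ≤
      (j + 2) * elemSymm s g (j + 2) := by
  induction s using Finset.induction_on generalizing j with
  | empty => simp [elemSymm_empty_succ]
  | insert a s ha ih =>
    rw [Finset.sum_insert ha, Finset.sum_insert ha, elemSymm_insert ha, elemSymm_insert ha]
    cases j with
    | zero =>
      have := ih 0
      simp only [elemSymm_zero, zero_add, elemSymm_one] at this ⊢
      push_cast at this ⊢
      nlinarith
    | succ j =>
      rw [elemSymm_insert ha]
      have h1 := ih (j + 1)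
      have h2 := mul_le_mul_of_nonneg_left (ih j) (hg a)
      have h3 := mul_nonneg (pow_nonneg (hg a) 3) (elemSymm_nonneg (s := s) hg j)
      push_cast at h1 h2 ⊢
      nlinarith

lemma elemSymm_le {g : ℕ → ℝ} (hg : ∀ p, 0 ≤ g p) (s : Finset ℕ) (j : ℕ) :
    elemSymm s g j ≤ (∑ p ∈ s, g p) ^ j / j.factorial := by
  induction j with
  | zero => simp [elemSymm_zero]
  | succ j ih =>
    have h := succ_mul_elemSymm_succ_le hg s j
    have hS : 0 ≤ ∑ p ∈ s, g p := Finset.sum_nonneg fun p _ => hg p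
    rw [Nat.factorial_succ, Nat.cast_mul, pow_succ, le_div_iff₀ (by positivity)]
    rw [le_div_iff₀ (by positivity)] at ih
    push_cast
    calc elemSymm s g (j + 1) * ((j + 1) * j.factorial)
        = ((j + 1) * elemSymm s g (j + 1)) * j.factorial := by ring
      _ ≤ ((∑ p ∈ s, g p) * elemSymm s g j) * j.factorial := by gcongr
      _ = (∑ p ∈ s, g p) * (elemSymm s g j * j.factorial) := by ring
      _ ≤ (∑ p ∈ s, g p) * (∑ p ∈ s, g p) ^ j := by gcongr
      _ = _ := by ring

lemma le_elemSymm {g : ℕ → ℝ} (hg : ∀ p, 0 ≤ g p) (s : Finset ℕ) (hS : 0 < ∑ p ∈ s, g p)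
    (j : ℕ) :
    (∑ p ∈ s, g p) ^ j / j.factorial *
      (1 - j * (j - 1) / 2 * ((∑ p ∈ s, g p ^ 2) / (∑ p ∈ s, g p) ^ 2)) ≤ elemSymm s g j := by
  set S := ∑ p ∈ s, g p with hSdef
  set V := ∑ p ∈ s, g p ^ 2
  have hV : 0 ≤ V := Finset.sum_nonneg fun p _ => by positivity
  induction j using Nat.strong_induction_on with
  | _ j ih =>
  match j, ih with
  | 0, _ => simp [elemSymm_zero]
  | 1, _ => simp [elemSymm_one, hSdef]
  | j + 2, ih =>
    have h1 := ih (j + 1) (by omega)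
    have h2 := elemSymm_le hg s j
    have h3 := newton_le_elemSymm hg s j
    rw [← hSdef] at h2 h3
    have h4 : S * (S ^ (j + 1) / (j + 1).factorial *
        (1 - (j + 1 : ℕ) * ((j + 1 : ℕ) - 1) / 2 * (V / S ^ 2))) - V * (S ^ j / j.factorial) ≤
        (j + 2) * elemSymm s g (j + 2) := by
      refine le_trans ?_ h3
      gcongr
    have hj : (0 : ℝ) < j + 2 := by positivity
    rw [← mul_le_mul_iff_right₀ hj]
    refine le_trans (le_of_eq ?_) h4
    have hf : (j.factorial : ℝ) ≠ 0 := by positivity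
    simp only [Nat.factorial_succ]
    push_cast
    field_simp
    ring

lemma sum_log_div_primesLE_le {N : ℕ} (hN : 1 ≤ N) :
    ∑ p ∈ N.primesLE, Real.log p / p ≤ Real.log N + Real.log 4 := by
  have hN0 : (0 : ℝ) < N := by exact_mod_cast hN
  have h1 : ∑ p ∈ N.primesLE, ((N : ℝ) / p - 1) * Real.log p ≤ N * Real.log N := by
    calc ∑ p ∈ N.primesLE, ((N : ℝ) / p - 1) * Real.log p
        ≤ ∑ p ∈ N.primesLE, (N.factorial.factorization p : ℝ) * Real.log p := by
          refine Finset.sum_le_sum fun p hp => ?_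
          have hpp := Nat.prime_of_mem_primesLE hp
          refine mul_le_mul_of_nonneg_right ?_ (Real.log_natCast_nonneg p)
          have h : N / p ≤ N.factorial.factorization p := by
            rw [Nat.factorization_factorial hpp (Nat.lt_succ_self _)]
            refine le_trans (by simp) (Finset.single_le_sum (f := fun i => N / p ^ i)
              (fun _ _ => Nat.zero_le _) (?_ : 1 ∈ _))
            have := Nat.log_pos hpp.one_lt (Nat.le_of_mem_primesLE hp)
            rw [Finset.mem_Ico]; exact ⟨le_rfl, Nat.succ_lt_succ this⟩
          have h' : (N : ℝ) / p - 1 ≤ (N / p : ℕ) := by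
            rw [← Nat.floor_div_eq_div (K := ℝ)]
            exact (Nat.sub_one_lt_floor _).le
          exact h'.trans (by exact_mod_cast h)
      _ = Real.log N.factorial := by
          conv_rhs => rw [← Nat.prod_factorization_pow_eq_self (Nat.factorial_ne_zero N)]
          rw [Finsupp.prod, Nat.cast_prod, Real.log_prod]
          · have : N.factorial.factorization.support = N.primesLE := by
              ext p
              simp only [Nat.support_factorization, Nat.mem_primeFactors, Nat.mem_primesLE]
              constructor
              · rintro ⟨hp, hd, -⟩
                exact ⟨hp.dvd_factorial.1 hd, hp⟩
              · rintro ⟨hd, hp⟩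
                exact ⟨hp, hp.dvd_factorial.2 hd, Nat.factorial_ne_zero N⟩
            rw [this]
            refine Finset.sum_congr rfl fun p _ => ?_
            push_cast
            rw [Real.log_pow]
          · intro p hp
            have := (Nat.prime_of_mem_primeFactors hp).pos
            positivity
      _ ≤ Real.log ((N : ℝ) ^ N) := by
          apply Real.log_le_log (by positivity)
          exact_mod_cast Nat.factorial_le_pow N
      _ = N * Real.log N := by rw [Real.log_pow]
  have h2 : ∑ p ∈ N.primesLE, ((N : ℝ) / p - 1) * Real.log p =
      N * ∑ p ∈ N.primesLE, Real.log p / p - ∑ p ∈ N.primesLE, Real.log p := by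
    rw [Finset.mul_sum, ← Finset.sum_sub_distrib]
    refine Finset.sum_congr rfl fun p _ => by ring
  have h3 := Chebyshev.theta_le_log4_mul_x (x := N) hN0.le
  rw [Chebyshev.theta_eq_sum_primesLE_log] at h3
  have h4 : N * ∑ p ∈ N.primesLE, Real.log p / p ≤ N * (Real.log N + Real.log 4) := by
    linarith
  exact le_of_mul_le_mul_left h4 hN0

/-- The sum of the reciprocals of the primes up to `N`. -/
noncomputable def primeRecip (N : ℕ) : ℝ := ∑ p ∈ N.primesLE, (p : ℝ)⁻¹

lemma primeRecip_nonneg (N : ℕ) : 0 ≤ primeRecip N :=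
  Finset.sum_nonneg fun _ _ => by positivity

lemma primeRecip_mono : Monotone primeRecip := fun _ _ h =>
  Finset.sum_le_sum_of_subset_of_nonneg (Nat.primesLE_mono h) fun _ _ _ => by positivity

lemma log_log_le_two_mul_primeRecip {x : ℝ} (hx : 1 < x) :
    Real.log (Real.log x) ≤ 2 * primeRecip ⌊x⌋₊ := by
  set N := ⌊x⌋₊ with hN
  let f : ℕ →* ℝ :=
    { toFun := fun n => (n : ℝ)⁻¹
      map_one' := by simp
      map_mul' := fun a b => by push_cast; rw [mul_inv] }
  have hf : ∀ n : ℕ, f n = (n : ℝ)⁻¹ := fun n => rfl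
  obtain ⟨-, hhas⟩ := EulerProduct.summable_and_hasSum_smoothNumbers_prod_primesBelow_geometric
    (f := f) (fun {p} hp => by
      rw [hf, norm_inv, Real.norm_natCast]
      exact inv_lt_one_of_one_lt₀ (by exact_mod_cast hp.one_lt)) (N + 1)
  have h1 : Real.log x ≤ ∏ p ∈ N.primesLE, (1 - f p)⁻¹ := by
    have h2 : Real.log x ≤ ∑ n ∈ Finset.Icc 1 N, (n : ℝ)⁻¹ := by
      have := log_add_one_le_harmonic N
      rw [harmonic_eq_sum_Icc] at this
      push_cast at this
      refine le_trans (Real.log_le_log (by linarith) ?_) this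
      exact (Nat.lt_floor_add_one x).le
    refine h2.trans ?_
    have h3 := hhas.tsum_eq
    rw [Nat.primesLE, ← h3]
    have h4 : ∑ n ∈ Finset.Icc 1 N, (n : ℝ)⁻¹ =
        ∑ m ∈ (Finset.Icc 1 N).subtype (· ∈ (N + 1).smoothNumbers), f m := by
      rw [Finset.sum_subtype_of_mem (fun n => f n)]
      · rfl
      · intro n hn
        rw [Finset.mem_Icc] at hn
        exact Nat.mem_smoothNumbers_of_lt (by omega) (by omega)
    rw [h4]
    exact hhas.summable.sum_le_tsum _ fun m _ => by rw [hf]; positivity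
  have h5 : ∏ p ∈ N.primesLE, (1 - f p)⁻¹ ≤ Real.exp (2 * primeRecip N) := by
    rw [primeRecip, Finset.mul_sum, Real.exp_sum]
    refine Finset.prod_le_prod (fun p hp => ?_) fun p hp => ?_
    · have : (1 : ℝ) ≤ p := by exact_mod_cast (Nat.prime_of_mem_primesLE hp).one_le
      have := inv_le_one_of_one_le₀ this
      rw [hf]
      exact inv_nonneg.2 (by linarith)
    · have hp2 : (2 : ℝ) ≤ p := by exact_mod_cast (Nat.prime_of_mem_primesLE hp).two_le
      have ht : (p : ℝ)⁻¹ ≤ 1 / 2 := by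
        rw [one_div]; exact inv_anti₀ (by norm_num) hp2
      have ht0 : 0 ≤ (p : ℝ)⁻¹ := by positivity
      rw [hf, inv_le_comm₀ (by linarith) (Real.exp_pos _), ← Real.exp_neg]
      set t := (p : ℝ)⁻¹
      have h6 := Real.add_one_le_exp (2 * t)
      rw [Real.exp_neg, inv_le_comm₀ (Real.exp_pos _) (by linarith)]
      refine le_trans ?_ h6
      rw [inv_le_iff_one_le_mul₀ (by linarith)]
      nlinarith
  have h6 := h1.trans h5
  rwa [← Real.log_le_iff_le_exp (Real.log_pos hx)] at h6

lemma add_pow_le_pow_mul_exp {S d K : ℝ} {j : ℕ} (hS : 0 < S) (hd : 0 ≤ d)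
    (hj : (j : ℝ) ≤ K * S) : (S + d) ^ j ≤ S ^ j * Real.exp (d * K) := by
  have h1 : S + d ≤ S * Real.exp (d / S) := by
    have := Real.add_one_le_exp (d / S)
    calc S + d = S * (d / S + 1) := by field_simp; ring
      _ ≤ _ := by gcongr
  calc (S + d) ^ j ≤ (S * Real.exp (d / S)) ^ j := by gcongr
    _ = S ^ j * Real.exp (j * (d / S)) := by rw [mul_pow, ← Real.exp_nat_mul]
    _ ≤ S ^ j * Real.exp (d * K) := by
      refine mul_le_mul_of_nonneg_left (Real.exp_le_exp.2 ?_) (by positivity)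
      calc (j : ℝ) * (d / S) ≤ K * S * (d / S) := by gcongr
        _ = d * K := by field_simp

lemma sum_rpow_le_sum_inv_add {w β : ℝ} (hw : 4 ≤ w) (hβ : 0 ≤ β) (hβw : β * Real.log w ≤ 1)
    {s : Finset ℕ} (hs : s ⊆ Nat.primesLE ⌊w⌋₊) :
    ∑ p ∈ s, (p : ℝ) ^ (β - 1) ≤ ∑ p ∈ s, (p : ℝ)⁻¹ + 6 := by
  have hN : 1 ≤ ⌊w⌋₊ := Nat.one_le_floor_iff w |>.2 (by linarith)
  have hNw : ((⌊w⌋₊ : ℕ) : ℝ) ≤ w := Nat.floor_le (by linarith)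
  have key : ∀ p ∈ s, (p : ℝ) ^ (β - 1) ≤ (p : ℝ)⁻¹ + β * 3 * (Real.log p / p) := by
    intro p hp
    have hp' := hs hp
    have hp1 : (1 : ℝ) ≤ p := by exact_mod_cast (Nat.prime_of_mem_primesLE hp').one_le
    have hpw : (p : ℝ) ≤ w :=
      le_trans (by exact_mod_cast Nat.le_of_mem_primesLE hp') hNw
    have hp0 : (0 : ℝ) < p := by linarith
    set t := β * Real.log p with ht
    have ht0 : 0 ≤ t := mul_nonneg hβ (Real.log_nonneg hp1)
    have ht1 : t ≤ 1 := le_trans (by rw [ht]; gcongr) hβw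
    have hexp : Real.exp t ≤ 1 + 3 * t := by
      have h1 := Real.add_one_le_exp (-t)
      have h2 : Real.exp t ≤ 3 :=
        (Real.exp_le_exp.2 ht1).trans (by linarith [Real.exp_one_lt_d9])
      have h3 : Real.exp t * Real.exp (-t) = 1 := by rw [← Real.exp_add]; simp
      nlinarith [Real.exp_pos t]
    rw [Real.rpow_sub hp0, Real.rpow_one, Real.rpow_def_of_pos hp0, mul_comm (Real.log _) β, ← ht]
    calc Real.exp t / p ≤ (1 + 3 * t) / p := by gcongr
      _ = _ := by rw [ht]; field_simp
  refine (Finset.sum_le_sum key).trans ?_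
  rw [Finset.sum_add_distrib, ← Finset.mul_sum]
  gcongr
  have h1 : ∑ p ∈ s, Real.log p / p ≤ 2 * Real.log w := by
    calc ∑ p ∈ s, Real.log p / p ≤ ∑ p ∈ Nat.primesLE ⌊w⌋₊, Real.log p / p :=
          Finset.sum_le_sum_of_subset_of_nonneg hs fun p _ _ =>
            div_nonneg (Real.log_natCast_nonneg p) (by positivity)
      _ ≤ Real.log ⌊w⌋₊ + Real.log 4 := sum_log_div_primesLE_le hN
      _ ≤ Real.log w + Real.log w := by gcongr
      _ = _ := by ring
  calc β * 3 * ∑ p ∈ s, Real.log p / p ≤ β * 3 * (2 * Real.log w) := by gcongr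
    _ = 6 * (β * Real.log w) := by ring
    _ ≤ 6 := by linarith

lemma primeRecip_le_sum_filter_add {x A : ℝ} (hx : 4 ≤ x) (hA : 1 ≤ A) (q : ℕ) :
    primeRecip ⌊x⌋₊ ≤
      ∑ p ∈ (Nat.primesLE ⌊x ^ A⁻¹⌋₊).filter (q < ·), (p : ℝ)⁻¹ + (q + 2 * A) := by
  set w := x ^ A⁻¹ with hw
  have hlx : 0 < Real.log x := Real.log_pos (by linarith)
  have hlw : Real.log w = Real.log x / A := by
    rw [hw, Real.log_rpow (by linarith)]; ring
  have hlw0 : 0 < Real.log w := by rw [hlw]; positivity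
  have hw0 : 0 < w := by positivity
  have h1 : primeRecip ⌊x⌋₊ ≤
      (∑ p ∈ (Nat.primesLE ⌊w⌋₊).filter (q < ·), (p : ℝ)⁻¹ + ∑ p ∈ Finset.Icc 1 q, (p : ℝ)⁻¹) +
      ∑ p ∈ (Nat.primesLE ⌊x⌋₊).filter (fun p : ℕ => w < p), (p : ℝ)⁻¹ := by
    rw [← Finset.sum_union, primeRecip]
    · refine le_trans (Finset.sum_le_sum_of_subset_of_nonneg (t := (((Nat.primesLE ⌊w⌋₊).filter
        (q < ·)) ∪ Finset.Icc 1 q) ∪ (Nat.primesLE ⌊x⌋₊).filter (fun p : ℕ => w < p)) ?_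
        fun _ _ _ => by positivity) ?_
      · intro p hp
        simp only [Finset.mem_union, Finset.mem_filter, Finset.mem_Icc]
        have hpp := Nat.prime_of_mem_primesLE hp
        by_cases h : w < p
        · exact Or.inr ⟨hp, h⟩
        · refine Or.inl ?_
          by_cases h' : q < p
          · exact Or.inl ⟨Nat.mem_primesLE.2 ⟨Nat.le_floor (not_lt.1 h), hpp⟩, h'⟩
          · exact Or.inr ⟨hpp.one_le, not_lt.1 h'⟩
      · rw [← Finset.sum_union_inter]
        exact le_add_of_nonneg_right (Finset.sum_nonneg fun _ _ => by positivity)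
    · rw [Finset.disjoint_left]
      intro p hp hp'
      have := (Finset.mem_filter.1 hp).2
      have := (Finset.mem_Icc.1 hp').2
      omega
  have h2 : ∑ p ∈ Finset.Icc 1 q, (p : ℝ)⁻¹ ≤ q := by
    calc ∑ p ∈ Finset.Icc 1 q, (p : ℝ)⁻¹ ≤ ∑ p ∈ Finset.Icc 1 q, (1 : ℝ) :=
          Finset.sum_le_sum fun p hp => inv_le_one_of_one_le₀
            (by exact_mod_cast (Finset.mem_Icc.1 hp).1)
      _ = q := by simp
  have h3 : ∑ p ∈ (Nat.primesLE ⌊x⌋₊).filter (fun p : ℕ => w < p), (p : ℝ)⁻¹ ≤ 2 * A := by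
    calc ∑ p ∈ (Nat.primesLE ⌊x⌋₊).filter (fun p : ℕ => w < p), (p : ℝ)⁻¹
        ≤ ∑ p ∈ (Nat.primesLE ⌊x⌋₊).filter (fun p : ℕ => w < p),
            (Real.log w)⁻¹ * (Real.log p / p) := by
          refine Finset.sum_le_sum fun p hp => ?_
          have hp' := (Finset.mem_filter.1 hp).2
          have hp0 : (0 : ℝ) < p := hw0.trans hp'
          have : Real.log w ≤ Real.log p := Real.log_le_log hw0 hp'.le
          calc (p : ℝ)⁻¹ = (Real.log w)⁻¹ * (Real.log w / p) := by field_simp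
            _ ≤ _ := by gcongr
      _ ≤ (Real.log w)⁻¹ * ∑ p ∈ Nat.primesLE ⌊x⌋₊, Real.log p / p := by
          rw [← Finset.mul_sum]
          exact mul_le_mul_of_nonneg_left (Finset.sum_le_sum_of_subset_of_nonneg
            (Finset.filter_subset _ _) fun p _ _ =>
              div_nonneg (Real.log_natCast_nonneg p) (by positivity)) (by positivity)
      _ ≤ (Real.log w)⁻¹ * (Real.log x + Real.log x) := by
          have hN : 1 ≤ ⌊x⌋₊ := Nat.one_le_floor_iff x |>.2 (by linarith)
          have hNx : ((⌊x⌋₊ : ℕ) : ℝ) ≤ x := Nat.floor_le (by linarith)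
          gcongr
          refine (sum_log_div_primesLE_le hN).trans ?_
          gcongr
      _ = 2 * A := by rw [hlw]; field_simp; ring
  linarith

lemma le_sum_powersetCard_prod_le {s : Finset ℕ} {β z K : ℝ} {j : ℕ} (hβ : 0 ≤ β) (hz : 0 < z)
    (hpos : ∀ p ∈ s, 0 < p)
    (hS : 0 < ∑ p ∈ s, (p : ℝ)⁻¹) (hj : (j : ℝ) ≤ K * ∑ p ∈ s, (p : ℝ)⁻¹)
    (hV : K ^ 2 * ∑ p ∈ s, ((p : ℝ)⁻¹) ^ 2 ≤ 1)
    (hS' : ∑ p ∈ s, (p : ℝ) ^ (β - 1) ≤ ∑ p ∈ s, (p : ℝ)⁻¹ + 6)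
    (hK : z ^ (-β) * Real.exp (6 * K) ≤ 1 / 4) :
    (∑ p ∈ s, (p : ℝ)⁻¹) ^ j / (4 * j.factorial) ≤
      ∑ T ∈ (s.powersetCard j).filter (fun T => ((∏ p ∈ T, p : ℕ) : ℝ) ≤ z),
        ∏ p ∈ T, (p : ℝ)⁻¹ := by
  set S := ∑ p ∈ s, (p : ℝ)⁻¹ with hSdef
  set V := ∑ p ∈ s, ((p : ℝ)⁻¹) ^ 2 with hVdef
  have hV0 : 0 ≤ V := Finset.sum_nonneg fun p _ => by positivity
  have hlow := le_elemSymm (g := fun p : ℕ => (p : ℝ)⁻¹) (fun p => by positivity) s hS j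
  simp only [← hSdef, ← hVdef] at hlow
  have hhalf : S ^ j / j.factorial * (1 / 2) ≤ elemSymm s (fun p : ℕ => (p : ℝ)⁻¹) j := by
    refine le_trans ?_ hlow
    gcongr
    have h1 : (j : ℝ) * (j - 1) ≤ (K * S) ^ 2 := by
      have : (j : ℝ) * (j - 1) ≤ j ^ 2 := by nlinarith [(Nat.cast_nonneg j : (0 : ℝ) ≤ j)]
      exact this.trans (by gcongr)
    have h2 : (j : ℝ) * (j - 1) / 2 * (V / S ^ 2) ≤ (K * S) ^ 2 / 2 * (V / S ^ 2) := by gcongr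
    have h3 : (K * S) ^ 2 / 2 * (V / S ^ 2) = K ^ 2 * V / 2 := by field_simp
    linarith
  have hbig : ∑ T ∈ (s.powersetCard j).filter (fun T => ¬ ((∏ p ∈ T, p : ℕ) : ℝ) ≤ z),
      ∏ p ∈ T, (p : ℝ)⁻¹ ≤ S ^ j / j.factorial * (1 / 4) := by
    calc ∑ T ∈ (s.powersetCard j).filter (fun T => ¬ ((∏ p ∈ T, p : ℕ) : ℝ) ≤ z),
          ∏ p ∈ T, (p : ℝ)⁻¹
        ≤ ∑ T ∈ (s.powersetCard j).filter (fun T => ¬ ((∏ p ∈ T, p : ℕ) : ℝ) ≤ z),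
          z ^ (-β) * ∏ p ∈ T, (p : ℝ) ^ (β - 1) := by
          refine Finset.sum_le_sum fun T hT => ?_
          obtain ⟨hT1, hT2⟩ := Finset.mem_filter.1 hT
          rw [not_le] at hT2
          have hTs := (Finset.mem_powersetCard.1 hT1).1
          have hprod : ∏ p ∈ T, (p : ℝ) ^ (β - 1) =
              ((∏ p ∈ T, p : ℕ) : ℝ) ^ β * ∏ p ∈ T, (p : ℝ)⁻¹ := by
            push_cast
            rw [← Real.finsetProd_rpow T (fun p : ℕ => (p : ℝ)) (fun p _ => by positivity),
              ← Finset.prod_mul_distrib]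
            refine Finset.prod_congr rfl fun p hp => ?_
            have : (0 : ℝ) < p := by exact_mod_cast hpos p (hTs hp)
            rw [Real.rpow_sub this, Real.rpow_one, div_eq_mul_inv]
          rw [hprod, ← mul_assoc]
          refine le_mul_of_one_le_left (Finset.prod_nonneg fun p _ => by positivity) ?_
          calc (1 : ℝ) = z ^ (-β) * z ^ β := by rw [← Real.rpow_add hz]; simp
            _ ≤ _ := by gcongr
      _ ≤ z ^ (-β) * elemSymm s (fun p : ℕ => (p : ℝ) ^ (β - 1)) j := by
          rw [← Finset.mul_sum, elemSymm]
          exact mul_le_mul_of_nonneg_left (Finset.sum_le_sum_of_subset_of_nonneg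
            (Finset.filter_subset _ _) fun T _ _ =>
              Finset.prod_nonneg fun p _ => by positivity) (by positivity)
      _ ≤ z ^ (-β) * ((∑ p ∈ s, (p : ℝ) ^ (β - 1)) ^ j / j.factorial) := by
          gcongr
          exact elemSymm_le (fun p => by positivity) s j
      _ ≤ z ^ (-β) * ((S + 6) ^ j / j.factorial) := by
          have : 0 ≤ ∑ p ∈ s, (p : ℝ) ^ (β - 1) := Finset.sum_nonneg fun p _ => by positivity
          gcongr
      _ ≤ z ^ (-β) * (S ^ j * Real.exp (6 * K) / j.factorial) := by
          gcongr
          exact add_pow_le_pow_mul_exp hS (by norm_num) hj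
      _ = S ^ j / j.factorial * (z ^ (-β) * Real.exp (6 * K)) := by ring
      _ ≤ _ := by gcongr
  have hsplit := Finset.sum_filter_add_sum_filter_not (s.powersetCard j)
    (fun T => ((∏ p ∈ T, p : ℕ) : ℝ) ≤ z) (fun T => ∏ p ∈ T, (p : ℝ)⁻¹)
  rw [elemSymm] at hhalf
  have : S ^ j / (4 * j.factorial) = S ^ j / j.factorial * (1 / 4) := by field_simp
  linarith

lemma eventually_le_sum_powersetCard {R : ℝ} (hR : 0 < R) :
    ∃ c : ℝ, 0 < c ∧ ∀ᶠ x : ℝ in Filter.atTop, ∀ j : ℕ, (j : ℝ) ≤ R * Real.log (Real.log x) →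
      c * (primeRecip ⌊x⌋₊ ^ j / j.factorial) ≤
        ∑ T ∈ ((Nat.primesLE ⌊x ^ (1 / 4 : ℝ)⌋₊).powersetCard j).filter
          (fun T => ((∏ p ∈ T, p : ℕ) : ℝ) ≤ x ^ (1 / 4 : ℝ)), ∏ p ∈ T, (p : ℝ)⁻¹ := by
  set K := 4 * R with hK
  set q := ⌈2 * K ^ 2⌉₊ with hq
  set A := 4 * (6 * K + 2) with hA
  set D := (q : ℝ) + 2 * A with hD
  have hK0 : 0 < K := by positivity
  have hA4 : 4 ≤ A := by rw [hA]; linarith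
  have hA0 : 0 < A := by linarith
  have hD0 : 0 < D := by positivity
  refine ⟨Real.exp (-(D * K)) / 4, by positivity, ?_⟩
  have hlog := Real.tendsto_log_atTop
  filter_upwards [Filter.eventually_ge_atTop 4, hlog.eventually_ge_atTop (A * Real.log 4),
    (hlog.comp hlog).eventually_ge_atTop (4 * D)] with x hx4 hx1 hx2 j hj
  simp only [Function.comp_apply] at hx2
  have hx0 : 0 < x := by linarith
  have hlx : 0 < Real.log x := Real.log_pos (by linarith)
  set w := x ^ A⁻¹ with hw
  set s := (Nat.primesLE ⌊w⌋₊).filter (q < ·) with hs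
  set S := ∑ p ∈ s, (p : ℝ)⁻¹ with hS
  set P := primeRecip ⌊x⌋₊ with hP
  have hPlow := log_log_le_two_mul_primeRecip (x := x) (by linarith)
  have hPS : P ≤ S + D := primeRecip_le_sum_filter_add hx4 (by linarith) q
  rw [← hP] at hPlow
  have hS4 : Real.log (Real.log x) ≤ 4 * S := by linarith
  have hS0 : 0 < S := by linarith
  have hjS : (j : ℝ) ≤ K * S := hj.trans (by rw [hK]; nlinarith)
  have hlw : Real.log w = Real.log x / A := by
    rw [hw, Real.log_rpow hx0]; ring
  have hw0 : 0 < w := by positivity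
  have hw4 : 4 ≤ w := by
    rw [← Real.log_le_log_iff (by norm_num) hw0, hlw, le_div_iff₀ hA0]
    linarith
  have hV : K ^ 2 * ∑ p ∈ s, ((p : ℝ)⁻¹) ^ 2 ≤ 1 := by
    have h1 : ∑ p ∈ s, ((p : ℝ)⁻¹) ^ 2 ≤ 2 / (q + 1) := by
      refine le_trans ?_ (sum_Ioo_inv_sq_le q (⌊w⌋₊ + 1))
      simp only [inv_pow]
      refine Finset.sum_le_sum_of_subset_of_nonneg ?_ fun _ _ _ => by positivity
      intro p hp
      rw [hs, Finset.mem_filter, Nat.mem_primesLE] at hp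
      rw [Finset.mem_Ioo]
      omega
    have h2 : 2 * K ^ 2 ≤ q := Nat.le_ceil _
    calc K ^ 2 * ∑ p ∈ s, ((p : ℝ)⁻¹) ^ 2 ≤ K ^ 2 * (2 / (q + 1)) := by gcongr
      _ = 2 * K ^ 2 / (q + 1) := by ring
      _ ≤ 1 := by rw [div_le_one (by positivity)]; linarith
  have hss : s ⊆ Nat.primesLE ⌊w⌋₊ := Finset.filter_subset _ _
  have hβ0 : 0 ≤ A / Real.log x := by positivity
  have hS' := sum_rpow_le_sum_inv_add hw4 hβ0
    (by rw [hlw]; apply le_of_eq; field_simp) hss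
  have hz : (x ^ (1 / 4 : ℝ)) ^ (-(A / Real.log x)) * Real.exp (6 * K) ≤ 1 / 4 := by
    rw [← Real.rpow_mul hx0.le, Real.rpow_def_of_pos hx0, ← Real.exp_add]
    have h1 : Real.log x * (1 / 4 * -(A / Real.log x)) + 6 * K = -2 := by
      rw [hA]; field_simp; ring
    have h2 : (4 : ℝ) ≤ Real.exp 2 := by
      have := Real.add_one_le_exp (1 : ℝ)
      calc (4 : ℝ) = (1 + 1) * (1 + 1) := by norm_num
        _ ≤ Real.exp 1 * Real.exp 1 := by gcongr
        _ = Real.exp 2 := by rw [← Real.exp_add]; norm_num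
    rw [h1, Real.exp_neg, one_div]
    exact inv_anti₀ (by norm_num) h2
  have hmain := le_sum_powersetCard_prod_le hβ0 (Real.rpow_pos_of_pos hx0 (1 / 4))
    (fun p hp => (Nat.prime_of_mem_primesLE (hss hp)).pos) hS0 hjS hV hS' hz
  have hP0 : 0 ≤ P := primeRecip_nonneg _
  have hPj : P ^ j ≤ S ^ j * Real.exp (D * K) :=
    (pow_le_pow_left₀ hP0 hPS j).trans (add_pow_le_pow_mul_exp hS0 hD0.le hjS)
  calc Real.exp (-(D * K)) / 4 * (P ^ j / j.factorial)
      ≤ Real.exp (-(D * K)) / 4 * (S ^ j * Real.exp (D * K) / j.factorial) := by gcongr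
    _ = S ^ j / (4 * j.factorial) * (Real.exp (-(D * K)) * Real.exp (D * K)) := by
        field_simp
    _ = S ^ j / (4 * j.factorial) := by rw [← Real.exp_add]; simp
    _ ≤ _ := hmain
    _ ≤ _ := by
        refine Finset.sum_le_sum_of_subset_of_nonneg ?_ fun T _ _ =>
          Finset.prod_nonneg fun p _ => by positivity
        refine Finset.filter_subset_filter _ (Finset.powersetCard_mono ?_)
        refine hss.trans (Nat.primesLE_mono (Nat.floor_mono ?_))
        refine Real.rpow_le_rpow_of_exponent_le (by linarith) ?_
        rw [one_div]
        exact inv_anti₀ (by norm_num) hA4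

lemma sum_card_primes_le_pik (x z : ℝ) (hx : 0 ≤ x) (hz : 0 ≤ z) (j : ℕ) :
    ∑ T ∈ ((Nat.primesLE ⌊z⌋₊).powersetCard j).filter
        (fun T => ((∏ p ∈ T, p : ℕ) : ℝ) ≤ z),
      ((Nat.primesLE ⌊x / (∏ p ∈ T, p : ℕ)⌋₊).filter (fun p : ℕ => z < p)).card ≤
        pik (j + 1) x := by
  rw [← Finset.card_sigma, pik]
  set F := ((Nat.primesLE ⌊z⌋₊).powersetCard j).filter (fun T => ((∏ p ∈ T, p : ℕ) : ℝ) ≤ z)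
  have hF : ∀ T ∈ F, (∀ p ∈ T, p.Prime ∧ (p : ℝ) ≤ z) ∧ T.card = j := by
    intro T hT
    obtain ⟨h1, h2⟩ := Finset.mem_powersetCard.1 (Finset.mem_filter.1 hT).1
    refine ⟨fun p hp => ?_, h2⟩
    have := Nat.mem_primesLE.1 (h1 hp)
    exact ⟨this.2, (Nat.le_floor_iff hz).1 this.1⟩
  have hpf : ∀ T ∈ F, ∀ p : ℕ, p.Prime → (p * ∏ q ∈ T, q).primeFactors = insert p T := by
    intro T hT p hp
    rw [Nat.primeFactors_mul hp.ne_zero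
      (Finset.prod_ne_zero_iff.2 fun q hq => ((hF T hT).1 q hq).1.ne_zero),
      Nat.primeFactors_prod fun q hq => ((hF T hT).1 q hq).1, hp.primeFactors,
      Finset.insert_eq]
  have hnot : ∀ T ∈ F, ∀ p : ℕ, z < p → p ∉ T := fun T hT p hzp hp =>
    absurd ((hF T hT).1 p hp).2 (not_le.2 hzp)
  refine Finset.card_le_card_of_injOn (fun a => a.2 * ∏ q ∈ a.1, q) ?_ ?_
  · rintro ⟨T, p⟩ ha
    simp only [Finset.coe_sigma, Set.mem_sigma_iff, Finset.mem_coe, Finset.mem_filter,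
      Nat.mem_primesLE] at ha
    obtain ⟨hT, ⟨hpx, hp⟩, hzp⟩ := ha
    have hprod : 0 < ∏ q ∈ T, q := Finset.prod_pos fun q hq => ((hF T hT).1 q hq).1.pos
    simp only [Finset.mem_coe, Finset.mem_filter, Finset.mem_Icc]
    refine ⟨⟨Nat.mul_pos hp.pos hprod, Nat.le_floor ?_⟩, ?_⟩
    · have h1 := (Nat.le_floor_iff (by positivity)).1 hpx
      rw [le_div_iff₀ (by exact_mod_cast hprod)] at h1
      exact_mod_cast h1
    · rw [hpf T hT p hp, Finset.card_insert_of_notMem (hnot T hT p hzp), (hF T hT).2]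
  · rintro ⟨T, p⟩ ha ⟨U, r⟩ hb h
    simp only [Finset.coe_sigma, Set.mem_sigma_iff, Finset.mem_coe, Finset.mem_filter,
      Nat.mem_primesLE] at ha hb
    obtain ⟨hT, ⟨-, hp⟩, hzp⟩ := ha
    obtain ⟨hU, ⟨-, hr⟩, hzr⟩ := hb
    have h1 := hpf T hT p hp
    simp only at h
    rw [h, hpf U hU r hr] at h1
    have hpr : p = r := by
      have : p ∈ insert r U := h1 ▸ Finset.mem_insert_self p T
      exact (Finset.mem_insert.1 this).resolve_right (hnot U hU p hzp)
    subst hpr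
    have hTU : T = U := by
      rw [← Finset.erase_insert (hnot T hT p hzp), ← Finset.erase_insert (hnot U hU p hzp), h1]
    subst hTU
    rfl

lemma eventually_le_card_primes :
    ∀ᶠ x : ℝ in Filter.atTop, ∀ m : ℝ, 1 ≤ m → m ≤ x ^ (1 / 4 : ℝ) →
      x / (4 * Real.log x) * m⁻¹ ≤
        ((Nat.primesLE ⌊x / m⌋₊).filter (fun p : ℕ => x ^ (1 / 4 : ℝ) < p)).card := by
  have hlo : ∀ᶠ z : ℝ in Filter.atTop, z / 2 ≤ (z - 1) * Real.log 2 - Real.log (z + 2) := by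
    have h := (Real.isLittleO_log_id_atTop.comp_tendsto
      (Filter.tendsto_atTop_add_const_right Filter.atTop (2 : ℝ) Filter.tendsto_id)).bound
      (show (0 : ℝ) < 1 / 20 by norm_num)
    filter_upwards [h, Filter.eventually_ge_atTop 10] with z hz h10
    simp only [Function.comp_apply, id] at hz
    rw [Real.norm_of_nonneg (Real.log_nonneg (by linarith)),
      Real.norm_of_nonneg (by linarith)] at hz
    nlinarith [Real.log_two_gt_d9]
  have hlo' := (tendsto_rpow_atTop (show (0 : ℝ) < 3 / 4 by norm_num)).eventually
    (Filter.eventually_forall_ge_atTop.2 hlo)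
  have hlog := (isLittleO_log_rpow_atTop (show (0 : ℝ) < 1 / 2 by norm_num)).bound
    (show (0 : ℝ) < 1 / 4 by norm_num)
  filter_upwards [hlo', hlog, Filter.eventually_ge_atTop 3] with x h1 h2 h3 m hm1 hm
  have hx0 : 0 < x := by linarith
  have hm0 : 0 < m := by linarith
  have hlx : 0 < Real.log x := Real.log_pos (by linarith)
  rw [Real.norm_of_nonneg hlx.le, Real.norm_of_nonneg (by positivity)] at h2
  set z := x / m with hz
  have hz34 : x ^ (3 / 4 : ℝ) ≤ z := by
    rw [hz, le_div_iff₀ hm0]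
    calc x ^ (3 / 4 : ℝ) * m ≤ x ^ (3 / 4 : ℝ) * x ^ (1 / 4 : ℝ) := by gcongr
      _ = x := by rw [← Real.rpow_add hx0]; norm_num
  have hz1 : 1 < z := lt_of_lt_of_le (Real.one_lt_rpow (by linarith) (by norm_num)) hz34
  have hzx : z ≤ x := div_le_self hx0.le hm1
  have hpi := Chebyshev.pi_ge' hz1
  have hpi' : z / (2 * Real.log x) ≤ (Nat.primeCounting ⌊z⌋₊ : ℝ) := by
    refine le_trans ?_ hpi
    calc z / (2 * Real.log x) = (z / 2) / Real.log x := by field_simp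
      _ ≤ (z / 2) / Real.log z := by
        have := Real.log_pos hz1
        gcongr
      _ ≤ _ := by
        have := Real.log_pos hz1
        gcongr
        exact h1 z hz34
  have hsmall : x ^ (1 / 4 : ℝ) ≤ z / (4 * Real.log x) := by
    rw [le_div_iff₀ (by positivity)]
    calc x ^ (1 / 4 : ℝ) * (4 * Real.log x) ≤ x ^ (1 / 4 : ℝ) * x ^ (1 / 2 : ℝ) := by
          gcongr; linarith
      _ = x ^ (3 / 4 : ℝ) := by rw [← Real.rpow_add hx0]; norm_num
      _ ≤ z := hz34
  have hcard : (Nat.primeCounting ⌊z⌋₊ : ℝ) ≤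
      ((Nat.primesLE ⌊z⌋₊).filter (fun p : ℕ => x ^ (1 / 4 : ℝ) < p)).card +
        x ^ (1 / 4 : ℝ) := by
    rw [← Nat.primesLE_card_eq_primeCounting,
      ← Finset.card_filter_add_card_filter_not (s := Nat.primesLE ⌊z⌋₊)
        (fun p : ℕ => x ^ (1 / 4 : ℝ) < p)]
    push_cast
    gcongr
    have : (Nat.primesLE ⌊z⌋₊).filter (fun p : ℕ => ¬ x ^ (1 / 4 : ℝ) < p) ⊆
        Finset.Icc 1 ⌊x ^ (1 / 4 : ℝ)⌋₊ := by
      intro p hp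
      obtain ⟨hp1, hp2⟩ := Finset.mem_filter.1 hp
      exact Finset.mem_Icc.2 ⟨(Nat.prime_of_mem_primesLE hp1).one_le,
        Nat.le_floor (not_lt.1 hp2)⟩
    have h := Finset.card_le_card this
    rw [Nat.card_Icc, Nat.add_sub_cancel] at h
    exact (Nat.cast_le.2 h).trans (Nat.floor_le (by positivity))
  have heq : x / (4 * Real.log x) * m⁻¹ = z / (2 * Real.log x) - z / (4 * Real.log x) := by
    rw [hz]; field_simp; norm_num
  rw [heq]
  linarith

lemma eventually_le_pik {R : ℝ} (hR : 0 < R) :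
    ∃ c : ℝ, 0 < c ∧ ∀ᶠ x : ℝ in Filter.atTop, ∀ j : ℕ, (j : ℝ) ≤ R * Real.log (Real.log x) →
      c * (x / Real.log x) * (primeRecip ⌊x⌋₊ ^ j / j.factorial) ≤ pik (j + 1) x := by
  obtain ⟨c, hc, h⟩ := eventually_le_sum_powersetCard hR
  refine ⟨c / 4, by positivity, ?_⟩
  filter_upwards [h, eventually_le_card_primes, Filter.eventually_ge_atTop 3]
    with x h1 h2 h3 j hj
  have hx0 : 0 < x := by linarith
  have hlx : 0 < Real.log x := Real.log_pos (by linarith)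
  have hcount := sum_card_primes_le_pik x (x ^ (1 / 4 : ℝ)) hx0.le (by positivity) j
  refine le_trans ?_ ((Nat.cast_le (α := ℝ)).2 hcount)
  rw [Nat.cast_sum]
  have hfirst : c / 4 * (x / Real.log x) * (primeRecip ⌊x⌋₊ ^ j / j.factorial) =
      x / (4 * Real.log x) * (c * (primeRecip ⌊x⌋₊ ^ j / j.factorial)) := by
    field_simp
  rw [hfirst]
  refine (mul_le_mul_of_nonneg_left (h1 j hj) (by positivity)).trans ?_
  rw [Finset.mul_sum]
  refine Finset.sum_le_sum fun T hT => ?_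
  obtain ⟨hT1, hT2⟩ := Finset.mem_filter.1 hT
  have hprod : 1 ≤ ∏ p ∈ T, p := Finset.prod_pos fun p hp =>
    (Nat.prime_of_mem_primesLE ((Finset.mem_powersetCard.1 hT1).1 hp)).pos
  have hinv : ∏ p ∈ T, (p : ℝ)⁻¹ = ((∏ p ∈ T, p : ℕ) : ℝ)⁻¹ := by
    push_cast
    rw [Finset.prod_inv_distrib]
  rw [hinv]
  exact h2 _ (by exact_mod_cast hprod) hT2

/-- The `n ≤ N` with exactly `k` distinct prime factors, all of them at most `M`. -/
def omegaSmooth (k N M : ℕ) : Finset ℕ :=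
  (Finset.Icc 1 N).filter fun n => n.primeFactors.card = k ∧ ∀ p ∈ n.primeFactors, p ≤ M

lemma mem_omegaSmooth {k N M n : ℕ} : n ∈ omegaSmooth k N M ↔
    (1 ≤ n ∧ n ≤ N) ∧ n.primeFactors.card = k ∧ ∀ p ∈ n.primeFactors, p ≤ M := by
  rw [omegaSmooth, Finset.mem_filter, Finset.mem_Icc]

lemma piky_eq_card_omegaSmooth (k : ℕ) {x y : ℝ} (hy : 0 ≤ y) :
    piky k x y = (omegaSmooth k ⌊x⌋₊ ⌊y⌋₊).card := by
  rw [piky, omegaSmooth]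
  simp only [Nat.le_floor_iff hy]

lemma sum_primeFactors_le_sum_omegaSmooth {F : ℕ → ℕ → ℝ} (hF : ∀ m q, 0 ≤ F m q)
    (k N M : ℕ) :
    ∑ n ∈ omegaSmooth (k + 1) N M, ∑ p ∈ n.primeFactors,
        F (n / p ^ n.factorization p) (p ^ n.factorization p) ≤
      ∑ m ∈ omegaSmooth k N M, ∑ q ∈ (omegaSmooth 1 N M).filter (fun q => m * q ≤ N), F m q := by
  rw [Finset.sum_sigma', Finset.sum_sigma']
  set A := (omegaSmooth (k + 1) N M).sigma fun n => n.primeFactors with hA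
  set i : (Σ _ : ℕ, ℕ) → (Σ _ : ℕ, ℕ) := fun a =>
    ⟨a.1 / a.2 ^ a.1.factorization a.2, a.2 ^ a.1.factorization a.2⟩ with hi
  have hmem : ∀ n p : ℕ, (⟨n, p⟩ : Σ _ : ℕ, ℕ) ∈ A →
      n ∈ omegaSmooth (k + 1) N M ∧ p.Prime ∧ p ∣ n ∧ n ≠ 0 := by
    intro n p h
    rw [hA, Finset.mem_sigma] at h
    exact ⟨h.1, Nat.mem_primeFactors.1 h.2⟩
  have hinj : Set.InjOn i (A : Set (Σ _ : ℕ, ℕ)) := by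
    rintro ⟨n, p⟩ ha ⟨n', p'⟩ hb h
    obtain ⟨-, hp, hpn, hn⟩ := hmem n p ha
    obtain ⟨-, hp', hpn', hn'⟩ := hmem n' p' hb
    simp only [hi, Sigma.mk.injEq, heq_eq_eq] at h
    have h1 : n = n' := by
      rw [← Nat.ordProj_mul_ordCompl_eq_self n p, ← Nat.ordProj_mul_ordCompl_eq_self n' p',
        h.1, h.2]
    have h2 : p = p' := by
      have h3 : p ∣ p ^ n.factorization p :=
        dvd_pow_self p (hp.factorization_pos_of_dvd hn hpn).ne'
      rw [h.2] at h3
      exact (Nat.prime_dvd_prime_iff_eq hp hp').1 (hp.dvd_of_dvd_pow h3)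
    rw [h1, h2]
  rw [← Finset.sum_image (f := fun a : (Σ _ : ℕ, ℕ) => F a.1 a.2) (g := i) hinj]
  refine Finset.sum_le_sum_of_subset_of_nonneg ?_ fun _ _ _ => hF _ _
  intro b hb
  obtain ⟨⟨n, p⟩, ha, rfl⟩ := Finset.mem_image.1 hb
  obtain ⟨hn, hp, hpn, hn0⟩ := hmem n p ha
  obtain ⟨⟨hn1, hnN⟩, hcard, hM⟩ := mem_omegaSmooth.1 hn
  have hfac : n.factorization p ≠ 0 := (hp.factorization_pos_of_dvd hn0 hpn).ne'
  have hmul := Nat.ordProj_mul_ordCompl_eq_self n p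
  have hpM : p ≤ M := hM p (Nat.mem_primeFactors.2 ⟨hp, hpn, hn0⟩)
  have hcompl : (n / p ^ n.factorization p).primeFactors = n.primeFactors.erase p := by
    rw [← Nat.support_factorization, Nat.factorization_ordCompl, Finsupp.support_erase,
      Nat.support_factorization]
  rw [Finset.mem_sigma, Finset.mem_filter, mem_omegaSmooth, mem_omegaSmooth]
  simp only [hi]
  refine ⟨⟨⟨Nat.ordCompl_pos p hn0, (Nat.ordCompl_le n p).trans hnN⟩, ?_, ?_⟩,
    ⟨⟨Nat.ordProj_pos n p, (Nat.ordProj_le p hn0).trans hnN⟩, ?_, ?_⟩, ?_⟩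
  · rw [hcompl, Finset.card_erase_of_mem (Nat.mem_primeFactors.2 ⟨hp, hpn, hn0⟩), hcard,
      Nat.add_sub_cancel]
  · intro r hr
    rw [hcompl] at hr
    exact hM r (Finset.mem_of_mem_erase hr)
  · rw [Nat.primeFactors_prime_pow hfac hp, Finset.card_singleton]
  · intro r hr
    rw [Nat.primeFactors_prime_pow hfac hp, Finset.mem_singleton] at hr
    exact hr ▸ hpM
  · rw [mul_comm, hmul]
    exact hnN

lemma sum_rpow_omegaSmooth_le (t : ℝ) (j N M : ℕ) :
    ∑ n ∈ omegaSmooth j N M, (n : ℝ) ^ t ≤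
      (∑ q ∈ omegaSmooth 1 N M, (q : ℝ) ^ t) ^ j / j.factorial := by
  set S := ∑ q ∈ omegaSmooth 1 N M, (q : ℝ) ^ t with hS
  have hS0 : 0 ≤ S := Finset.sum_nonneg fun _ _ => by positivity
  induction j with
  | zero =>
    have hsub : omegaSmooth 0 N M ⊆ {1} := by
      intro n hn
      obtain ⟨⟨hn1, -⟩, hc, -⟩ := mem_omegaSmooth.1 hn
      rw [Finset.card_eq_zero, Nat.primeFactors_eq_empty] at hc
      rw [Finset.mem_singleton]
      omega
    refine (Finset.sum_le_sum_of_subset_of_nonneg hsub fun _ _ _ => by positivity).trans ?_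
    simp
  | succ j ih =>
    have h := sum_primeFactors_le_sum_omegaSmooth
      (F := fun m q => (m : ℝ) ^ t * (q : ℝ) ^ t) (fun _ _ => by positivity) j N M
    have hl : ∑ n ∈ omegaSmooth (j + 1) N M, ∑ p ∈ n.primeFactors,
        ((n / p ^ n.factorization p : ℕ) : ℝ) ^ t * ((p ^ n.factorization p : ℕ) : ℝ) ^ t =
        (j + 1) * ∑ n ∈ omegaSmooth (j + 1) N M, (n : ℝ) ^ t := by
      rw [Finset.mul_sum]
      refine Finset.sum_congr rfl fun n hn => ?_
      have hterm : ∀ p ∈ n.primeFactors, ((n / p ^ n.factorization p : ℕ) : ℝ) ^ t *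
          ((p ^ n.factorization p : ℕ) : ℝ) ^ t = (n : ℝ) ^ t := by
        intro p _
        rw [← Real.mul_rpow (by positivity) (by positivity), ← Nat.cast_mul, mul_comm,
          Nat.ordProj_mul_ordCompl_eq_self]
      rw [Finset.sum_congr rfl hterm, Finset.sum_const, (mem_omegaSmooth.1 hn).2.1,
        nsmul_eq_mul]
      push_cast
      rfl
    have hr : ∑ m ∈ omegaSmooth j N M, ∑ q ∈ (omegaSmooth 1 N M).filter (fun q => m * q ≤ N),
        (m : ℝ) ^ t * (q : ℝ) ^ t ≤ (∑ m ∈ omegaSmooth j N M, (m : ℝ) ^ t) * S := by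
      rw [Finset.sum_mul]
      refine Finset.sum_le_sum fun m _ => ?_
      rw [← Finset.mul_sum]
      exact mul_le_mul_of_nonneg_left (Finset.sum_le_sum_of_subset_of_nonneg
        (Finset.filter_subset _ _) fun _ _ _ => by positivity) (by positivity)
    rw [hl] at h
    have h2 := h.trans (hr.trans (mul_le_mul_of_nonneg_right ih hS0))
    rw [Nat.factorial_succ, Nat.cast_mul, pow_succ, ← div_div, le_div_iff₀' (by positivity)] at *
    push_cast at *
    rw [le_div_iff₀ (by positivity)]
    calc _ = ((j + 1) * ∑ n ∈ omegaSmooth (j + 1) N M, (n : ℝ) ^ t) * j.factorial := by ring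
      _ ≤ (S ^ j / j.factorial * S) * j.factorial := by gcongr
      _ = _ := by field_simp

lemma exists_sum_not_prime_le : ∃ D : ℝ, 0 < D ∧ ∀ N M : ℕ,
    ∑ q ∈ (omegaSmooth 1 N M).filter (fun q => ¬ q.Prime), (q : ℝ) ^ (-(4 / 5) : ℝ) ≤ D := by
  have hs1 : Summable fun n : ℕ => (n : ℝ) ^ (-(8 / 5) : ℝ) :=
    Real.summable_nat_rpow.2 (by norm_num)
  have hs2 : Summable fun n : ℕ => (n : ℝ) ^ (-(12 / 5) : ℝ) :=
    Real.summable_nat_rpow.2 (by norm_num)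
  refine ⟨(∑' n : ℕ, (n : ℝ) ^ (-(8 / 5) : ℝ)) * (∑' n : ℕ, (n : ℝ) ^ (-(12 / 5) : ℝ)) + 1,
    ?_, fun N M => ?_⟩
  · have h1 : 0 ≤ ∑' n : ℕ, (n : ℝ) ^ (-(8 / 5) : ℝ) := tsum_nonneg fun _ => by positivity
    have h2 : 0 ≤ ∑' n : ℕ, (n : ℝ) ^ (-(12 / 5) : ℝ) := tsum_nonneg fun _ => by positivity
    positivity
  set I : Finset ℕ := (Finset.Icc 1 N ×ˢ Finset.Icc 1 N).image fun b => b.1 ^ 2 * b.2 ^ 3 with hI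
  have hsub : (omegaSmooth 1 N M).filter (fun q => ¬ q.Prime) ⊆ I := by
    intro q hq
    obtain ⟨hq, hqp⟩ := Finset.mem_filter.1 hq
    obtain ⟨⟨hq1, hqN⟩, hc, -⟩ := mem_omegaSmooth.1 hq
    obtain ⟨p, a, hp, ha, rfl⟩ :=
      (isPrimePow_nat_iff q).1 (isPrimePow_iff_card_primeFactors_eq_one.2 hc)
    have ha2 : a ≠ 1 := by
      rintro rfl
      exact hqp (by rwa [pow_one])
    have hle : ∀ b ≤ a, p ^ b ≤ N := fun b hb => (Nat.pow_le_pow_right hp.pos hb).trans hqN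
    rw [hI, Finset.mem_image]
    rcases Nat.even_or_odd' a with ⟨s, rfl | rfl⟩
    · refine ⟨(p ^ s, 1), ?_, by ring⟩
      simp only [Finset.mem_product, Finset.mem_Icc]
      exact ⟨⟨Nat.pow_pos hp.pos, hle s (by omega)⟩, le_rfl, hq1.trans hqN⟩
    · obtain ⟨r, rfl⟩ : ∃ r, s = r + 1 := ⟨s - 1, by omega⟩
      refine ⟨(p ^ r, p), ?_, by ring⟩
      simp only [Finset.mem_product, Finset.mem_Icc]
      exact ⟨⟨Nat.pow_pos hp.pos, hle r (by omega)⟩, hp.one_le, by simpa using hle 1 (by omega)⟩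
  calc ∑ q ∈ (omegaSmooth 1 N M).filter (fun q => ¬ q.Prime), (q : ℝ) ^ (-(4 / 5) : ℝ)
      ≤ ∑ q ∈ I,
          (q : ℝ) ^ (-(4 / 5) : ℝ) :=
        Finset.sum_le_sum_of_subset_of_nonneg hsub fun _ _ _ => by positivity
    _ ≤ ∑ b ∈ Finset.Icc 1 N ×ˢ Finset.Icc 1 N,
          ((b.1 ^ 2 * b.2 ^ 3 : ℕ) : ℝ) ^ (-(4 / 5) : ℝ) :=
        Finset.sum_image_le_of_nonneg fun _ _ => by positivity
    _ = ∑ b ∈ Finset.Icc 1 N ×ˢ Finset.Icc 1 N,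
          (b.1 : ℝ) ^ (-(8 / 5) : ℝ) * (b.2 : ℝ) ^ (-(12 / 5) : ℝ) := by
        refine Finset.sum_congr rfl fun b _ => ?_
        push_cast
        rw [Real.mul_rpow (by positivity) (by positivity), ← Real.rpow_natCast_mul (by positivity),
          ← Real.rpow_natCast_mul (by positivity)]
        norm_num
    _ = (∑ b ∈ Finset.Icc 1 N, (b : ℝ) ^ (-(8 / 5) : ℝ)) *
          ∑ c ∈ Finset.Icc 1 N, (c : ℝ) ^ (-(12 / 5) : ℝ) := by
        rw [Finset.sum_mul_sum, Finset.sum_product]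
    _ ≤ (∑' n : ℕ, (n : ℝ) ^ (-(8 / 5) : ℝ)) * (∑' n : ℕ, (n : ℝ) ^ (-(12 / 5) : ℝ)) := by
        have h1 : 0 ≤ ∑' n : ℕ, (n : ℝ) ^ (-(8 / 5) : ℝ) := tsum_nonneg fun _ => by positivity
        exact mul_le_mul (hs1.sum_le_tsum _ fun _ _ => by positivity)
          (hs2.sum_le_tsum _ fun _ _ => by positivity)
          (Finset.sum_nonneg fun _ _ => by positivity) h1
    _ ≤ _ := by linarith

lemma exists_sum_rpow_omegaSmooth_one_le : ∃ D : ℝ, 0 < D ∧ ∀ (N : ℕ) (x y α : ℝ), 4 ≤ y →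
    y ≤ x → 0 ≤ α → α ≤ 1 / 5 → α * Real.log y ≤ 1 →
      ∑ q ∈ omegaSmooth 1 N ⌊y⌋₊, (q : ℝ) ^ (α - 1) ≤ primeRecip ⌊x⌋₊ + D := by
  obtain ⟨D, hD, h⟩ := exists_sum_not_prime_le
  refine ⟨D + 6, by positivity, fun N x y α hy hyx hα hα' hαy => ?_⟩
  rw [← Finset.sum_filter_add_sum_filter_not _ (fun q : ℕ => q.Prime)]
  have hsub : (omegaSmooth 1 N ⌊y⌋₊).filter (fun q => q.Prime) ⊆ Nat.primesLE ⌊y⌋₊ := by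
    intro q hq
    obtain ⟨hq1, hq2⟩ := Finset.mem_filter.1 hq
    exact Nat.mem_primesLE.2 ⟨(mem_omegaSmooth.1 hq1).2.2 q
      (Nat.mem_primeFactors.2 ⟨hq2, dvd_rfl, hq2.ne_zero⟩), hq2⟩
  have h1 := sum_rpow_le_sum_inv_add hy hα hαy hsub
  have h2 : ∑ p ∈ (omegaSmooth 1 N ⌊y⌋₊).filter (fun q => q.Prime), (p : ℝ)⁻¹ ≤
      primeRecip ⌊x⌋₊ :=
    (Finset.sum_le_sum_of_subset_of_nonneg hsub fun _ _ _ => by positivity).trans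
      (primeRecip_mono (Nat.floor_mono hyx))
  have h3 : ∑ q ∈ (omegaSmooth 1 N ⌊y⌋₊).filter (fun q => ¬ q.Prime), (q : ℝ) ^ (α - 1) ≤ D := by
    refine (Finset.sum_le_sum fun q hq => ?_).trans (h N ⌊y⌋₊)
    have hq1 := (mem_omegaSmooth.1 (Finset.mem_filter.1 hq).1).1.1
    exact Real.rpow_le_rpow_of_exponent_le (by exact_mod_cast hq1) (by linarith)
  linarith

lemma exists_sum_rpow_mul_log_le : ∃ C : ℝ, 0 < C ∧ ∀ (N : ℕ) (y α z : ℝ), 1 ≤ y → 0 ≤ z →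
    0 ≤ α → α ≤ 1 / 10 → α * Real.log y ≤ 1 →
      ∑ q ∈ (omegaSmooth 1 N ⌊y⌋₊).filter (fun q : ℕ => (q : ℝ) ≤ z),
        (q : ℝ) ^ α * Real.log q ≤ C * z := by
  obtain ⟨D, hD, h⟩ := exists_sum_not_prime_le
  refine ⟨3 * Real.log 4 + 10 * D, by positivity, fun N y α z hy hz hα hα' hαy => ?_⟩
  set Q := (omegaSmooth 1 N ⌊y⌋₊).filter (fun q : ℕ => (q : ℝ) ≤ z) with hQ
  have hmem : ∀ q ∈ Q, (1 : ℝ) ≤ q ∧ (q : ℝ) ≤ z ∧ ∀ p ∈ q.primeFactors, p ≤ ⌊y⌋₊ := by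
    intro q hq
    obtain ⟨hq1, hq2⟩ := Finset.mem_filter.1 hq
    obtain ⟨hq3, -, hq4⟩ := mem_omegaSmooth.1 hq1
    exact ⟨by exact_mod_cast hq3.1, hq2, hq4⟩
  rw [← Finset.sum_filter_add_sum_filter_not Q (fun q : ℕ => q.Prime), add_mul]
  refine add_le_add ?_ ?_
  · have hθ := Chebyshev.theta_le_log4_mul_x hz
    rw [Chebyshev.theta_eq_sum_primesLE] at hθ
    calc ∑ q ∈ Q.filter (fun q => q.Prime), (q : ℝ) ^ α * Real.log q
        ≤ ∑ q ∈ Q.filter (fun q => q.Prime), 3 * Real.log q := by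
          refine Finset.sum_le_sum fun q hq => ?_
          obtain ⟨hq1, hq2⟩ := Finset.mem_filter.1 hq
          obtain ⟨h1, -, h3⟩ := hmem q hq1
          refine mul_le_mul_of_nonneg_right ?_ (Real.log_natCast_nonneg q)
          have hqy : (q : ℝ) ≤ y := (Nat.le_floor_iff (by linarith)).1
            (h3 q (Nat.mem_primeFactors.2 ⟨hq2, dvd_rfl, hq2.ne_zero⟩))
          rw [Real.rpow_def_of_pos (by linarith)]
          have : Real.log q * α ≤ 1 := by
            refine le_trans ?_ hαy
            rw [mul_comm]
            gcongr
          exact (Real.exp_le_exp.2 this).trans (by linarith [Real.exp_one_lt_d9])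
      _ = 3 * ∑ q ∈ Q.filter (fun q => q.Prime), Real.log q := by rw [Finset.mul_sum]
      _ ≤ 3 * ∑ q ∈ Nat.primesLE ⌊z⌋₊, Real.log q := by
          refine mul_le_mul_of_nonneg_left (Finset.sum_le_sum_of_subset_of_nonneg ?_
            fun q _ _ => Real.log_natCast_nonneg q) (by norm_num)
          intro q hq
          obtain ⟨hq1, hq2⟩ := Finset.mem_filter.1 hq
          exact Nat.mem_primesLE.2 ⟨Nat.le_floor (hmem q hq1).2.1, hq2⟩
      _ ≤ 3 * Real.log 4 * z := by linarith
  · calc ∑ q ∈ Q.filter (fun q => ¬ q.Prime), (q : ℝ) ^ α * Real.log q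
        ≤ ∑ q ∈ Q.filter (fun q => ¬ q.Prime), 10 * z * (q : ℝ) ^ (-(4 / 5) : ℝ) := by
          refine Finset.sum_le_sum fun q hq => ?_
          obtain ⟨h1, h2, -⟩ := hmem q (Finset.mem_filter.1 hq).1
          have hq0 : (0 : ℝ) < q := by linarith
          have hlog := Real.log_le_rpow_div hq0.le (show (0 : ℝ) < 1 / 10 by norm_num)
          have hα1 : (q : ℝ) ^ α ≤ (q : ℝ) ^ (1 / 10 : ℝ) :=
            Real.rpow_le_rpow_of_exponent_le h1 hα'
          calc (q : ℝ) ^ α * Real.log q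
              ≤ (q : ℝ) ^ (1 / 10 : ℝ) * ((q : ℝ) ^ (1 / 10 : ℝ) / (1 / 10)) := by
                have := Real.log_nonneg h1
                gcongr
            _ = 10 * ((q : ℝ) ^ (1 / 10 : ℝ) * (q : ℝ) ^ (1 / 10 : ℝ)) := by ring
            _ = 10 * (q * (q : ℝ) ^ (-(4 / 5) : ℝ)) := by
                rw [← Real.rpow_add hq0, ← Real.rpow_one_add' hq0.le (by norm_num)]
                norm_num
            _ ≤ 10 * (z * (q : ℝ) ^ (-(4 / 5) : ℝ)) := by gcongr
            _ = _ := by ring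
      _ = 10 * z * ∑ q ∈ Q.filter (fun q => ¬ q.Prime), (q : ℝ) ^ (-(4 / 5) : ℝ) := by
          rw [Finset.mul_sum]
      _ ≤ 10 * z * D := by
          gcongr
          refine le_trans (Finset.sum_le_sum_of_subset_of_nonneg ?_
            fun _ _ _ => by positivity) (h N ⌊y⌋₊)
          exact Finset.filter_subset_filter _ (Finset.filter_subset _ _)
      _ = 10 * D * z := by ring

lemma log_eq_sum_log_ordProj {n : ℕ} (hn : n ≠ 0) :
    Real.log n = ∑ p ∈ n.primeFactors, Real.log ((p ^ n.factorization p : ℕ) : ℝ) := by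
  conv_lhs => rw [← Nat.prod_factorization_pow_eq_self hn]
  rw [Finsupp.prod, Nat.cast_prod, Real.log_prod, Nat.support_factorization]
  intro p hp
  have := (Nat.prime_of_mem_primeFactors hp).pos
  positivity

lemma exists_sum_rpow_mul_log_omegaSmooth_le : ∃ C D : ℝ, 0 < C ∧ 0 < D ∧
    ∀ (x y α : ℝ) (j : ℕ), 4 ≤ y → y ≤ x → 0 ≤ α → α ≤ 1 / 10 → α * Real.log y ≤ 1 →
      ∑ n ∈ omegaSmooth (j + 1) ⌊x⌋₊ ⌊y⌋₊, (n : ℝ) ^ α * Real.log n ≤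
        C * x * ((primeRecip ⌊x⌋₊ + D) ^ j / j.factorial) := by
  obtain ⟨D, hD, hS⟩ := exists_sum_rpow_omegaSmooth_one_le
  obtain ⟨C, hC, hT⟩ := exists_sum_rpow_mul_log_le
  refine ⟨C, D, hC, hD, fun x y α j hy hyx hα hα' hαy => ?_⟩
  have hx0 : 0 < x := by linarith
  have h := sum_primeFactors_le_sum_omegaSmooth
    (F := fun m q => (m : ℝ) ^ α * ((q : ℝ) ^ α * Real.log q))
    (fun m q => mul_nonneg (by positivity) (mul_nonneg (by positivity)
      (Real.log_natCast_nonneg q))) j ⌊x⌋₊ ⌊y⌋₊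
  have hl : ∑ n ∈ omegaSmooth (j + 1) ⌊x⌋₊ ⌊y⌋₊, (n : ℝ) ^ α * Real.log n =
      ∑ n ∈ omegaSmooth (j + 1) ⌊x⌋₊ ⌊y⌋₊, ∑ p ∈ n.primeFactors,
        ((n / p ^ n.factorization p : ℕ) : ℝ) ^ α * (((p ^ n.factorization p : ℕ) : ℝ) ^ α *
          Real.log ((p ^ n.factorization p : ℕ) : ℝ)) := by
    refine Finset.sum_congr rfl fun n hn => ?_
    have hn0 : n ≠ 0 := by have := (mem_omegaSmooth.1 hn).1.1; omega
    rw [log_eq_sum_log_ordProj hn0, Finset.mul_sum]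
    refine Finset.sum_congr rfl fun p _ => ?_
    rw [← mul_assoc, ← Real.mul_rpow (by positivity) (by positivity), ← Nat.cast_mul,
      mul_comm (n / _), Nat.ordProj_mul_ordCompl_eq_self]
  rw [hl]
  refine h.trans ?_
  calc ∑ m ∈ omegaSmooth j ⌊x⌋₊ ⌊y⌋₊,
        ∑ q ∈ (omegaSmooth 1 ⌊x⌋₊ ⌊y⌋₊).filter (fun q => m * q ≤ ⌊x⌋₊),
          (m : ℝ) ^ α * ((q : ℝ) ^ α * Real.log q)
      ≤ ∑ m ∈ omegaSmooth j ⌊x⌋₊ ⌊y⌋₊, C * x * (m : ℝ) ^ (α - 1) := by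
        refine Finset.sum_le_sum fun m hm => ?_
        have hm0 : (0 : ℝ) < m := by exact_mod_cast (mem_omegaSmooth.1 hm).1.1
        rw [← Finset.mul_sum]
        calc (m : ℝ) ^ α * ∑ q ∈ (omegaSmooth 1 ⌊x⌋₊ ⌊y⌋₊).filter (fun q => m * q ≤ ⌊x⌋₊),
              (q : ℝ) ^ α * Real.log q
            ≤ (m : ℝ) ^ α * ∑ q ∈ (omegaSmooth 1 ⌊x⌋₊ ⌊y⌋₊).filter
                (fun q : ℕ => (q : ℝ) ≤ x / m), (q : ℝ) ^ α * Real.log q := by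
              refine mul_le_mul_of_nonneg_left (Finset.sum_le_sum_of_subset_of_nonneg ?_
                fun q _ _ => mul_nonneg (by positivity) (Real.log_natCast_nonneg q))
                (by positivity)
              refine Finset.monotone_filter_right _ fun q _ hq => ?_
              have := (Nat.le_floor_iff hx0.le).1 hq
              push_cast at this
              rw [le_div_iff₀ hm0]
              linarith
          _ ≤ (m : ℝ) ^ α * (C * (x / m)) := by
              gcongr
              exact hT _ y α _ (by linarith) (by positivity) hα hα' hαy
          _ = C * x * (m : ℝ) ^ (α - 1) := by
              rw [Real.rpow_sub hm0, Real.rpow_one]; ring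
    _ = C * x * ∑ m ∈ omegaSmooth j ⌊x⌋₊ ⌊y⌋₊, (m : ℝ) ^ (α - 1) := by rw [Finset.mul_sum]
    _ ≤ C * x * ((∑ q ∈ omegaSmooth 1 ⌊x⌋₊ ⌊y⌋₊, (q : ℝ) ^ (α - 1)) ^ j / j.factorial) := by
        gcongr
        exact sum_rpow_omegaSmooth_le _ _ _ _
    _ ≤ _ := by
        have : 0 ≤ ∑ q ∈ omegaSmooth 1 ⌊x⌋₊ ⌊y⌋₊, (q : ℝ) ^ (α - 1) :=
          Finset.sum_nonneg fun _ _ => by positivity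
        gcongr
        exact hS _ x y α hy hyx hα (by linarith) hαy

lemma exists_piky_le : ∃ C D : ℝ, 0 < C ∧ 0 < D ∧ ∀ (x y : ℝ) (j : ℕ), 7 ≤ Real.log y →
    1 ≤ y → y ≤ x → (piky (j + 1) x y : ℝ) ≤ x ^ (3 / 4 : ℝ) +
      C * (x / Real.log x) * ((primeRecip ⌊x⌋₊ + D) ^ j / j.factorial) *
        Real.exp (-(Real.log x / Real.log y) / 2) := by
  obtain ⟨C, D, hC, hD, h⟩ := exists_sum_rpow_mul_log_omegaSmooth_le
  refine ⟨C * (4 / 3), D, by positivity, hD, fun x y j hy hy1 hyx => ?_⟩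
  have hx0 : 0 < x := by linarith
  have hlx : 0 < Real.log x := by
    have := Real.log_le_log (by linarith) hyx
    linarith
  have hly : 0 < Real.log y := by linarith
  have hy4 : 4 ≤ y := by
    have := Real.log_le_sub_one_of_pos (show 0 < y by linarith)
    linarith
  set α := 2 / (3 * Real.log y) with hα
  have hα0 : 0 ≤ α := by positivity
  have hα1 : α ≤ 1 / 10 := by
    rw [hα, div_le_div_iff₀ (by positivity) (by norm_num)]
    linarith
  have hαy : α * Real.log y ≤ 1 := by
    have : α * Real.log y = 2 / 3 := by rw [hα]; field_simp
    linarith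
  have hmain := h x y α j hy4 hyx hα0 hα1 hαy
  have hexp : x ^ (-(3 / 4 * α)) = Real.exp (-(Real.log x / Real.log y) / 2) := by
    rw [Real.rpow_def_of_pos hx0]
    congr 1
    rw [hα]
    field_simp
    norm_num
  rw [piky_eq_card_omegaSmooth _ (by linarith)]
  set Ω := omegaSmooth (j + 1) ⌊x⌋₊ ⌊y⌋₊ with hΩ
  rw [← Finset.card_filter_add_card_filter_not (s := Ω) (fun n : ℕ => (n : ℝ) ≤ x ^ (3 / 4 : ℝ))]
  push_cast
  refine add_le_add ?_ ?_
  · have hsub : Ω.filter (fun n : ℕ => (n : ℝ) ≤ x ^ (3 / 4 : ℝ)) ⊆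
        Finset.Icc 1 ⌊x ^ (3 / 4 : ℝ)⌋₊ := by
      intro n hn
      obtain ⟨h1, h2⟩ := Finset.mem_filter.1 hn
      exact Finset.mem_Icc.2 ⟨(mem_omegaSmooth.1 h1).1.1, Nat.le_floor h2⟩
    have := Finset.card_le_card hsub
    rw [Nat.card_Icc, Nat.add_sub_cancel] at this
    exact (Nat.cast_le.2 this).trans (Nat.floor_le (by positivity))
  · calc ((Ω.filter (fun n : ℕ => ¬ (n : ℝ) ≤ x ^ (3 / 4 : ℝ))).card : ℝ)
        = ∑ n ∈ Ω.filter (fun n : ℕ => ¬ (n : ℝ) ≤ x ^ (3 / 4 : ℝ)), (1 : ℝ) := by simp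
      _ ≤ ∑ n ∈ Ω.filter (fun n : ℕ => ¬ (n : ℝ) ≤ x ^ (3 / 4 : ℝ)),
            x ^ (-(3 / 4 * α)) * (4 / 3 / Real.log x) * ((n : ℝ) ^ α * Real.log n) := by
          refine Finset.sum_le_sum fun n hn => ?_
          have hn' := not_le.1 (Finset.mem_filter.1 hn).2
          have hx34 : 0 < x ^ (3 / 4 : ℝ) := by positivity
          have h1 : x ^ (3 / 4 * α) ≤ (n : ℝ) ^ α := by
            rw [Real.rpow_mul hx0.le]
            gcongr
          have h2 : 3 / 4 * Real.log x ≤ Real.log n := by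
            rw [← Real.log_rpow hx0]
            exact Real.log_le_log hx34 hn'.le
          calc (1 : ℝ) = x ^ (-(3 / 4 * α)) * (4 / 3 / Real.log x) *
                (x ^ (3 / 4 * α) * (3 / 4 * Real.log x)) := by
                rw [Real.rpow_neg hx0.le]; field_simp
            _ ≤ _ := by gcongr
      _ ≤ ∑ n ∈ Ω, x ^ (-(3 / 4 * α)) * (4 / 3 / Real.log x) * ((n : ℝ) ^ α * Real.log n) :=
          Finset.sum_le_sum_of_subset_of_nonneg (Finset.filter_subset _ _) fun n _ _ =>
            mul_nonneg (by positivity) (mul_nonneg (by positivity) (Real.log_natCast_nonneg n))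
      _ = x ^ (-(3 / 4 * α)) * (4 / 3 / Real.log x) *
            ∑ n ∈ Ω, (n : ℝ) ^ α * Real.log n := by rw [Finset.mul_sum]
      _ ≤ x ^ (-(3 / 4 * α)) * (4 / 3 / Real.log x) *
            (C * x * ((primeRecip ⌊x⌋₊ + D) ^ j / j.factorial)) := by gcongr
      _ = _ := by rw [hexp]; ring

lemma eventually_rpow_le_pik {R : ℝ} (hR : 0 < R) :
    ∀ᶠ x : ℝ in Filter.atTop, ∀ j : ℕ, (j : ℝ) ≤ R * Real.log (Real.log x) →
      x ^ (9 / 10 : ℝ) ≤ pik (j + 1) x := by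
  obtain ⟨c, hc, h⟩ := eventually_le_pik hR
  set B := R * Real.log (2 * R + 1) with hB
  have ho := (isLittleO_log_rpow_rpow_atTop (1 + B) (show (0 : ℝ) < 1 / 10 by norm_num)).bound hc
  filter_upwards [h, ho, Filter.eventually_ge_atTop 3,
    (Real.tendsto_log_atTop.comp Real.tendsto_log_atTop).eventually_gt_atTop 0]
    with x h1 h2 h3 h4 j hj
  simp only [Function.comp_apply] at h4
  have hx0 : 0 < x := by linarith
  have hlx : 0 < Real.log x := Real.log_pos (by linarith)
  rw [Real.norm_of_nonneg (by positivity), Real.norm_of_nonneg (by positivity)] at h2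
  refine le_trans ?_ (h1 j hj)
  set P := primeRecip ⌊x⌋₊
  have hP : Real.log (Real.log x) ≤ 2 * P := log_log_le_two_mul_primeRecip (by linarith)
  have hP0 : 0 < P := by linarith
  have hjP : (j : ℝ) ≤ (2 * R + 1) * P := by nlinarith
  have hfac : (j.factorial : ℝ) ≤ ((2 * R + 1) * P) ^ j := by
    calc (j.factorial : ℝ) ≤ (j : ℝ) ^ j := by exact_mod_cast Nat.factorial_le_pow j
      _ ≤ _ := by gcongr
  have hpow : (2 * R + 1) ^ j ≤ Real.log x ^ B := by
    rw [Real.rpow_def_of_pos hlx, ← Real.exp_log (show 0 < 2 * R + 1 by linarith),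
      ← Real.exp_nat_mul]
    refine Real.exp_le_exp.2 ?_
    have : 0 ≤ Real.log (2 * R + 1) := Real.log_nonneg (by linarith)
    calc (j : ℝ) * Real.log (2 * R + 1) ≤ R * Real.log (Real.log x) * Real.log (2 * R + 1) := by
          gcongr
      _ = _ := by rw [hB]; ring
  have hlow : (Real.log x ^ B)⁻¹ ≤ P ^ j / j.factorial := by
    calc (Real.log x ^ B)⁻¹ ≤ ((2 * R + 1) ^ j)⁻¹ := inv_anti₀ (by positivity) hpow
      _ = P ^ j / ((2 * R + 1) * P) ^ j := by rw [mul_pow]; field_simp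
      _ ≤ _ := by gcongr
  calc x ^ (9 / 10 : ℝ) = x ^ (9 / 10 : ℝ) * Real.log x ^ (1 + B) / Real.log x ^ (1 + B) := by
        field_simp
    _ ≤ x ^ (9 / 10 : ℝ) * (c * x ^ (1 / 10 : ℝ)) / Real.log x ^ (1 + B) := by gcongr
    _ = c * (x ^ (9 / 10 : ℝ) * x ^ (1 / 10 : ℝ)) / Real.log x ^ (1 + B) := by ring
    _ = c * x / (Real.log x * Real.log x ^ B) := by
        rw [← Real.rpow_add hx0, Real.rpow_add hlx, Real.rpow_one]
        norm_num
    _ = c * (x / Real.log x) * (Real.log x ^ B)⁻¹ := by field_simp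
    _ ≤ _ := by gcongr

lemma exists_piky_le_rpow (b : ℝ) : ∃ C : ℝ, 0 < C ∧ ∀ (k : ℕ) (x y : ℝ), 0 < x → 0 ≤ y →
    y ≤ b → (piky k x y : ℝ) ≤ C * x ^ (1 / 10 : ℝ) := by
  let f : ℕ →* ℝ :=
    { toFun := fun n => (n : ℝ) ^ (-(1 / 10) : ℝ)
      map_one' := by simp
      map_mul' := fun a b => by
        push_cast
        rw [Real.mul_rpow (by positivity) (by positivity)] }
  have hf : ∀ n : ℕ, f n = (n : ℝ) ^ (-(1 / 10) : ℝ) := fun n => rfl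
  have hf0 : ∀ n : ℕ, 0 ≤ f n := fun n => by rw [hf]; positivity
  obtain ⟨-, hhas⟩ := EulerProduct.summable_and_hasSum_smoothNumbers_prod_primesBelow_geometric
    (f := f) (fun {p} hp => by
      rw [Real.norm_of_nonneg (hf0 p), hf]
      exact Real.rpow_lt_one_of_one_lt_of_neg (by exact_mod_cast hp.one_lt) (by norm_num))
    (⌊b⌋₊ + 1)
  refine ⟨(∑' m : (⌊b⌋₊ + 1).smoothNumbers, f m) + 1, ?_, fun k x y hx hy hyb => ?_⟩
  · have : 0 ≤ ∑' m : (⌊b⌋₊ + 1).smoothNumbers, f m := tsum_nonneg fun m => hf0 m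
    positivity
  rw [piky_eq_card_omegaSmooth _ hy]
  set Ω := omegaSmooth k ⌊x⌋₊ ⌊y⌋₊ with hΩ
  have hsum : ∑ n ∈ Ω, f n ≤ ∑' m : (⌊b⌋₊ + 1).smoothNumbers, f m := by
    have : ∑ n ∈ Ω, f n = ∑ m ∈ Ω.subtype (· ∈ (⌊b⌋₊ + 1).smoothNumbers), f m := by
      rw [Finset.sum_subtype_of_mem (fun n => f n)]
      intro n hn
      obtain ⟨⟨hn1, -⟩, -, hM⟩ := mem_omegaSmooth.1 hn
      rw [Nat.mem_smoothNumbers']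
      intro p hp hpn
      exact Nat.lt_succ_of_le ((hM p (Nat.mem_primeFactors.2 ⟨hp, hpn, by omega⟩)).trans
        (Nat.floor_mono hyb))
    rw [this]
    exact hhas.summable.sum_le_tsum _ fun m _ => hf0 m
  calc (Ω.card : ℝ) = ∑ n ∈ Ω, (1 : ℝ) := by simp
    _ ≤ ∑ n ∈ Ω, x ^ (1 / 10 : ℝ) * f n := by
        refine Finset.sum_le_sum fun n hn => ?_
        obtain ⟨⟨hn1, hn2⟩, -⟩ := mem_omegaSmooth.1 hn
        have hn0 : (0 : ℝ) < n := by exact_mod_cast hn1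
        have hnx : (n : ℝ) ≤ x := (Nat.le_floor_iff hx.le).1 hn2
        rw [hf]
        calc (1 : ℝ) = (n : ℝ) ^ (1 / 10 : ℝ) * (n : ℝ) ^ (-(1 / 10) : ℝ) := by
              rw [← Real.rpow_add hn0]; simp
          _ ≤ _ := by gcongr
    _ = x ^ (1 / 10 : ℝ) * ∑ n ∈ Ω, f n := by rw [Finset.mul_sum]
    _ ≤ x ^ (1 / 10 : ℝ) * ((∑' m : (⌊b⌋₊ + 1).smoothNumbers, f m) + 1) := by
        gcongr
        linarith
    _ = _ := by ring

lemma piky_le_pik (k : ℕ) (x y : ℝ) : piky k x y ≤ pik k x :=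
  Finset.card_le_card (Finset.monotone_filter_right _ fun _ _ h => h.1)

lemma rpow_le_rpow_mul_exp_neg_log_div {x y a b t : ℝ} (hx : 1 ≤ x) (ha : 0 < a)
    (hy : a ≤ Real.log y) (htb : t + 1 / (2 * a) ≤ b) :
    x ^ t ≤ x ^ b * Real.exp (-(Real.log x / Real.log y) / 2) := by
  have hx0 : 0 < x := by linarith
  have hlx : 0 ≤ Real.log x := Real.log_nonneg hx
  rw [Real.rpow_def_of_pos hx0, Real.rpow_def_of_pos hx0, ← Real.exp_add]
  refine Real.exp_le_exp.2 ?_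
  have h1 : Real.log x / Real.log y ≤ Real.log x / a := by gcongr
  have h2 := mul_le_mul_of_nonneg_left htb hlx
  have h3 : Real.log x * (t + 1 / (2 * a)) = Real.log x * t + Real.log x / a / 2 := by
    field_simp
  linarith

/-- Uniformly for `x ≥ 3`, `1 ≤ k ≪ log log x`, `2 ≤ y ≤ x`, and `u := log x / log y`,
one has `π_k(x,y) ≪ π_k(x) e^{−u/2}`. -/
theorem stmt_6 (R : ℝ) (hR : 0 < R) :
    ∃ C : ℝ, 0 < C ∧ ∀ (x y : ℝ) (k : ℕ), 3 ≤ x → 1 ≤ k →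
      (k : ℝ) ≤ R * Real.log (Real.log x) → 2 ≤ y → y ≤ x →
      (piky k x y : ℝ) ≤
        C * (pik k x : ℝ) * Real.exp (-(Real.log x / Real.log y) / 2) := by
  obtain ⟨c, hc, hpik⟩ := eventually_le_pik hR
  obtain ⟨x₀, hx₀⟩ := Filter.eventually_atTop.1 (hpik.and (eventually_rpow_le_pik hR))
  obtain ⟨C₁, D, hC₁, hD, hlarge⟩ := exists_piky_le
  obtain ⟨C₂, hC₂, hsmall⟩ := exists_piky_le_rpow (Real.exp 7)
  set C₃ := Real.exp (Real.log (max x₀ 3) / (2 * Real.log 2)) with hC₃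
  set C₄ := C₁ / c * Real.exp (D * (2 * R)) with hC₄
  have hl2 := Real.log_two_gt_d9
  refine ⟨C₂ + C₃ + (1 + C₄), by positivity, fun x y k hx hk hkx hy hyx => ?_⟩
  have hx0 : 0 < x := by linarith
  have hlx : 0 < Real.log x := Real.log_pos (by linarith)
  have hly2 : Real.log 2 ≤ Real.log y := Real.log_le_log (by norm_num) hy
  set E := Real.exp (-(Real.log x / Real.log y) / 2) with hE
  have hE0 : 0 < E := Real.exp_pos _
  have hmono : ∀ {A : ℝ}, A ≤ C₂ + C₃ + (1 + C₄) → (piky k x y : ℝ) ≤ A * pik k x * E →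
      (piky k x y : ℝ) ≤ (C₂ + C₃ + (1 + C₄)) * pik k x * E := fun hA h =>
    h.trans (by gcongr)
  have hC₃0 : 0 < C₃ := Real.exp_pos _
  have hC₄0 : 0 < C₄ := by positivity
  rcases lt_or_ge x x₀ with hxx | hxx
  · refine hmono (A := C₃) (by linarith) ?_
    have h1 : 1 ≤ C₃ * E := by
      rw [hC₃, hE, ← Real.exp_add, Real.one_le_exp_iff]
      have h2 : Real.log x / Real.log y ≤ Real.log (max x₀ 3) / Real.log 2 := by
        have h := Real.log_le_log hx0 (hxx.le.trans (le_max_left x₀ 3))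
        have h0 := hlx.le.trans h
        gcongr
      have h3 : Real.log (max x₀ 3) / (2 * Real.log 2) =
          Real.log (max x₀ 3) / Real.log 2 / 2 := by field_simp
      linarith
    calc (piky k x y : ℝ) ≤ pik k x := by exact_mod_cast piky_le_pik k x y
      _ ≤ pik k x * (C₃ * E) := le_mul_of_one_le_right (by positivity) h1
      _ = _ := by ring
  obtain ⟨hpik1, hpik2⟩ := hx₀ x hxx
  obtain ⟨j, rfl⟩ : ∃ j, k = j + 1 := ⟨k - 1, by omega⟩
  have hj : (j : ℝ) ≤ R * Real.log (Real.log x) := by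
    push_cast at hkx
    linarith
  have hlow := hpik1 j hj
  have hpow := hpik2 j hj
  rcases le_total (Real.log y) 7 with hly | hly
  · refine hmono (A := C₂) (by linarith) ?_
    have hyb : y ≤ Real.exp 7 := (Real.log_le_iff_le_exp (by linarith)).1 hly
    have h1 : x ^ (1 / 10 : ℝ) ≤ x ^ (9 / 10 : ℝ) * E := by
      refine rpow_le_rpow_mul_exp_neg_log_div (a := 5 / 8) (by linarith) (by norm_num) (by linarith) ?_
      norm_num
    calc (piky (j + 1) x y : ℝ) ≤ C₂ * x ^ (1 / 10 : ℝ) := hsmall _ x y hx0 (by linarith) hyb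
      _ ≤ C₂ * (x ^ (9 / 10 : ℝ) * E) := by gcongr
      _ ≤ C₂ * (pik (j + 1) x * E) := by gcongr
      _ = _ := by ring
  · refine hmono (A := 1 + C₄) (by linarith) ?_
    set P := primeRecip ⌊x⌋₊
    have hll : 0 < Real.log (Real.log x) := by
      refine Real.log_pos ((Real.lt_log_iff_exp_lt hx0).2 ?_)
      linarith [Real.exp_one_lt_d9]
    have hP : Real.log (Real.log x) ≤ 2 * P := log_log_le_two_mul_primeRecip (by linarith)
    have hPj : (P + D) ^ j ≤ P ^ j * Real.exp (D * (2 * R)) :=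
      add_pow_le_pow_mul_exp (by linarith) hD.le (by nlinarith)
    have h1 : x ^ (3 / 4 : ℝ) ≤ x ^ (9 / 10 : ℝ) * E :=
      rpow_le_rpow_mul_exp_neg_log_div (by linarith) (by norm_num) hly (by norm_num)
    calc (piky (j + 1) x y : ℝ)
        ≤ x ^ (3 / 4 : ℝ) + C₁ * (x / Real.log x) * ((P + D) ^ j / j.factorial) * E :=
          hlarge x y j hly (by linarith) hyx
      _ ≤ x ^ (9 / 10 : ℝ) * E + C₁ * (x / Real.log x) *
            (P ^ j * Real.exp (D * (2 * R)) / j.factorial) * E := by gcongr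
      _ = x ^ (9 / 10 : ℝ) * E + C₄ * (c * (x / Real.log x) * (P ^ j / j.factorial)) * E := by
          rw [hC₄]; field_simp
      _ ≤ pik (j + 1) x * E + C₄ * pik (j + 1) x * E := by gcongr
      _ = _ := by ring
end
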